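/- arXiv:2305.06427 — 11 statements merged into one kernel-verified Lean document; each statement's English description precedes it below -/
import Mathlib

section
/- Let p, q ∈ ℝ² be linearly independent and let P = conv{p, −p, q, −q} be the 0-symmetric parallelogram they span. Suppose (5/9)·C₂ ⊆ P ⊆ C₂. Then for every choice of signs ε₁, ε₂ ∈ {−1, 1}, the square W_{(ε₁,ε₂)} = {(x,y) ∈ ℝ² : 1/3 ≤ ε₁x ≤ 1 and 1/3 ≤ ε₂y ≤ 1} contains exactly one of the four points p, −p, q, −q. -/
open Set Pointwise

noncomputable section

/-- The unit cube in `ℝⁿ`. -/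
def cube (n : ℕ) : Set (Fin n → ℝ) := {x | ∀ i, |x i| ≤ 1}

/-- The cross-polytope (unit ball of the `ℓ¹` norm) in `ℝⁿ`. -/
def crossPoly (n : ℕ) : Set (Fin n → ℝ) := {x | ∑ i, |x i| ≤ 1}

/-- A convex body: compact, convex, nonempty interior. -/
def IsConvexBody {n : ℕ} (K : Set (Fin n → ℝ)) : Prop :=
  Convex ℝ K ∧ IsCompact K ∧ (interior K).Nonempty

/-- A centrally symmetric set: symmetric about some point `c`. -/
def IsSymmetricBody {n : ℕ} (L : Set (Fin n → ℝ)) : Prop :=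
  ∃ c : Fin n → ℝ, L = (fun x => (2 : ℝ) • c - x) '' L

/-- The Banach–Mazur distance. -/
def bmDist {n : ℕ} (K L : Set (Fin n → ℝ)) : ℝ :=
  sInf {r : ℝ | 0 < r ∧ ∃ (T : (Fin n → ℝ) ≃ₗ[ℝ] (Fin n → ℝ)) (u v : Fin n → ℝ),
    (fun x => x + u) '' K ⊆ ⇑T '' ((fun x => x + v) '' L) ∧
    ⇑T '' ((fun x => x + v) '' L) ⊆ r • ((fun x => x + u) '' K)}

/-- The asymmetry constant of a convex body. -/
def asymConst {n : ℕ} (K : Set (Fin n → ℝ)) : ℝ :=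
  sInf {r : ℝ | 0 < r ∧ ∃ z ∈ interior K,
    (fun x => x - z) '' K ⊆ (-r) • ((fun x => x - z) '' K)}

/-- The convex hull of `±p, ±q` lies in the unit ball of the norm obtained from Cramer's rule. -/
theorem convexHull_subset_cramer_ball (p q : Fin 2 → ℝ) :
    convexHull ℝ {p, -p, q, -q} ⊆
      {x | |x 0 * q 1 - x 1 * q 0| + |p 0 * x 1 - p 1 * x 0| ≤ |p 0 * q 1 - p 1 * q 0|} := by
  apply convexHull_min
  · rintro x (rfl | rfl | rfl | rfl)
    · simp [mul_comm]
    · simp only [mem_ofPred_eq, Pi.neg_apply]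
      rw [show -p 0 * q 1 - -p 1 * q 0 = -(p 0 * q 1 - p 1 * q 0) by ring,
        show p 0 * -p 1 - p 1 * -p 0 = 0 by ring, abs_neg, abs_zero, add_zero]
    · simp [mul_comm]
    · simp only [mem_ofPred_eq, Pi.neg_apply]
      rw [show -q 0 * q 1 - -q 1 * q 0 = 0 by ring,
        show p 0 * -q 1 - p 1 * -q 0 = -(p 0 * q 1 - p 1 * q 0) by ring, abs_neg, abs_zero,
        zero_add]
  · intro x hx y hy s t hs ht hst
    simp only [mem_ofPred_eq, Pi.add_apply, Pi.smul_apply, smul_eq_mul] at hx hy ⊢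
    have h₁ := abs_add_le (s * (x 0 * q 1 - x 1 * q 0)) (t * (y 0 * q 1 - y 1 * q 0))
    have h₂ := abs_add_le (s * (p 0 * x 1 - p 1 * x 0)) (t * (p 0 * y 1 - p 1 * y 0))
    rw [abs_mul, abs_mul, abs_of_nonneg hs, abs_of_nonneg ht] at h₁ h₂
    rw [show (s * x 0 + t * y 0) * q 1 - (s * x 1 + t * y 1) * q 0 =
        s * (x 0 * q 1 - x 1 * q 0) + t * (y 0 * q 1 - y 1 * q 0) by ring,
      show p 0 * (s * x 1 + t * y 1) - p 1 * (s * x 0 + t * y 0) =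
        s * (p 0 * x 1 - p 1 * x 0) + t * (p 0 * y 1 - p 1 * y 0) by ring]
    have h₃ := mul_le_mul_of_nonneg_left hx hs
    have h₄ := mul_le_mul_of_nonneg_left hy ht
    have h₅ : s * |p 0 * q 1 - p 1 * q 0| + t * |p 0 * q 1 - p 1 * q 0| =
        |p 0 * q 1 - p 1 * q 0| := by rw [← add_mul, hst, one_mul]
    linarith

/-- If `p = (a, b)` and `q = (c, d)` lie in the closed first quadrant of the unit square, then the
parallelogram spanned by `p` and `q` does not contain the point `(5/9, -5/9)`. -/
theorem abs_det_lt_of_nonneg {a b c d : ℝ} (ha : 0 ≤ a) (hb : 0 ≤ b) (hc : 0 ≤ c) (hd : 0 ≤ d)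
    (ha₁ : a ≤ 1) (hb₁ : b ≤ 1) (hc₁ : c ≤ 1) (hd₁ : d ≤ 1) (hD : a * d - b * c ≠ 0) :
    9 * |a * d - b * c| < 5 * (|d + c| + |a + b|) := by
  rw [abs_of_nonneg (add_nonneg hd hc), abs_of_nonneg (add_nonneg ha hb)]
  have h₁ := mul_nonneg ha hd
  have h₂ := mul_nonneg hb hc
  have h₃ := mul_le_of_le_one_right ha hd₁
  have h₄ := mul_le_of_le_one_left hd ha₁
  have h₅ := mul_le_of_le_one_right hb hc₁
  have h₆ := mul_le_of_le_one_left hc hb₁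
  rcases lt_or_gt_of_ne hD with h | h
  · rw [abs_of_neg h]; linarith
  · rw [abs_of_pos h]; linarith

theorem one_third_le_of_opposite_quadrants {a b c e : ℝ} (ha : 0 ≤ a) (hb : 0 ≤ b) (hc : 0 ≤ c)
    (he : 0 ≤ e) (hb₁ : b ≤ 1) (hc₁ : c ≤ 1) (hD : 0 < a * e + b * c)
    (h₁ : 5 * (c + e + (b - a)) ≤ 9 * (a * e + b * c))
    (h₂ : 5 * (c - e + (a + b)) ≤ 9 * (a * e + b * c))
    (h₃ : 5 * (e - c + (a + b)) ≤ 9 * (a * e + b * c))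
    (h₄ : 5 * (c + e + (a - b)) ≤ 9 * (a * e + b * c)) : 1 / 3 ≤ a := by
  by_contra! hlt
  have hae : 3 * (a * e) ≤ e := by nlinarith
  have hc_large : 5 / 9 ≤ c := by
    by_contra! hc₂
    have hbc : 9 * (b * c) ≤ 5 * b := by nlinarith
    have he₀ : e = 0 := by linarith
    subst he₀
    nlinarith
  have hb_large : 5 / 9 ≤ b := by
    by_contra! hb₂
    have hbc : 9 * (b * c) ≤ 5 * c := by nlinarith
    have he₀ : e = 0 := by linarith
    subst he₀
    nlinarith
  have hbc : 9 * (b * c) - 5 * b - 5 * c ≤ -1 := by nlinarith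
  have h₅ : 1 + 5 * (e - a) ≤ 9 * (a * e) := by linarith
  have h₆ : 1 + 5 * (a - e) ≤ 9 * (a * e) := by linarith
  nlinarith [mul_le_mul_of_nonneg_right h₅ (by linarith : 0 ≤ 9 * a + 5),
    mul_le_mul_of_nonneg_right h₆ (by linarith : 0 ≤ 5 - 9 * a)]

theorem one_third_le_abs {a b c d : ℝ} (ha₁ : |a| ≤ 1) (hb₁ : |b| ≤ 1) (hc₁ : |c| ≤ 1)
    (hd₁ : |d| ≤ 1) (hD : a * d - b * c ≠ 0)
    (h₁ : 5 * (|d - c| + |a - b|) ≤ 9 * |a * d - b * c|)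
    (h₂ : 5 * (|d + c| + |a + b|) ≤ 9 * |a * d - b * c|) : 1 / 3 ≤ |a| := by
  wlog ha : 0 ≤ a generalizing a b
  · have := @this (-a) (-b) (by rwa [abs_neg]) (by rwa [abs_neg])
      (by contrapose! hD; linarith)
      (by rwa [show -a - -b = -(a - b) by ring, abs_neg,
        show -a * d - -b * c = -(a * d - b * c) by ring, abs_neg])
      (by rwa [show -a + -b = -(a + b) by ring, abs_neg,
        show -a * d - -b * c = -(a * d - b * c) by ring, abs_neg]) (by linarith)
    rwa [abs_neg] at this
  wlog hb : 0 ≤ b generalizing b d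
  · exact @this (-d) (by rwa [abs_neg]) (-b) (by rwa [abs_neg])
      (by contrapose! hD; linarith)
      (by rwa [show -d - c = -(d + c) by ring, abs_neg, sub_neg_eq_add,
        show a * -d - -b * c = -(a * d - b * c) by ring, abs_neg])
      (by rwa [show -d + c = -(d - c) by ring, abs_neg, ← sub_eq_add_neg,
        show a * -d - -b * c = -(a * d - b * c) by ring, abs_neg]) (by linarith)
  wlog hc : 0 ≤ c generalizing c d
  · exact @this (-c) (by rwa [abs_neg]) (-d) (by rwa [abs_neg])
      (by contrapose! hD; linarith)
      (by rwa [show -d - -c = -(d - c) by ring, abs_neg,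
        show a * -d - b * -c = -(a * d - b * c) by ring, abs_neg])
      (by rwa [show -d + -c = -(d + c) by ring, abs_neg,
        show a * -d - b * -c = -(a * d - b * c) by ring, abs_neg]) (by linarith)
  rw [abs_of_nonneg ha] at ha₁ ⊢
  rw [abs_of_nonneg hb] at hb₁
  rw [abs_of_nonneg hc] at hc₁
  rcases le_total 0 d with hd | hd
  · rw [abs_of_nonneg hd] at hd₁
    exact absurd h₂ (abs_det_lt_of_nonneg ha hb hc hd ha₁ hb₁ hc₁ hd₁ hD).not_ge
  · have had := mul_nonpos_of_nonneg_of_nonpos ha hd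
    have hbc := mul_nonneg hb hc
    have hneg : a * d - b * c < 0 := lt_of_le_of_ne (by linarith) hD
    rw [abs_of_neg hneg] at h₁ h₂
    have := neg_abs_le (d - c)
    have := le_abs_self (a - b)
    have := neg_abs_le (a - b)
    have := le_abs_self (d + c)
    have := neg_abs_le (d + c)
    have := le_abs_self (a + b)
    exact one_third_le_of_opposite_quadrants (e := -d) ha hb hc (by linarith) hb₁ hc₁
      (by linarith) (by linarith) (by linarith) (by linarith) (by linarith)

/-- The points `(a, b)` and `(c, d)` do not lie in the same or in opposite open quadrants. -/
theorem mul_mul_mul_nonpos_of_det_bounds {a b c d : ℝ} (ha₁ : |a| ≤ 1) (hb₁ : |b| ≤ 1)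
    (hc₁ : |c| ≤ 1) (hd₁ : |d| ≤ 1) (hD : a * d - b * c ≠ 0)
    (h₁ : 5 * (|d - c| + |a - b|) ≤ 9 * |a * d - b * c|)
    (h₂ : 5 * (|d + c| + |a + b|) ≤ 9 * |a * d - b * c|) : (a * b) * (c * d) ≤ 0 := by
  by_contra! h
  have hsum : 5 * (|a| + |b| + |c| + |d|) ≤ 9 * |a * d - b * c| := by
    rcases pos_and_pos_or_neg_and_neg_of_mul_pos h with ⟨hab, hcd⟩ | ⟨hab, hcd⟩
    · rw [(abs_add_eq_add_abs_iff d c).2 (by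
          rcases pos_and_pos_or_neg_and_neg_of_mul_pos hcd with h | h
          exacts [.inl ⟨h.2.le, h.1.le⟩, .inr ⟨h.2.le, h.1.le⟩]),
        (abs_add_eq_add_abs_iff a b).2 (by
          rcases pos_and_pos_or_neg_and_neg_of_mul_pos hab with h | h
          exacts [.inl ⟨h.1.le, h.2.le⟩, .inr ⟨h.1.le, h.2.le⟩])] at h₂
      linarith
    · rw [sub_eq_add_neg, sub_eq_add_neg a, (abs_add_eq_add_abs_iff d (-c)).2 (by
          rcases mul_neg_iff.1 hcd with h | h
          exacts [.inr ⟨h.2.le, by linarith⟩, .inl ⟨h.2.le, by linarith⟩]),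
        (abs_add_eq_add_abs_iff a (-b)).2 (by
          rcases mul_neg_iff.1 hab with h | h
          exacts [.inl ⟨h.1.le, by linarith⟩, .inr ⟨h.1.le, by linarith⟩]), abs_neg, abs_neg] at h₁
      linarith
  have key : |(|a| * |d| - |b| * |c|)| = |a * d - b * c| := by
    rw [← abs_mul, ← abs_mul, ← sq_eq_sq_iff_abs_eq_abs, sub_sq, sub_sq, sq_abs, sq_abs,
      mul_assoc 2 |a * d|, ← abs_mul, abs_of_nonneg (by linarith : 0 ≤ a * d * (b * c))]
    ring
  have hlt := abs_det_lt_of_nonneg (abs_nonneg a) (abs_nonneg b) (abs_nonneg c) (abs_nonneg d)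
    ha₁ hb₁ hc₁ hd₁ (by rwa [← abs_ne_zero, key, abs_ne_zero])
  rw [key, abs_of_nonneg (by positivity : 0 ≤ |d| + |c|),
    abs_of_nonneg (by positivity : 0 ≤ |a| + |b|)] at hlt
  linarith

/-- If `u` and `v` lie in the first and fourth corner squares, then each corner square contains
exactly one of `±u, ±v`. -/
theorem existsUnique_mem_corner {u v : Fin 2 → ℝ} (hu₀ : u 0 ∈ Icc (1 / 3) 1)
    (hu₁ : u 1 ∈ Icc (1 / 3) 1) (hv₀ : v 0 ∈ Icc (1 / 3) 1) (hv₁ : v 1 ∈ Icc (-1) (-(1 / 3)))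
    {ε₁ ε₂ : ℝ} (hε₁ : ε₁ = 1 ∨ ε₁ = -1) (hε₂ : ε₂ = 1 ∨ ε₂ = -1) :
    ∃! x : Fin 2 → ℝ, x ∈ ({u, -u, v, -v} : Set (Fin 2 → ℝ)) ∧
      1/3 ≤ ε₁ * x 0 ∧ ε₁ * x 0 ≤ 1 ∧ 1/3 ≤ ε₂ * x 1 ∧ ε₂ * x 1 ≤ 1 := by
  rw [mem_Icc] at hu₀ hu₁ hv₀ hv₁
  have unique {z : Fin 2 → ℝ} (hz : z ∈ ({u, -u, v, -v} : Set (Fin 2 → ℝ)))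
      (hz' : 1/3 ≤ ε₁ * z 0 ∧ ε₁ * z 0 ≤ 1 ∧ 1/3 ≤ ε₂ * z 1 ∧ ε₂ * z 1 ≤ 1)
      (h : ∀ y ∈ ({u, -u, v, -v} : Set (Fin 2 → ℝ)), 0 < ε₁ * y 0 → 0 < ε₂ * y 1 → y = z) :
      ∃! x : Fin 2 → ℝ, x ∈ ({u, -u, v, -v} : Set (Fin 2 → ℝ)) ∧
        1/3 ≤ ε₁ * x 0 ∧ ε₁ * x 0 ≤ 1 ∧ 1/3 ≤ ε₂ * x 1 ∧ ε₂ * x 1 ≤ 1 :=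
    ⟨z, ⟨hz, hz'⟩, fun y hy => h y hy.1 (by linarith [hy.2.1]) (by linarith [hy.2.2.2.1])⟩
  rcases hε₁ with rfl | rfl <;> rcases hε₂ with rfl | rfl
  · refine unique (z := u) (by simp) (by refine ⟨?_, ?_, ?_, ?_⟩ <;> linarith) ?_
    rintro y (rfl | rfl | rfl | rfl) h₀ h₁ <;> first | rfl | (simp at h₀ h₁; linarith)
  · refine unique (z := v) (by simp) (by refine ⟨?_, ?_, ?_, ?_⟩ <;> linarith) ?_
    rintro y (rfl | rfl | rfl | rfl) h₀ h₁ <;> first | rfl | (simp at h₀ h₁; linarith)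
  · refine unique (z := -v) (by simp)
      (by simp only [Pi.neg_apply]; refine ⟨?_, ?_, ?_, ?_⟩ <;> linarith) ?_
    rintro y (rfl | rfl | rfl | rfl) h₀ h₁ <;> first | rfl | (simp at h₀ h₁; linarith)
  · refine unique (z := -u) (by simp)
      (by simp only [Pi.neg_apply]; refine ⟨?_, ?_, ?_, ?_⟩ <;> linarith) ?_
    rintro y (rfl | rfl | rfl | rfl) h₀ h₁ <;> first | rfl | (simp at h₀ h₁; linarith)

/-- If all coordinates of `u` and `v` have absolute value in `[1/3, 1]`, and `u`, `v` lie neither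
in the same nor in opposite quadrants, then each corner square contains exactly one of
`±u, ±v`. -/
theorem existsUnique_mem_corner_of_abs {u v : Fin 2 → ℝ} (hu : ∀ i, |u i| ∈ Icc (1 / 3) 1)
    (hv : ∀ i, |v i| ∈ Icc (1 / 3) 1) (huv : u 0 * u 1 * (v 0 * v 1) ≤ 0)
    {ε₁ ε₂ : ℝ} (hε₁ : ε₁ = 1 ∨ ε₁ = -1) (hε₂ : ε₂ = 1 ∨ ε₂ = -1) :
    ∃! x : Fin 2 → ℝ, x ∈ ({u, -u, v, -v} : Set (Fin 2 → ℝ)) ∧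
      1/3 ≤ ε₁ * x 0 ∧ ε₁ * x 0 ≤ 1 ∧ 1/3 ≤ ε₂ * x 1 ∧ ε₂ * x 1 ≤ 1 := by
  wlog hu₀ : 0 ≤ u 0 generalizing u
  · have h := this (u := -u) (by simpa using hu) (by simpa using huv)
      (by rw [Pi.neg_apply]; linarith)
    rwa [neg_neg, insert_comm] at h
  wlog hv₀ : 0 ≤ v 0 generalizing v
  · have h := this (v := -v) (by simpa using hv) (by simpa using huv)
      (by rw [Pi.neg_apply]; linarith)
    rwa [neg_neg, pair_comm (-v)] at h
  wlog hu₁ : 0 ≤ u 1 generalizing u v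
  · have hset : ({v, -v, u, -u} : Set (Fin 2 → ℝ)) = {u, -u, v, -v} := by
      ext; simp only [mem_insert_iff, mem_singleton_iff]; tauto
    by_cases hv₁ : 0 ≤ v 1
    · exact hset ▸ this hv hv₀ hu (by linarith) hu₀ hv₁
    · have hu₀' := (hu 0).1
      have hv₀' := (hv 0).1
      rw [abs_of_nonneg hu₀] at hu₀'
      rw [abs_of_nonneg hv₀] at hv₀'
      have h₁ : u 0 * u 1 < 0 := mul_neg_of_pos_of_neg (by linarith) (by linarith)
      have h₂ : v 0 * v 1 < 0 := mul_neg_of_pos_of_neg (by linarith) (by linarith)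
      exact absurd huv (mul_pos_of_neg_of_neg h₁ h₂).not_ge
  have hu₀' := hu 0
  have hu₁' := hu 1
  have hv₀' := hv 0
  have hv₁' := hv 1
  rw [abs_of_nonneg hu₀] at hu₀'
  rw [abs_of_nonneg hu₁] at hu₁'
  rw [abs_of_nonneg hv₀] at hv₀'
  rcases le_or_gt 0 (v 1) with hv₁ | hv₁
  · rw [abs_of_nonneg hv₁] at hv₁'
    rw [mem_Icc] at hu₀' hu₁' hv₀' hv₁'
    have h₁ : 0 < u 0 * u 1 := mul_pos (by linarith) (by linarith)
    have h₂ : 0 < v 0 * v 1 := mul_pos (by linarith) (by linarith)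
    exact absurd huv (mul_pos h₁ h₂).not_ge
  · rw [abs_of_neg hv₁, mem_Icc] at hv₁'
    exact existsUnique_mem_corner hu₀' hu₁' hv₀' ⟨by linarith, by linarith⟩ hε₁ hε₂

/-- If a 0-symmetric parallelogram `P = conv{p, −p, q, −q}` satisfies
`(5/9)·C₂ ⊆ P ⊆ C₂`, then each square `W_{(ε₁,ε₂)}` contains exactly one of
the four points `p, −p, q, −q`. -/
theorem stmt0 (p q : Fin 2 → ℝ) (hli : LinearIndependent ℝ ![p, q])
    (hP1 : (5/9 : ℝ) • cube 2 ⊆ convexHull ℝ {p, -p, q, -q})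
    (hP2 : convexHull ℝ {p, -p, q, -q} ⊆ cube 2) :
    ∀ ε₁ ε₂ : ℝ, (ε₁ = 1 ∨ ε₁ = -1) → (ε₂ = 1 ∨ ε₂ = -1) →
      ∃! x : Fin 2 → ℝ, x ∈ ({p, -p, q, -q} : Set (Fin 2 → ℝ)) ∧
        1/3 ≤ ε₁ * x 0 ∧ ε₁ * x 0 ≤ 1 ∧ 1/3 ≤ ε₂ * x 1 ∧ ε₂ * x 1 ≤ 1 := by
  have hp : p ∈ cube 2 := hP2 (subset_convexHull ℝ _ (by simp))
  have hq : q ∈ cube 2 := hP2 (subset_convexHull ℝ _ (by simp))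
  have hD : p 0 * q 1 - p 1 * q 0 ≠ 0 := by
    have h := (Matrix.linearIndependent_rows_iff_isUnit (A := Matrix.of ![p, q])).1 hli
    rw [Matrix.isUnit_iff_isUnit_det, isUnit_iff_ne_zero, Matrix.det_fin_two] at h
    simpa using h
  have hball : ∀ v ∈ cube 2, 5 * (|v 0 * q 1 - v 1 * q 0| + |p 0 * v 1 - p 1 * v 0|) ≤
      9 * |p 0 * q 1 - p 1 * q 0| := by
    intro v hv
    have h := convexHull_subset_cramer_ball p q (hP1 (smul_mem_smul_set hv))
    simp only [mem_ofPred_eq, Pi.smul_apply, smul_eq_mul] at h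
    rw [show 5 / 9 * v 0 * q 1 - 5 / 9 * v 1 * q 0 = 5 / 9 * (v 0 * q 1 - v 1 * q 0) by ring,
      show p 0 * (5 / 9 * v 1) - p 1 * (5 / 9 * v 0) = 5 / 9 * (p 0 * v 1 - p 1 * v 0) by ring,
      abs_mul, abs_mul, abs_of_pos (by norm_num : (0 : ℝ) < 5 / 9)] at h
    linarith
  have h₁ : 5 * (|q 1 - q 0| + |p 0 - p 1|) ≤ 9 * |p 0 * q 1 - p 1 * q 0| := by
    simpa using hball ![1, 1] (by simp [cube, Fin.forall_fin_two])
  have h₂ : 5 * (|q 1 + q 0| + |p 0 + p 1|) ≤ 9 * |p 0 * q 1 - p 1 * q 0| := by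
    have h := hball ![1, -1] (by simp [cube, Fin.forall_fin_two])
    simp only [Matrix.cons_val_zero, Matrix.cons_val_one] at h
    rwa [show 1 * q 1 - -1 * q 0 = q 1 + q 0 by ring,
      show p 0 * -1 - p 1 * 1 = -(p 0 + p 1) by ring, abs_neg] at h
  have hp₀ := one_third_le_abs (hp 0) (hp 1) (hq 0) (hq 1) hD h₁ h₂
  have hdet : p 1 * q 0 - p 0 * q 1 = -(p 0 * q 1 - p 1 * q 0) := by ring
  have hp₁ := one_third_le_abs (hp 1) (hp 0) (hq 1) (hq 0) (by rwa [hdet, neg_ne_zero])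
    (by rwa [hdet, abs_neg, abs_sub_comm (q 0), abs_sub_comm (p 1)])
    (by rwa [hdet, abs_neg, add_comm (q 0), add_comm (p 1)])
  have hdet' : q 0 * p 1 - q 1 * p 0 = -(p 0 * q 1 - p 1 * q 0) := by ring
  have hq₀ := one_third_le_abs (hq 0) (hq 1) (hp 0) (hp 1) (by rwa [hdet', neg_ne_zero])
    (by rwa [hdet', abs_neg, abs_sub_comm (p 1), abs_sub_comm (q 0), add_comm])
    (by rwa [hdet', abs_neg, add_comm (p 1), add_comm (q 0), add_comm])
  have hdet'' : q 1 * p 0 - q 0 * p 1 = p 0 * q 1 - p 1 * q 0 := by ring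
  have hq₁ := one_third_le_abs (hq 1) (hq 0) (hp 1) (hp 0) (by rwa [hdet''])
    (by rwa [hdet'', add_comm])
    (by rwa [hdet'', add_comm (p 0), add_comm (q 1), add_comm, add_comm (q 0), add_comm (p 1)])
  have hsign := mul_mul_mul_nonpos_of_det_bounds (hp 0) (hp 1) (hq 0) (hq 1) hD h₁ h₂
  intro ε₁ ε₂ hε₁ hε₂
  exact existsUnique_mem_corner_of_abs (Fin.forall_fin_two.2 ⟨⟨hp₀, hp 0⟩, ⟨hp₁, hp 1⟩⟩)
    (Fin.forall_fin_two.2 ⟨⟨hq₀, hq 0⟩, ⟨hq₁, hq 1⟩⟩) hsign hε₁ hε₂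
end
end

section
/- The Banach–Mazur distance between the three-dimensional cube and the cross-polytope equals 9/5; that is, inf{r > 0 : there exist an invertible linear map T : ℝ³ → ℝ³ and vectors u, v ∈ ℝ³ with C₃ + u ⊆ T(C₃* + v) ⊆ r·(C₃ + u)} = 9/5. -/
open Set Pointwise

noncomputable section

/-- The rescaled matrix `S` of an inclusion `cube ⊆ T crossPoly ⊆ N cube`: the norm
`x ↦ ‖S x‖₁` lies between `‖x‖_∞` and `N ‖x‖_∞`, and the lower bound also holds for `Sᵀ`. -/
structure IsCubeApprox (S : Fin 3 → Fin 3 → ℝ) (N : ℝ) : Prop where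
  upper : ∀ x : Fin 3 → ℝ, (∀ k, |x k| ≤ 1) → ∑ j, |∑ k, S j k * x k| ≤ N
  lower : ∀ (x : Fin 3 → ℝ) (k : Fin 3), |x k| ≤ ∑ j, |∑ k, S j k * x k|
  lower_transpose : ∀ (y : Fin 3 → ℝ) (j : Fin 3), |y j| ≤ ∑ k, |∑ j, S j k * y j|

theorem IsCubeApprox.transform {S : Fin 3 → Fin 3 → ℝ} {N : ℝ} (h : IsCubeApprox S N)
    (σ τ : Fin 3 → ℝ) (hσ : ∀ j, |σ j| = 1) (hτ : ∀ k, |τ k| = 1) (π : Equiv.Perm (Fin 3)) :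
    IsCubeApprox (fun j k => σ j * S (π j) k * τ k) N := by
  have key : ∀ x : Fin 3 → ℝ, ∑ j, |∑ k, σ j * S (π j) k * τ k * x k|
      = ∑ j, |∑ k, S j k * (τ k * x k)| := by
    intro x
    rw [← Equiv.sum_comp π (fun j => |∑ k, S j k * (τ k * x k)|)]
    refine Finset.sum_congr rfl fun j _ => ?_
    have : ∑ k, σ j * S (π j) k * τ k * x k = σ j * ∑ k, S (π j) k * (τ k * x k) := by
      rw [Finset.mul_sum]
      exact Finset.sum_congr rfl fun k _ => by ring
    rw [this, abs_mul, hσ, one_mul]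
  refine ⟨fun x hx => ?_, fun x k => ?_, fun y j => ?_⟩
  · rw [key]
    exact h.upper _ fun k => by rw [abs_mul, hτ, one_mul]; exact hx k
  · rw [key]
    have := h.lower (fun k => τ k * x k) k
    rwa [abs_mul, hτ, one_mul] at this
  · have := h.lower_transpose (fun j => σ (π.symm j) * y (π.symm j)) (π j)
    simp only [Equiv.symm_apply_apply, abs_mul, hσ, one_mul] at this
    refine this.trans_eq (Finset.sum_congr rfl fun k _ => ?_)
    rw [← Equiv.sum_comp π]
    simp only [Equiv.symm_apply_apply]
    have : ∑ j, σ j * S (π j) k * τ k * y j = τ k * ∑ j, S (π j) k * (σ j * y j) := by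
      rw [Finset.mul_sum]
      exact Finset.sum_congr rfl fun j _ => by ring
    rw [this, abs_mul, hτ, one_mul]

theorem IsCubeApprox.one_le_col {S : Fin 3 → Fin 3 → ℝ} {N : ℝ} (h : IsCubeApprox S N)
    (k : Fin 3) : 1 ≤ ∑ j, |S j k| := by
  simpa [Pi.single_apply] using h.lower (Pi.single k 1) k

theorem IsCubeApprox.one_le_row {S : Fin 3 → Fin 3 → ℝ} {N : ℝ} (h : IsCubeApprox S N)
    (j : Fin 3) : 1 ≤ ∑ k, |S j k| := by
  simpa [Pi.single_apply] using h.lower_transpose (Pi.single j 1) j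

theorem IsCubeApprox.two_le_of_mul_nonneg {S : Fin 3 → Fin 3 → ℝ} {N : ℝ}
    (h : IsCubeApprox S N) {k l : Fin 3} (hkl : k ≠ l)
    (hs : ∀ j, 0 ≤ S j k * S j l) : 2 ≤ N := by
  have h1 := h.upper (Pi.single k 1 + Pi.single l 1) (by
    intro i
    by_cases hik : i = k
    · subst hik; simp [hkl]
    · by_cases hil : i = l
      · subst hil; simp [hik]
      · simp [hik, hil])
  have h2 : ∀ j, |∑ i, S j i * (Pi.single k 1 + Pi.single l 1 : Fin 3 → ℝ) i|
      = |S j k| + |S j l| := by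
    intro j
    rw [← abs_add_eq_add_abs_iff _ _ |>.mpr (mul_nonneg_iff.mp (hs j))]
    simp [Pi.single_apply, mul_add, Finset.sum_add_distrib]
  simp only [h2, Finset.sum_add_distrib] at h1
  linarith [h.one_le_col k, h.one_le_col l]

theorem nine_fifths_le_of_reduced {N w₁ w₂ w₃ d₁ d₂ d₃ : ℝ}
    (hN : w₁ + w₂ + w₃ ≤ N)
    (h₁ : 4 * (w₁ + d₁) ≤ N + (w₁ + w₂ + w₃)) (h₂ : 4 * (w₂ + d₂) ≤ N + (w₁ + w₂ + w₃))
    (h₃ : 4 * (w₃ + d₃) ≤ N + (w₁ + w₂ + w₃))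
    (k₁ : 1 ≤ w₁ + 2 * d₁) (k₂ : 1 ≤ w₂ + 2 * d₂) (k₃ : 1 ≤ w₃ + 2 * d₃)
    (q₁ : w₁ * (1 - w₁) ≤ (w₁ + w₂ + w₃ - 1) * d₁)
    (q₂ : w₂ * (1 - w₂) ≤ (w₁ + w₂ + w₃ - 1) * d₂)
    (q₃ : w₃ * (1 - w₃) ≤ (w₁ + w₂ + w₃ - 1) * d₃)
    (e₁ : 0 ≤ d₁) (e₂ : 0 ≤ d₂) (e₃ : 0 ≤ d₃) : 9 / 5 ≤ N := by
  by_contra! hlt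
  obtain ⟨W, hW⟩ : ∃ W, W = w₁ + w₂ + w₃ := ⟨_, rfl⟩
  rw [← hW] at hN h₁ h₂ h₃ q₁ q₂ q₃
  have hW0 : 3 / 5 < W := by linarith
  have large : ∀ w d : ℝ, 4 * (w + d) ≤ N + W → 1 ≤ w + 2 * d → w < 2 * W / 3 :=
    fun w d h k => by linarith
  have small : ∀ w d : ℝ, 4 * (w + d) ≤ N + W → 1 ≤ w + 2 * d → w * (1 - w) ≤ (W - 1) * d →
      0 ≤ d → w < W / 3 := by
    intro w d h k q e
    by_contra! hw
    have hw2 := large w d h k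
    have hW1 : 1 < W := by
      by_contra! hW1
      nlinarith [mul_nonneg (sub_nonneg.mpr hW1) e, mul_pos (by linarith : 0 < w)
        (by linarith : 0 < 1 - w)]
    have hmid : 2 * W ^ 2 / 9 ≤ w * (W - w) := by
      nlinarith [mul_nonneg (sub_nonneg.mpr hw) (sub_nonneg.mpr hw2.le)]
    have : 4 * (w * (W - w)) ≤ (W - 1) * (N + W) := by
      nlinarith [mul_le_mul_of_nonneg_left h (sub_nonneg.mpr hW1.le)]
    have : (W - 1) * (N + W) < (W - 1) * (9 / 5 + W) :=
      mul_lt_mul_of_pos_left (by linarith) (by linarith)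
    nlinarith [mul_pos (by linarith : 0 < W + 9) (by linarith : 0 < 9 / 5 - W)]
  linarith [small w₁ d₁ h₁ k₁ q₁ e₁, small w₂ d₂ h₂ k₂ q₂ e₂, small w₃ d₃ h₃ k₃ q₃ e₃]

theorem mul_one_sub_le_of_minors {p q d W e : ℝ}
    (hp : p ≤ p * q + d * e) (hq : q ≤ p * q + d * e) (he : e = W + d - (p + q)) :
    ((p + q) / 2 - d) * (1 - ((p + q) / 2 - d)) ≤ (W - 1) * d := by
  subst he
  nlinarith [sq_nonneg (p - q)]

set_option maxHeartbeats 400000 in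
theorem IsCubeApprox.nine_fifths_le_of_signs {a₁ a₂ a₃ b₁ b₂ b₃ c₁ c₂ c₃ N : ℝ}
    (h : IsCubeApprox ![![-a₁, b₁, c₁], ![a₂, -b₂, c₂], ![a₃, b₃, -c₃]] N)
    (ha₁ : 0 ≤ a₁) (ha₂ : 0 ≤ a₂) (ha₃ : 0 ≤ a₃) (hb₁ : 0 ≤ b₁) (hb₂ : 0 ≤ b₂) (hb₃ : 0 ≤ b₃)
    (hc₁ : 0 ≤ c₁) (hc₂ : 0 ≤ c₂) (hc₃ : 0 ≤ c₃) : 9 / 5 ≤ N := by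
  by_contra! hN
  have upper : ∀ x y z : ℝ, |x| ≤ 1 → |y| ≤ 1 → |z| ≤ 1 →
      |-(a₁ * x) + b₁ * y + c₁ * z| + |a₂ * x + -(b₂ * y) + c₂ * z|
        + |a₃ * x + b₃ * y + -(c₃ * z)| ≤ N := by
    intro x y z hx hy hz
    simpa [Fin.sum_univ_three] using h.upper ![x, y, z] (by
      intro k; fin_cases k <;> simpa)
  have lower : ∀ x y z : ℝ, ∀ k, |![x, y, z] k| ≤
      |-(a₁ * x) + b₁ * y + c₁ * z| + |a₂ * x + -(b₂ * y) + c₂ * z|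
        + |a₃ * x + b₃ * y + -(c₃ * z)| := by
    intro x y z k
    simpa [Fin.sum_univ_three] using h.lower ![x, y, z] k
  have lower' : ∀ x y z : ℝ, ∀ k, |![x, y, z] k| ≤
      |-(a₁ * x) + a₂ * y + a₃ * z| + |b₁ * x + -(b₂ * y) + b₃ * z|
        + |c₁ * x + c₂ * y + -(c₃ * z)| := by
    intro x y z k
    simpa [Fin.sum_univ_three] using h.lower_transpose ![x, y, z] k
  have hr : ∀ j, _ := h.one_le_row
  have hc : ∀ k, _ := h.one_le_col
  simp only [Fin.forall_fin_succ, Fin.sum_univ_three] at hr hc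
  simp [abs_of_nonneg, *] at hr hc
  obtain ⟨r₁, r₂, r₃⟩ := hr
  obtain ⟨s₁, s₂, s₃⟩ := hc
  have u₀ := upper 1 1 1 (by simp) (by simp) (by simp)
  have u₁ := upper (-1) 1 1 (by simp) (by simp) (by simp)
  have u₂ := upper 1 (-1) 1 (by simp) (by simp) (by simp)
  have u₃ := upper 1 1 (-1) (by simp) (by simp) (by simp)
  have pos := fun x : ℝ => le_abs_self x
  have neg := fun x : ℝ => neg_le_abs x
  have f₀ : b₁ + c₁ + (a₂ + c₂) + (a₃ + b₃) - (a₁ + b₂ + c₃) ≤ N := by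
    refine le_trans (le_trans (le_of_eq (by ring))
      (add_le_add_three (pos _) (pos _) (pos _))) u₀
  have f₁ : a₁ + b₂ + c₃ + (b₁ + c₁) + (a₂ + a₃) - (c₂ + b₃) ≤ N := by
    refine le_trans (le_trans (le_of_eq (by ring))
      (add_le_add_three (pos _) (neg _) (neg _))) u₁
  have f₂ : a₁ + b₂ + c₃ + (a₂ + c₂) + (b₁ + b₃) - (c₁ + a₃) ≤ N := by
    refine le_trans (le_trans (le_of_eq (by ring))
      (add_le_add_three (neg _) (pos _) (neg _))) u₂
  have f₃ : a₁ + b₂ + c₃ + (a₃ + b₃) + (c₁ + c₂) - (b₁ + a₂) ≤ N := by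
    refine le_trans (le_trans (le_of_eq (by ring))
      (add_le_add_three (neg _) (neg _) (pos _))) u₃
  have v₁ : a₁ + b₂ + c₂ + b₃ + c₃ ≤ N := by
    have g := le_trans (add_le_add_three (neg _) (neg _) (pos _)) u₃
    have g' := le_trans (add_le_add_three (neg _) (pos _) (neg _)) u₂
    linarith
  have v₂ : b₂ + a₁ + c₁ + a₃ + c₃ ≤ N := by
    have g := le_trans (add_le_add_three (neg _) (neg _) (pos _)) u₃
    have g' := le_trans (add_le_add_three (pos _) (neg _) (neg _)) u₁
    linarith
  have v₃ : c₃ + a₁ + b₁ + a₂ + b₂ ≤ N := by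
    have g := le_trans (add_le_add_three (neg _) (pos _) (neg _)) u₂
    have g' := le_trans (add_le_add_three (pos _) (neg _) (neg _)) u₁
    linarith
  have p₁ : a₁ ≤ b₁ + c₁ := by linarith
  have p₂ : b₂ ≤ a₂ + c₂ := by linarith
  have p₃ : c₃ ≤ a₃ + b₃ := by linarith
  have q₁ : a₁ ≤ a₂ + a₃ := by linarith
  have q₂ : b₂ ≤ b₁ + b₃ := by linarith
  have q₃ : c₃ ≤ c₁ + c₂ := by linarith
  have nonneg : ∀ d a c b p : ℝ, 0 ≤ d → 0 ≤ a → b ≤ a + c → d ≤ p →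
      0 ≤ a * p + -(b * d) + c * d := by
    intro d a c b p hd ha hb hp
    nlinarith [mul_le_mul_of_nonneg_left hp ha, mul_le_mul_of_nonneg_right hb hd]
  have minor : ∀ {t x y z : ℝ}, |t| ≤ |x| + |y| + |z| → x = 0 → 0 ≤ y → 0 ≤ z →
      t ≤ y + z := by
    intro t x y z ht hx hy hz
    rw [hx, abs_zero, abs_of_nonneg hy, abs_of_nonneg hz] at ht
    linarith [le_abs_self t]
  have rot : ∀ x y z : ℝ, |x| + |y| + |z| = |y| + |x| + |z| ∧
      |x| + |y| + |z| = |z| + |x| + |y| := fun x y z => ⟨by ring, by ring⟩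
  have row₁ := minor (lower (b₁ + c₁) a₁ a₁ 0) (by ring)
    ((nonneg a₁ a₂ c₂ b₂ _ ha₁ ha₂ p₂ p₁).trans_eq (by ring))
    ((nonneg a₁ a₃ b₃ c₃ _ ha₁ ha₃ p₃ p₁).trans_eq (by ring))
  have col₁ := minor (lower' (a₂ + a₃) a₁ a₁ 0) (by ring)
    ((nonneg a₁ b₁ b₃ b₂ _ ha₁ hb₁ q₂ q₁).trans_eq (by ring))
    ((nonneg a₁ c₁ c₂ c₃ _ ha₁ hc₁ q₃ q₁).trans_eq (by ring))
  have row₂ := minor ((lower b₂ (a₂ + c₂) b₂ 1).trans_eq (rot _ _ _).1) (by ring)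
    ((nonneg b₂ b₁ c₁ a₁ _ hb₂ hb₁ p₁ p₂).trans_eq (by ring))
    ((nonneg b₂ b₃ a₃ c₃ _ hb₂ hb₃ (by linarith) p₂).trans_eq (by ring))
  have col₂ := minor ((lower' b₂ (b₁ + b₃) b₂ 1).trans_eq (rot _ _ _).1) (by ring)
    ((nonneg b₂ a₂ a₃ a₁ _ hb₂ ha₂ q₁ q₂).trans_eq (by ring))
    ((nonneg b₂ c₂ c₁ c₃ _ hb₂ hc₂ (by linarith) q₂).trans_eq (by ring))
  have row₃ := minor ((lower c₃ c₃ (a₃ + b₃) 2).trans_eq (rot _ _ _).2) (by ring)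
    ((nonneg c₃ c₁ b₁ a₁ _ hc₃ hc₁ (by linarith) p₃).trans_eq (by ring))
    ((nonneg c₃ c₂ a₂ b₂ _ hc₃ hc₂ (by linarith) p₃).trans_eq (by ring))
  have col₃ := minor ((lower' c₃ c₃ (c₁ + c₂) 2).trans_eq (rot _ _ _).2) (by ring)
    ((nonneg c₃ a₃ a₂ a₁ _ hc₃ ha₃ (by linarith) q₃).trans_eq (by ring))
    ((nonneg c₃ b₃ b₁ b₂ _ hc₃ hb₃ (by linarith) q₃).trans_eq (by ring))
  simp at row₁ col₁ row₂ col₂ row₃ col₃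
  refine hN.not_ge (nine_fifths_le_of_reduced
    (w₁ := (b₁ + c₁ + (a₂ + a₃)) / 2 - a₁) (w₂ := (a₂ + c₂ + (b₁ + b₃)) / 2 - b₂)
    (w₃ := (a₃ + b₃ + (c₁ + c₂)) / 2 - c₃) (d₁ := a₁) (d₂ := b₂) (d₃ := c₃)
    (by linarith) (by linarith) (by linarith) (by linarith)
    (by linarith) (by linarith) (by linarith)
    (mul_one_sub_le_of_minors (e := c₂ + b₃ - b₂ - c₃) ?_ ?_ (by ring))
    (mul_one_sub_le_of_minors (e := c₁ + a₃ - a₁ - c₃) ?_ ?_ (by ring))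
    (mul_one_sub_le_of_minors (e := b₁ + a₂ - a₁ - b₂) ?_ ?_ (by ring)) ha₁ hb₂ hc₃) <;>
  linarith

theorem IsCubeApprox.nine_fifths_le_of_nonneg {S : Fin 3 → Fin 3 → ℝ} {N : ℝ}
    (h : IsCubeApprox S N) (hcol : ∀ j, 0 ≤ S j 0) (hrow : ∀ k, 0 ≤ S 0 k) : 9 / 5 ≤ N := by
  have parallel : ∀ k l : Fin 3, k ≠ l → 0 ≤ S 1 k * S 1 l → 0 ≤ S 2 k * S 2 l → 9 / 5 ≤ N := by
    intro k l hkl h₁ h₂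
    have := h.two_le_of_mul_nonneg hkl (by
      simpa [Fin.forall_fin_succ] using ⟨mul_nonneg (hrow k) (hrow l), h₁, h₂⟩)
    linarith
  have pattern : ∀ (π : Equiv.Perm (Fin 3)) (s t : ℝ), |s| = 1 → |t| = 1 →
      S (π 0) 1 * s ≤ 0 → S (π 0) 2 * t ≤ 0 → S (π 1) 1 * s ≤ 0 → 0 ≤ S (π 1) 2 * t →
      0 ≤ S (π 2) 1 * s → S (π 2) 2 * t ≤ 0 → 9 / 5 ≤ N := by
    intro π s t hs ht h₀₁ h₀₂ h₁₁ h₁₂ h₂₁ h₂₂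
    have h' := h.transform ![-1, 1, 1] ![1, s, t] (by simp [Fin.forall_fin_succ])
      (by simp [Fin.forall_fin_succ, hs, ht]) π
    refine IsCubeApprox.nine_fifths_le_of_signs (a₁ := S (π 0) 0) (b₁ := -(S (π 0) 1 * s))
      (c₁ := -(S (π 0) 2 * t)) (a₂ := S (π 1) 0) (b₂ := -(S (π 1) 1 * s))
      (c₂ := S (π 1) 2 * t) (a₃ := S (π 2) 0) (b₃ := S (π 2) 1 * s)
      (c₃ := -(S (π 2) 2 * t)) ?_ (hcol _) (hcol _) (hcol _) (by linarith) (by linarith)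
      h₂₁ (by linarith) h₁₂ (by linarith)
    convert h' using 1
    ext j k
    fin_cases j <;> fin_cases k <;> simp
  have r₁ := hcol 1
  have r₂ := hcol 2
  have t₁ := hrow 1
  have t₂ := hrow 2
  rcases le_total 0 (S 1 1) with h₁₁ | h₁₁ <;> rcases le_total 0 (S 1 2) with h₁₂ | h₁₂ <;>
  rcases le_total 0 (S 2 1) with h₂₁ | h₂₁ <;> rcases le_total 0 (S 2 2) with h₂₂ | h₂₂
  all_goals
    first
    | exact parallel 0 1 (by decide) (mul_nonneg r₁ h₁₁) (mul_nonneg r₂ h₂₁)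
    | exact parallel 0 2 (by decide) (mul_nonneg r₁ h₁₂) (mul_nonneg r₂ h₂₂)
    | exact parallel 1 2 (by decide)
        (by first | exact mul_nonneg h₁₁ h₁₂ | exact mul_nonneg_of_nonpos_of_nonpos h₁₁ h₁₂)
        (by first | exact mul_nonneg h₂₁ h₂₂ | exact mul_nonneg_of_nonpos_of_nonpos h₂₁ h₂₂)
    | skip
  · refine pattern 1 (-1) (-1) ?_ ?_ ?_ ?_ ?_ ?_ ?_ ?_ <;> simp [*]
  · refine pattern (Equiv.swap 0 1) (-1) 1 ?_ ?_ ?_ ?_ ?_ ?_ ?_ ?_ <;>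
      simp [Equiv.swap_apply_def, *]
  · refine pattern (Equiv.swap 1 2) (-1) (-1) ?_ ?_ ?_ ?_ ?_ ?_ ?_ ?_ <;>
      simp [Equiv.swap_apply_def, *]
  · refine pattern (Equiv.swap 0 1 * Equiv.swap 1 2) 1 (-1) ?_ ?_ ?_ ?_ ?_ ?_ ?_ ?_ <;>
      simp [Equiv.swap_apply_def, *]
  · refine pattern (Equiv.swap 1 2 * Equiv.swap 0 1) (-1) 1 ?_ ?_ ?_ ?_ ?_ ?_ ?_ ?_ <;>
      simp [Equiv.swap_apply_def, *]
  · refine pattern (Equiv.swap 0 2) 1 (-1) ?_ ?_ ?_ ?_ ?_ ?_ ?_ ?_ <;>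
      simp [Equiv.swap_apply_def, *]

theorem IsCubeApprox.nine_fifths_le {S : Fin 3 → Fin 3 → ℝ} {N : ℝ}
    (h : IsCubeApprox S N) : 9 / 5 ≤ N := by
  have sign : ∀ x : ℝ, ∃ s : ℝ, |s| = 1 ∧ 0 ≤ s * x := by
    intro x
    rcases le_total 0 x with hx | hx
    · exact ⟨1, by simp, by simpa⟩
    · exact ⟨-1, by simp, by simpa⟩
  choose sgn hsgn hnonneg using sign
  have h₁ := h.transform (fun j => sgn (S j 0)) 1 (fun j => hsgn _) (by simp) 1
  have h₂ := h₁.transform 1 (fun k => if k = 0 then 1 else sgn (sgn (S 0 0) * S 0 k))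
    (by simp) (fun k => by split_ifs <;> simp [hsgn]) 1
  refine h₂.nine_fifths_le_of_nonneg (fun j => by simpa using hnonneg _) fun k => ?_
  by_cases hk : k = 0
  · subst hk; simpa using hnonneg _
  · simpa [hk, mul_comm] using hnonneg (sgn (S 0 0) * S 0 k)

open scoped Matrix in
theorem isCubeApprox_of_subset {r : ℝ} (hr : 0 < r)
    (T : (Fin 3 → ℝ) ≃ₗ[ℝ] (Fin 3 → ℝ)) (u v : Fin 3 → ℝ)
    (h₁ : (fun x => x + u) '' cube 3 ⊆ ⇑T '' ((fun x => x + v) '' crossPoly 3))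
    (h₂ : ⇑T '' ((fun x => x + v) '' crossPoly 3) ⊆ r • ((fun x => x + u) '' cube 3)) :
    IsCubeApprox (r • LinearMap.toMatrix' T.symm.toLinearMap) r := by
  have hS : ∀ x ∈ cube 3, ∑ j, |T.symm x j| ≤ 1 := by
    have aux : ∀ x ∈ cube 3, ∑ j, |T.symm x j + (T.symm u - v) j| ≤ 1 := by
      intro x hx
      obtain ⟨_, ⟨y, hy, rfl⟩, hxy⟩ := h₁ ⟨x, hx, rfl⟩
      have : y = T.symm x + (T.symm u - v) := by
        have := congrArg T.symm hxy
        simp only [LinearEquiv.symm_apply_apply, map_add] at this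
        rw [eq_sub_of_add_eq this]; abel
      rw [this] at hy
      exact hy
    intro x hx
    have p := aux x hx
    have q := aux (-x) fun i => by simpa using hx i
    have : ∑ j, 2 * |T.symm x j| ≤ ∑ j, |T.symm x j + (T.symm u - v) j|
        + ∑ j, |T.symm (-x) j + (T.symm u - v) j| := by
      rw [← Finset.sum_add_distrib]
      refine Finset.sum_le_sum fun j _ => ?_
      have := abs_sub (T.symm x j + (T.symm u - v) j) (T.symm (-x) j + (T.symm u - v) j)
      simp only [map_neg, Pi.neg_apply] at this ⊢
      rw [show T.symm x j + (T.symm u - v) j - (-T.symm x j + (T.symm u - v) j)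
        = 2 * T.symm x j by ring, abs_mul, abs_two] at this
      exact this
    rw [← Finset.mul_sum] at this
    linarith
  have hT : ∀ y ∈ crossPoly 3, ∀ i, |T y i| ≤ r := by
    have aux : ∀ y ∈ crossPoly 3, ∀ i, |T y i + (T v - r • u) i| ≤ r := by
      intro y hy i
      obtain ⟨_, ⟨z, hz, rfl⟩, hyz⟩ := h₂ ⟨_, ⟨y, hy, rfl⟩, rfl⟩
      have : T y i + (T v - r • u) i = r * z i := by
        have := congrFun hyz i
        simp at this ⊢
        linarith
      rw [this, abs_mul, abs_of_pos hr]
      exact mul_le_of_le_one_right hr.le (hz i)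
    intro y hy i
    have p := abs_le.mp (aux y hy i)
    have q := abs_le.mp (aux (-y) (by simpa [crossPoly] using hy) i)
    simp only [map_neg, Pi.neg_apply] at q
    exact abs_le.mpr ⟨by linarith, by linarith⟩
  obtain ⟨A, hA⟩ : ∃ A, A = LinearMap.toMatrix' T.toLinearMap := ⟨_, rfl⟩
  obtain ⟨B, hB⟩ : ∃ B, B = LinearMap.toMatrix' T.symm.toLinearMap := ⟨_, rfl⟩
  have hAB : A * B = 1 := by
    rw [hA, hB, ← LinearMap.toMatrix'_comp]; simp
  have hBA : B * A = 1 := by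
    rw [hA, hB, ← LinearMap.toMatrix'_comp]; simp
  have hentry : ∀ i j, |A i j| ≤ r := by
    intro i j
    rw [hA, LinearMap.toMatrix'_apply]
    refine hT _ ?_ i
    simp [crossPoly, Pi.single_apply, apply_ite abs]
  have bound : ∀ (c z : Fin 3 → ℝ), (∀ i, |c i| ≤ r) → |∑ i, c i * z i| ≤ ∑ i, |r * z i| := by
    intro c z hc
    refine (Finset.abs_sum_le_sum_abs _ _).trans (Finset.sum_le_sum fun i _ => ?_)
    rw [abs_mul, abs_mul, abs_of_pos hr]
    exact mul_le_mul_of_nonneg_right (hc i) (abs_nonneg _)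
  rw [← hB]
  have hrow : ∀ x : Fin 3 → ℝ, ∑ j, |∑ k, (r • B) j k * x k| = ∑ j, |r * (B *ᵥ x) j| := by
    intro x
    simp [Matrix.mulVec, dotProduct, Finset.mul_sum, mul_assoc]
  have hcol : ∀ y : Fin 3 → ℝ, ∑ k, |∑ j, (r • B) j k * y j| = ∑ k, |r * (y ᵥ* B) k| := by
    intro x
    simp [Matrix.vecMul, dotProduct, Finset.mul_sum, mul_assoc, mul_comm (x _)]
  refine ⟨fun x hx => ?_, fun x k => ?_, fun y j => ?_⟩
  · rw [hrow]
    have hBx : B *ᵥ x = T.symm x := by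
      rw [hB, LinearMap.toMatrix'_mulVec]; rfl
    rw [hBx]
    simp only [abs_mul, ← Finset.mul_sum, abs_of_pos hr]
    exact mul_le_of_le_one_right hr.le (hS x hx)
  · rw [hrow]
    refine le_trans (le_of_eq ?_) (bound (A k) (B *ᵥ x) (hentry k))
    have : (A *ᵥ (B *ᵥ x)) k = x k := by rw [Matrix.mulVec_mulVec, hAB, Matrix.one_mulVec]
    rw [← this]; rfl
  · rw [hcol]
    refine le_trans (le_of_eq ?_) (bound (fun i => A i j) (y ᵥ* B) fun i => hentry i j)
    have : ((y ᵥ* B) ᵥ* A) j = y j := by rw [Matrix.vecMul_vecMul, hBA, Matrix.vecMul_one]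
    rw [← this]
    simp [Matrix.vecMul, dotProduct, mul_comm]

open scoped Matrix in
theorem exists_cube_subset_crossPoly_subset : ∃ T : (Fin 3 → ℝ) ≃ₗ[ℝ] (Fin 3 → ℝ),
    cube 3 ⊆ ⇑T '' crossPoly 3 ∧ ⇑T '' crossPoly 3 ⊆ (9 / 5 : ℝ) • cube 3 := by
  obtain ⟨A, hA⟩ : ∃ A : Matrix (Fin 3) (Fin 3) ℝ,
    A = !![-3/5, 9/5, 9/5; 9/5, -3/5, 9/5; 9/5, 9/5, -3/5] := ⟨_, rfl⟩
  obtain ⟨B, hB⟩ : ∃ B : Matrix (Fin 3) (Fin 3) ℝ,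
    B = !![-1/6, 1/4, 1/4; 1/4, -1/6, 1/4; 1/4, 1/4, -1/6] := ⟨_, rfl⟩
  have hAB : A * B = 1 := by
    subst hA hB
    rw [Matrix.mul_fin_three, Matrix.one_fin_three]
    norm_num
  have hBA : B * A = 1 := mul_eq_one_comm.mp hAB
  refine ⟨Matrix.toLin'OfInv hBA hAB, fun x hx => ⟨B *ᵥ x, ?_, ?_⟩, ?_⟩
  · have h₀ := abs_le.mp (hx 0)
    have h₁ := abs_le.mp (hx 1)
    have h₂ := abs_le.mp (hx 2)
    simp only [crossPoly, hB, Set.mem_ofPred_eq, Fin.sum_univ_three, Matrix.mulVec, dotProduct,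
      Matrix.of_apply, Matrix.cons_val]
    rcases abs_cases (-1 / 6 * x 0 + 1 / 4 * x 1 + 1 / 4 * x 2) with ⟨e₀, -⟩ | ⟨e₀, -⟩ <;>
    rcases abs_cases (1 / 4 * x 0 + -1 / 6 * x 1 + 1 / 4 * x 2) with ⟨e₁, -⟩ | ⟨e₁, -⟩ <;>
    rcases abs_cases (1 / 4 * x 0 + 1 / 4 * x 1 + -1 / 6 * x 2) with ⟨e₂, -⟩ | ⟨e₂, -⟩ <;>
    rw [e₀, e₁, e₂] <;> linarith
  · change A *ᵥ (B *ᵥ x) = x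
    simp [hAB]
  · rintro _ ⟨y, hy, rfl⟩
    refine ⟨(5 / 9 : ℝ) • (A *ᵥ y), fun i => ?_, ?_⟩
    · simp only [crossPoly, Set.mem_ofPred_eq, Fin.sum_univ_three] at hy
      have p := fun j => le_abs_self (y j)
      have n := fun j => neg_le_abs (y j)
      rw [abs_le]
      fin_cases i <;>
        simp [hA, dotProduct, Fin.sum_univ_three] <;>
        constructor <;> linarith [p 0, p 1, p 2, n 0, n 1, n 2]
    · change _ = A *ᵥ y
      simp [smul_smul]


/-- `d_BM(C₃, C₃*) = 9/5`. -/
theorem stmt1 : bmDist (cube 3) (crossPoly 3) = 9/5 := by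
  refine IsLeast.csInf_eq ⟨⟨by norm_num, ?_⟩, ?_⟩
  · obtain ⟨T, h₁, h₂⟩ := exists_cube_subset_crossPoly_subset
    exact ⟨T, 0, 0, by simpa using h₁, by simpa using h₂⟩
  · rintro r ⟨hr, T, u, v, h₁, h₂⟩
    exact (isCubeApprox_of_subset hr T u v h₁ h₂).nine_fifths_le
end
end

section
/- If T : ℝ³ → ℝ³ is a linear map and r > 0 satisfies r·C₃ ⊆ T(C₃*) ⊆ C₃, then r ≤ 5/9. -/
open Set Pointwise

noncomputable section

/-- A nonzero functional `v` exists that is small, relative to its `ℓ¹` norm, on every column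
of `a`. Equivalently, some singular matrix lies within `5/9` of `a` in every entry. -/
def NearSingular (a : Fin 3 → Fin 3 → ℝ) : Prop :=
  ∃ v : Fin 3 → ℝ, 0 < ∑ i, |v i| ∧ ∀ k, |∑ i, v i * a i k| ≤ 5 / 9 * ∑ i, |v i|

theorem NearSingular.of_signed_perm {a : Fin 3 → Fin 3 → ℝ} (ρ π : Equiv.Perm (Fin 3))
    (s c : Fin 3 → ℝ) (hs : ∀ i, |s i| = 1) (hc : ∀ j, |c j| = 1)
    (h : NearSingular fun i j => s i * c j * a (ρ i) (π j)) : NearSingular a := by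
  obtain ⟨v, hv, hk⟩ := h
  have hsum : ∑ i, |s (ρ.symm i) * v (ρ.symm i)| = ∑ i, |v i| := by
    rw [Equiv.sum_comp ρ.symm fun i => |s i * v i|]
    simp [abs_mul, hs]
  refine ⟨fun i => s (ρ.symm i) * v (ρ.symm i), by rwa [hsum], fun k => ?_⟩
  rw [hsum]
  have hcol : ∑ i, v i * (s i * c (π.symm k) * a (ρ i) (π (π.symm k)))
      = c (π.symm k) * ∑ i, s (ρ.symm i) * v (ρ.symm i) * a i k := by
    rw [Finset.mul_sum, ← Equiv.sum_comp ρ fun i => c (π.symm k) * _]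
    refine Finset.sum_congr rfl fun i _ => ?_
    simp only [Equiv.symm_apply_apply, Equiv.apply_symm_apply]
    ring
  have := hk (π.symm k)
  rwa [hcol, abs_mul, hc, one_mul] at this

/-- Two rows with the same sign pattern are close to each other. -/
theorem NearSingular.of_sub_le {a : Fin 3 → Fin 3 → ℝ} {i j : Fin 3} (hij : i ≠ j)
    (h : ∀ k, |a i k - a j k| ≤ 1) : NearSingular a := by
  have hsum : ∑ l, |(Pi.single i 1 - Pi.single j 1 : Fin 3 → ℝ) l| = 2 := by
    fin_cases i <;> fin_cases j <;> simp [Fin.sum_univ_three, Pi.single_apply] at hij ⊢ <;> norm_num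
  refine ⟨Pi.single i 1 - Pi.single j 1, by rw [hsum]; norm_num, fun k => ?_⟩
  have : ∑ l, (Pi.single i 1 - Pi.single j 1 : Fin 3 → ℝ) l * a l k = a i k - a j k := by
    simp [sub_mul, Finset.sum_sub_distrib, Pi.single_apply]
  rw [hsum, this]
  linarith [h k]

/-- The sign pattern with nonpositive diagonal and nonnegative off-diagonal entries. -/
def SignPattern (a : Fin 3 → Fin 3 → ℝ) : Prop :=
  ∀ i j, if i = j then -1 ≤ a i j ∧ a i j ≤ 0 else 0 ≤ a i j ∧ a i j ≤ 1

theorem SignPattern.nearSingular_of_diag_le {a : Fin 3 → Fin 3 → ℝ} (ha : SignPattern a)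
    (ht : ∀ i, a i i ≤ -(1 / 3)) : NearSingular a := by
  refine ⟨fun _ => 1, by simp, fun k => ?_⟩
  have h0 := ha 0
  have h1 := ha 1
  have h2 := ha 2
  have := ht k
  simp only [Fin.forall_fin_succ] at h0 h1 h2
  simp at h0 h1 h2
  rw [abs_le]
  fin_cases k <;> simp [Fin.sum_univ_three] at this ⊢ <;> constructor <;> linarith

/-- If the first diagonal entry of a matrix with nonpositive diagonal and nonnegative
off-diagonal entries is at least `-1/3`, then a suitable functional has its last two
coordinates proportional to `x + t₃` and `y + t₂`. -/
theorem exists_small_functional {t t₂ t₃ p p' q q' x y : ℝ} (ht : t ∈ Icc 0 (1 / 3 : ℝ))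
    (ht₂ : t₂ ∈ Icc (0 : ℝ) 1) (ht₃ : t₃ ∈ Icc (0 : ℝ) 1) (hp : p ∈ Icc (0 : ℝ) 1)
    (hp' : p' ∈ Icc (0 : ℝ) 1) (hq : q ∈ Icc (0 : ℝ) 1) (hq' : q' ∈ Icc (0 : ℝ) 1)
    (hx : x ∈ Icc (0 : ℝ) 1) (hy : y ∈ Icc (0 : ℝ) 1) :
    ∃ u v w : ℝ, 0 < |u| + |v| + |w| ∧
      |-(u * t) + v * q + w * q'| ≤ 5 / 9 * (|u| + |v| + |w|) ∧
      |u * p - v * t₂ + w * x| ≤ 5 / 9 * (|u| + |v| + |w|) ∧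
      |u * p' + v * y - w * t₃| ≤ 5 / 9 * (|u| + |v| + |w|) := by
  obtain ⟨ht0, ht1⟩ := ht
  obtain ⟨ht₂0, ht₂1⟩ := ht₂
  obtain ⟨ht₃0, ht₃1⟩ := ht₃
  obtain ⟨hp0, hp1⟩ := hp
  obtain ⟨hp'0, hp'1⟩ := hp'
  obtain ⟨hq0, hq1⟩ := hq
  obtain ⟨hq'0, hq'1⟩ := hq'
  obtain ⟨hx0, hx1⟩ := hx
  obtain ⟨hy0, hy1⟩ := hy
  rcases (by positivity : 0 ≤ x + t₃ + (y + t₂)).eq_or_lt with hN | hN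
  · obtain rfl : x = 0 := by linarith
    obtain rfl : y = 0 := by linarith
    obtain rfl : t₂ = 0 := by linarith
    obtain rfl : t₃ = 0 := by linarith
    refine ⟨8, 5, 5, by norm_num, ?_⟩
    simp only [abs_le]
    norm_num
    refine ⟨⟨?_, ?_⟩, ⟨?_, ?_⟩, ?_, ?_⟩ <;> linarith
  obtain ⟨m, hm⟩ : ∃ m, m = x + t₃ := ⟨_, rfl⟩
  obtain ⟨n, hn⟩ : ∃ n, n = y + t₂ := ⟨_, rfl⟩
  rw [← hm, ← hn] at hN
  have hm0 : 0 ≤ m := by rw [hm]; positivity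
  have hn0 : 0 ≤ n := by rw [hn]; positivity
  have mq0 := mul_nonneg hm0 hq0
  have nq0 := mul_nonneg hn0 hq'0
  have mq1 := mul_le_of_le_one_right hm0 hq1
  have nq1 := mul_le_of_le_one_right hn0 hq'1
  have mt0 := mul_nonneg hm0 ht₂0
  have nt0 := mul_nonneg hn0 ht₃0
  have mt1 := mul_le_of_le_one_right hm0 ht₂1
  have nt1 := mul_le_of_le_one_right hn0 ht₃1
  have nx0 := mul_nonneg hn0 hx0
  have my0 := mul_nonneg hm0 hy0
  have nx1 := mul_le_of_le_one_right hn0 hx1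
  have my1 := mul_le_of_le_one_right hm0 hy1
  obtain ⟨Δ, hΔ⟩ : ∃ Δ, Δ = m * (1 + t₂) + n * (1 - x) := ⟨_, rfl⟩
  obtain ⟨Δ', hΔ'⟩ : ∃ Δ', Δ' = m * (1 - t₂) + n * (1 + x) := ⟨_, rfl⟩
  have hΔ₂ : Δ = n * (1 + t₃) + m * (1 - y) := by rw [hΔ, hm, hn]; ring
  have hΔ'₂ : Δ' = n * (1 - t₃) + m * (1 + y) := by rw [hΔ', hm, hn]; ring
  have hadd : Δ + Δ' = 2 * (m + n) := by rw [hΔ, hΔ']; ring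
  have hΔm : m ≤ Δ := by linarith
  have hΔn : n ≤ Δ := by linarith
  have hΔ'm : m ≤ Δ' := by linarith
  have hΔ'n : n ≤ Δ' := by linarith
  by_cases hA : 4 * Δ ≤ (9 * Δ - 4 * (m + n)) * (1 + t)
  · have hu : 0 ≤ 9 * Δ - 4 * (m + n) := by
      by_contra! h
      nlinarith
    have up0 := mul_nonneg hu hp0
    have up1 := mul_le_of_le_one_right hu hp1
    have up'0 := mul_nonneg hu hp'0
    have up'1 := mul_le_of_le_one_right hu hp'1
    have ut0 := mul_nonneg hu ht0
    have ut1 := mul_le_mul_of_nonneg_left ht1 hu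
    refine ⟨9 * Δ - 4 * (m + n), 4 * m, 4 * n, ?_⟩
    rw [abs_of_nonneg hu, abs_of_nonneg (by positivity : 0 ≤ 4 * m),
      abs_of_nonneg (by positivity : 0 ≤ 4 * n)]
    simp only [abs_le]
    refine ⟨by linarith, ⟨?_, ?_⟩, ⟨?_, ?_⟩, ?_, ?_⟩ <;> linarith
  · push Not at hA
    have hB : 4 * Δ' ≤ (9 * Δ' - 4 * (m + n)) * (1 - t) := by
      have e : Δ' = 2 * (m + n) - Δ := by linarith
      have h1 : Δ * (5 + 9 * t) ≤ 4 * (m + n) * (1 + t) := by linarith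
      have h2 := mul_le_mul_of_nonneg_right h1 (by linarith : 0 ≤ 5 - 9 * t)
      have h3 : 0 ≤ (m + n) * (10 - 90 * t ^ 2) := mul_nonneg hN.le (by nlinarith)
      have h4 : Δ * (5 - 9 * t) * (5 + 9 * t) ≤ (m + n) * (6 - 14 * t) * (5 + 9 * t) := by
        linarith
      have h5 := le_of_mul_le_mul_right h4 (by positivity)
      rw [e]
      linarith
    have hu : 0 ≤ 9 * Δ' - 4 * (m + n) := by
      by_contra! h
      nlinarith
    have up0 := mul_nonneg hu hp0
    have up1 := mul_le_of_le_one_right hu hp1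
    have up'0 := mul_nonneg hu hp'0
    have up'1 := mul_le_of_le_one_right hu hp'1
    have ut0 := mul_nonneg hu ht0
    refine ⟨-(9 * Δ' - 4 * (m + n)), 4 * m, 4 * n, ?_⟩
    rw [abs_neg, abs_of_nonneg hu, abs_of_nonneg (by positivity : 0 ≤ 4 * m),
      abs_of_nonneg (by positivity : 0 ≤ 4 * n)]
    simp only [abs_le]
    refine ⟨by linarith, ⟨?_, ?_⟩, ⟨?_, ?_⟩, ?_, ?_⟩ <;> linarith

theorem SignPattern.nearSingular_of_le_diag {a : Fin 3 → Fin 3 → ℝ} (ha : SignPattern a)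
    (ht : -(1 / 3) ≤ a 0 0) : NearSingular a := by
  have h0 := ha 0
  have h1 := ha 1
  have h2 := ha 2
  simp only [Fin.forall_fin_succ] at h0 h1 h2
  simp at h0 h1 h2
  obtain ⟨⟨_, _⟩, ⟨_, _⟩, _, _⟩ := h0
  obtain ⟨⟨_, _⟩, ⟨_, _⟩, _, _⟩ := h1
  obtain ⟨⟨_, _⟩, ⟨_, _⟩, _, _⟩ := h2
  have key := exists_small_functional (t := -a 0 0) (t₂ := -a 1 1) (t₃ := -a 2 2)
    (p := a 0 1) (p' := a 0 2) (q := a 1 0) (q' := a 2 0) (x := a 2 1) (y := a 1 2)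
    (by constructor <;> linarith) (by constructor <;> linarith) (by constructor <;> linarith)
    (by constructor <;> linarith) (by constructor <;> linarith) (by constructor <;> linarith)
    (by constructor <;> linarith) (by constructor <;> linarith) (by constructor <;> linarith)
  obtain ⟨u, v, w, hpos, k0, k1, k2⟩ := key
  refine ⟨![u, v, w], by simpa [Fin.sum_univ_three] using hpos, fun k => ?_⟩
  fin_cases k <;> simp [Fin.sum_univ_three]
  · convert k0 using 2; ring
  · convert k1 using 2; ring
  · convert k2 using 2; ring

theorem SignPattern.nearSingular {a : Fin 3 → Fin 3 → ℝ} (ha : SignPattern a) :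
    NearSingular a := by
  by_cases h : ∀ i, a i i ≤ -(1 / 3)
  · exact ha.nearSingular_of_diag_le h
  · push Not at h
    obtain ⟨i, hi⟩ := h
    refine .of_signed_perm (Equiv.swap 0 i) (Equiv.swap 0 i) 1 1 (by simp) (by simp) ?_
    refine nearSingular_of_le_diag (fun j k => ?_) (by simpa using hi.le)
    simpa using ha (Equiv.swap 0 i j) (Equiv.swap 0 i k)

theorem exists_sign (x : ℝ) : ∃ s : ℝ, |s| = 1 ∧ s * x = |x| := by
  rcases le_total 0 x with h | h
  · exact ⟨1, by simp, by simp [abs_of_nonneg h]⟩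
  · exact ⟨-1, by simp, by simp [abs_of_nonpos h]⟩

theorem abs_sub_le_one_of_nonneg {x y : ℝ} (hx : |x| ≤ 1) (hy : |y| ≤ 1) (hx0 : 0 ≤ x)
    (hy0 : 0 ≤ y) : |x - y| ≤ 1 := by
  rw [abs_le] at *
  constructor <;> linarith

theorem abs_sub_le_one_of_nonpos {x y : ℝ} (hx : |x| ≤ 1) (hy : |y| ≤ 1) (hx0 : x ≤ 0)
    (hy0 : y ≤ 0) : |x - y| ≤ 1 := by
  rw [abs_le] at *
  constructor <;> linarith

/-- Up to signed permutations, a sign pattern on a `3 × 3` matrix either has two equal rows or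
is `SignPattern`. -/
theorem nearSingular_of_nonneg {a : Fin 3 → Fin 3 → ℝ} (ha : ∀ i j, |a i j| ≤ 1)
    (hrow : ∀ j, 0 ≤ a 0 j) (hcol : ∀ i, 0 ≤ a i 0) : NearSingular a := by
  have pos {i j k} := abs_sub_le_one_of_nonneg (ha i k) (ha j k)
  have neg {i j k} := abs_sub_le_one_of_nonpos (ha i k) (ha j k)
  have hb (i j) := abs_le.1 (ha i j)
  simp only [Fin.forall_fin_succ] at hb hrow hcol
  simp at hb hrow hcol
  obtain ⟨⟨⟨_, _⟩, ⟨_, _⟩, _, _⟩, ⟨⟨_, _⟩, ⟨_, _⟩, _, _⟩, ⟨_, _⟩, ⟨_, _⟩, _, _⟩ := hb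
  obtain ⟨r0, r1, r2⟩ := hrow
  obtain ⟨-, c1, c2⟩ := hcol
  have close {i j : Fin 3} (hij : i ≠ j) (h0 : |a i 0 - a j 0| ≤ 1) (h1 : |a i 1 - a j 1| ≤ 1)
      (h2 : |a i 2 - a j 2| ≤ 1) : NearSingular a :=
    .of_sub_le hij (by simpa [Fin.forall_fin_succ] using ⟨h0, h1, h2⟩)
  have signed (ρ π : Equiv.Perm (Fin 3)) (s : Fin 3 → ℝ) (hs : ∀ i, |s i| = 1)
      (h : SignPattern fun i j => s i * ![1, -1, -1] j * a (ρ i) (π j)) : NearSingular a :=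
    .of_signed_perm ρ π s _ hs (by norm_num [Fin.forall_fin_succ]) h.nearSingular
  rcases le_total 0 (a 1 1) with h11 | h11 <;> rcases le_total 0 (a 1 2) with h12 | h12
  · exact close (i := 0) (j := 1) (by decide) (pos r0 c1) (pos r1 h11) (pos r2 h12)
  all_goals rcases le_total 0 (a 2 1) with h21 | h21 <;> rcases le_total 0 (a 2 2) with h22 | h22
  · exact close (i := 0) (j := 2) (by decide) (pos r0 c2) (pos r1 h21) (pos r2 h22)
  · exact close (i := 1) (j := 2) (by decide) (pos c1 c2) (pos h11 h21) (neg h12 h22)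
  · exact signed (Equiv.refl _) (Equiv.refl _) ![-1, 1, 1] (by norm_num [Fin.forall_fin_succ]) (by
      simp [SignPattern, Fin.forall_fin_succ]; grind)
  · exact signed (Equiv.refl _) (Equiv.swap 0 1) ![-1, 1, -1] (by norm_num [Fin.forall_fin_succ]) (by
      simp [SignPattern, Fin.forall_fin_succ, Equiv.swap_apply_def]; grind)
  · exact close (i := 0) (j := 2) (by decide) (pos r0 c2) (pos r1 h21) (pos r2 h22)
  · exact signed (Equiv.swap 1 2) (Equiv.refl _) ![-1, 1, 1] (by norm_num [Fin.forall_fin_succ]) (by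
      simp [SignPattern, Fin.forall_fin_succ, Equiv.swap_apply_def]; grind)
  · exact close (i := 1) (j := 2) (by decide) (pos c1 c2) (neg h11 h21) (pos h12 h22)
  · exact signed (Equiv.swap 1 2) (Equiv.swap 0 2) ![-1, -1, 1] (by norm_num [Fin.forall_fin_succ]) (by
      simp [SignPattern, Fin.forall_fin_succ, Equiv.swap_apply_def]; grind)
  · exact close (i := 0) (j := 2) (by decide) (pos r0 c2) (pos r1 h21) (pos r2 h22)
  · exact signed (Equiv.swap 1 2) (Equiv.swap 0 1) ![-1, 1, -1] (by norm_num [Fin.forall_fin_succ]) (by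
      simp [SignPattern, Fin.forall_fin_succ, Equiv.swap_apply_def]; grind)
  · exact signed (Equiv.refl _) (Equiv.swap 0 2) ![-1, -1, 1] (by norm_num [Fin.forall_fin_succ]) (by
      simp [SignPattern, Fin.forall_fin_succ, Equiv.swap_apply_def]; grind)
  · exact close (i := 1) (j := 2) (by decide) (pos c1 c2) (neg h11 h21) (neg h12 h22)

theorem nearSingular {a : Fin 3 → Fin 3 → ℝ} (ha : ∀ i j, |a i j| ≤ 1) : NearSingular a := by
  choose c hc hca using fun j => exists_sign (a 0 j)
  choose s hs hsa using fun i => exists_sign (if i = 0 then 1 else c 0 * a i 0)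
  have hs0 : s 0 = 1 := by simpa using hsa 0
  refine .of_signed_perm (Equiv.refl _) (Equiv.refl _) s c hs hc
    (nearSingular_of_nonneg (fun i j => ?_) (fun j => ?_) fun i => ?_)
  · simpa [abs_mul, hs, hc] using ha i j
  · simp [hs0, hca]
  · by_cases hi : i = 0
    · simp [hi, hs0, hca]
    · have := hsa i
      rw [if_neg hi] at this
      simp only [Equiv.refl_apply, mul_assoc, this, abs_nonneg]

theorem le_of_nearSingular {T : (Fin 3 → ℝ) →ₗ[ℝ] (Fin 3 → ℝ)} {r : ℝ}
    (h1 : r • cube 3 ⊆ ⇑T '' crossPoly 3)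
    (hT : NearSingular fun i j => T (Pi.single j 1) i) : r ≤ 5 / 9 := by
  obtain ⟨v, hv, hk⟩ := hT
  choose s hs hsv using fun i => exists_sign (v i)
  obtain ⟨u, hu, hTu⟩ := h1 (smul_mem_smul_set (show s ∈ cube 3 from fun i => (hs i).le))
  have hcoord (i) : T u i = ∑ j, u j * T (Pi.single j 1) i := by
    conv_lhs => rw [pi_eq_sum_univ' u]
    simp
  have hr : r * ∑ i, |v i| = ∑ j, u j * ∑ i, v i * T (Pi.single j 1) i := by
    calc r * ∑ i, |v i| = ∑ i, v i * T u i := by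
          rw [hTu, Finset.mul_sum]
          exact Finset.sum_congr rfl fun i _ => by rw [← hsv, Pi.smul_apply, smul_eq_mul]; ring
      _ = _ := by
          simp only [hcoord, Finset.mul_sum]
          rw [Finset.sum_comm]
          exact Finset.sum_congr rfl fun _ _ => Finset.sum_congr rfl fun _ _ => by ring
  refine le_of_mul_le_mul_right ?_ hv
  calc r * ∑ i, |v i| ≤ ∑ j, |u j| * (5 / 9 * ∑ i, |v i|) := by
        rw [hr]
        refine Finset.sum_le_sum fun j _ => (le_abs_self _).trans ?_
        rw [abs_mul]
        exact mul_le_mul_of_nonneg_left (hk j) (abs_nonneg _)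
    _ ≤ 5 / 9 * ∑ i, |v i| := by
        rw [← Finset.sum_mul]
        exact mul_le_of_le_one_left (by positivity) hu

/-- If `r·C₃ ⊆ T(C₃*) ⊆ C₃` for a linear `T` and `r > 0`, then `r ≤ 5/9`. -/
theorem stmt2 (T : (Fin 3 → ℝ) →ₗ[ℝ] (Fin 3 → ℝ)) (r : ℝ) (hr : 0 < r)
    (h1 : r • cube 3 ⊆ ⇑T '' crossPoly 3) (h2 : ⇑T '' crossPoly 3 ⊆ cube 3) :
    r ≤ 5/9 := by
  refine le_of_nearSingular h1 (nearSingular fun i j => ?_)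
  refine h2 ⟨Pi.single j 1, ?_, rfl⟩ i
  simp [crossPoly, Pi.single_apply, apply_ite abs]
end
end

section
/- Let T : ℝ³ → ℝ³ be a linear map with (5/9)·C₃ ⊆ T(C₃*) ⊆ C₃. Then the matrix of T arises from the matrix M with entries M_{ii} = 1/3 and M_{ij} = −1 for i ≠ j by permuting rows and columns and multiplying rows and columns by −1; that is, there exist signs ε, δ : {1,2,3} → {−1,1} and permutations σ, τ of {1,2,3} such that T_{ij} = ε(i)·δ(j)·M_{σ(i)τ(j)} for all i, j. -/
open Set Pointwise

noncomputable section

/-- For the matrix `A` with diagonal `-a, -p, -q` and off-diagonal entries `b`, the combination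
`3 * det (A - 5/9 • J) + 2 * det (A + 5/9 • r rᵀ)`, where `J` is the all-ones matrix and
`r = (-1, 1, 1)`, plus a penalty that is positive away from `a = p = q` and `b = 1`. It is affine
in each variable other than `a`. -/
def penalizedDet (a p q b₁₂ b₁₃ b₂₁ b₂₃ b₃₁ b₃₂ : ℝ) : ℝ :=
  5 * (-(a * p * q) + b₁₂ * b₂₃ * b₃₁ + b₁₃ * b₃₂ * b₂₁ + a * b₂₃ * b₃₂ + p * b₁₃ * b₃₁ +
      q * b₁₂ * b₂₁) -
    5/9 * ((p * q - b₂₃ * b₃₂) + (a * q - b₁₃ * b₃₁) + (a * p - b₁₂ * b₂₁) +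
      (a * b₃₂ + b₁₂ * b₃₁) + (a * b₂₃ + b₁₃ * b₂₁)) -
    25/9 * ((b₂₁ * q + b₂₃ * b₃₁) + (b₂₁ * b₃₂ + p * b₃₁) + (b₁₂ * q + b₁₃ * b₃₂) +
      (b₁₂ * b₂₃ + p * b₁₃)) +
    1/50 * ((1 - b₁₂) + (1 - b₁₃) + (1 - b₂₁) + (1 - b₂₃) + (1 - b₃₁) + (1 - b₃₂) +
      (p - a) + (q - a))

lemma affine_nonpos_of_endpoints {f : ℝ → ℝ} {l u : ℝ}
    (hf : ∀ x, (u - l) * f x = (x - l) * f u + (u - x) * f l)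
    (h : ∀ x, x = l ∨ x = u → f x ≤ 0) {x : ℝ} (hl : l ≤ x) (hu : x ≤ u) : f x ≤ 0 := by
  rcases (hl.trans hu).eq_or_lt with hlu | hlu
  · exact h x (Or.inl (le_antisymm (hu.trans hlu.ge) hl))
  · have h₁ := h l (Or.inl rfl)
    have h₂ := h u (Or.inr rfl)
    have : (u - l) * f x ≤ 0 := by
      rw [hf]; nlinarith
    by_contra! hc
    nlinarith [mul_pos (sub_pos.2 hlu) hc]

set_option maxHeartbeats 4000000 in
lemma penalizedDet_vertex_nonpos {a p q b₁₂ b₁₃ b₂₁ b₂₃ b₃₁ b₃₂ : ℝ} (ha : 0 ≤ a) (ha' : a ≤ 1)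
    (hp : p = a ∨ p = 1) (hq : q = a ∨ q = 1)
    (h₁₂ : b₁₂ = 1/4 ∨ b₁₂ = 1) (h₁₃ : b₁₃ = 1/4 ∨ b₁₃ = 1) (h₂₁ : b₂₁ = 1/4 ∨ b₂₁ = 1)
    (h₂₃ : b₂₃ = 1/4 ∨ b₂₃ = 1) (h₃₁ : b₃₁ = 1/4 ∨ b₃₁ = 1) (h₃₂ : b₃₂ = 1/4 ∨ b₃₂ = 1) :
    penalizedDet a p q b₁₂ b₁₃ b₂₁ b₂₃ b₃₁ b₃₂ ≤ 0 := by
  have e₀ : 0 ≤ (1 - a) ^ 3 := pow_nonneg (by linarith) 3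
  have e₁ : 0 ≤ a * (1 - a) ^ 2 := mul_nonneg ha (sq_nonneg _)
  have e₂ : 0 ≤ a ^ 2 * (1 - a) := mul_nonneg (sq_nonneg _) (by linarith)
  have e₃ : 0 ≤ a ^ 3 := pow_nonneg ha 3
  have e₄ : 0 ≤ a * (a - 1/3) ^ 2 := mul_nonneg ha (sq_nonneg _)
  have e₅ : 0 ≤ (1 - a) * (a - 1/3) ^ 2 := mul_nonneg (by linarith) (sq_nonneg _)
  ring_nf at e₀ e₁ e₂ e₃ e₄ e₅
  unfold penalizedDet
  clear ha ha'
  rcases hp with rfl | rfl <;> rcases hq with rfl | rfl <;> rcases h₁₂ with rfl | rfl <;>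
    rcases h₁₃ with rfl | rfl <;> rcases h₂₁ with rfl | rfl <;> rcases h₂₃ with rfl | rfl <;>
    rcases h₃₁ with rfl | rfl <;> rcases h₃₂ with rfl | rfl <;> linarith

lemma penalizedDet_nonpos {a p q b₁₂ b₁₃ b₂₁ b₂₃ b₃₁ b₃₂ : ℝ} (ha : 0 ≤ a) (ha' : a ≤ 1)
    (hp : a ≤ p) (hp' : p ≤ 1) (hq : a ≤ q) (hq' : q ≤ 1)
    (h₁₂ : 1/4 ≤ b₁₂) (h₁₂' : b₁₂ ≤ 1) (h₁₃ : 1/4 ≤ b₁₃) (h₁₃' : b₁₃ ≤ 1)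
    (h₂₁ : 1/4 ≤ b₂₁) (h₂₁' : b₂₁ ≤ 1) (h₂₃ : 1/4 ≤ b₂₃) (h₂₃' : b₂₃ ≤ 1)
    (h₃₁ : 1/4 ≤ b₃₁) (h₃₁' : b₃₁ ≤ 1) (h₃₂ : 1/4 ≤ b₃₂) (h₃₂' : b₃₂ ≤ 1) :
    penalizedDet a p q b₁₂ b₁₃ b₂₁ b₂₃ b₃₁ b₃₂ ≤ 0 := by
  refine affine_nonpos_of_endpoints (f := fun t => penalizedDet a t q b₁₂ b₁₃ b₂₁ b₂₃ b₃₁ b₃₂)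
    (fun x => by unfold penalizedDet; ring) (fun p hp => ?_) hp hp'
  refine affine_nonpos_of_endpoints (f := fun t => penalizedDet a p t b₁₂ b₁₃ b₂₁ b₂₃ b₃₁ b₃₂)
    (fun x => by unfold penalizedDet; ring) (fun q hq => ?_) hq hq'
  refine affine_nonpos_of_endpoints (f := fun t => penalizedDet a p q t b₁₃ b₂₁ b₂₃ b₃₁ b₃₂)
    (fun x => by unfold penalizedDet; ring) (fun b₁₂ h₁₂ => ?_) h₁₂ h₁₂'
  refine affine_nonpos_of_endpoints (f := fun t => penalizedDet a p q b₁₂ t b₂₁ b₂₃ b₃₁ b₃₂)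
    (fun x => by unfold penalizedDet; ring) (fun b₁₃ h₁₃ => ?_) h₁₃ h₁₃'
  refine affine_nonpos_of_endpoints (f := fun t => penalizedDet a p q b₁₂ b₁₃ t b₂₃ b₃₁ b₃₂)
    (fun x => by unfold penalizedDet; ring) (fun b₂₁ h₂₁ => ?_) h₂₁ h₂₁'
  refine affine_nonpos_of_endpoints (f := fun t => penalizedDet a p q b₁₂ b₁₃ b₂₁ t b₃₁ b₃₂)
    (fun x => by unfold penalizedDet; ring) (fun b₂₃ h₂₃ => ?_) h₂₃ h₂₃'
  refine affine_nonpos_of_endpoints (f := fun t => penalizedDet a p q b₁₂ b₁₃ b₂₁ b₂₃ t b₃₂)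
    (fun x => by unfold penalizedDet; ring) (fun b₃₁ h₃₁ => ?_) h₃₁ h₃₁'
  refine affine_nonpos_of_endpoints (f := fun t => penalizedDet a p q b₁₂ b₁₃ b₂₁ b₂₃ b₃₁ t)
    (fun x => by unfold penalizedDet; ring) (fun b₃₂ h₃₂ => ?_) h₃₂ h₃₂'
  exact penalizedDet_vertex_nonpos ha ha' hp hq h₁₂ h₁₃ h₂₁ h₂₃ h₃₁ h₃₂

/-- The linear map with matrix `A` maps the cross-polytope into the cube, and its image contains
`5/9` times the cube. -/
def IsAdmissible (A : Matrix (Fin 3) (Fin 3) ℝ) : Prop :=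
  (∀ i j, |A i j| ≤ 1) ∧
    ∀ s : Fin 3 → ℝ, (∀ i, |s i| ≤ 1) → ∃ y, A.mulVec y = s ∧ ∑ j, |y j| ≤ 9/5

lemma isAdmissible_of_image_crossPoly (T : (Fin 3 → ℝ) →ₗ[ℝ] (Fin 3 → ℝ))
    (h1 : (5/9 : ℝ) • cube 3 ⊆ ⇑T '' crossPoly 3) (h2 : ⇑T '' crossPoly 3 ⊆ cube 3) :
    IsAdmissible (LinearMap.toMatrix' T) := by
  refine ⟨fun i j => ?_, fun s hs => ?_⟩
  · rw [LinearMap.toMatrix'_apply]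
    refine h2 ⟨_, ?_, rfl⟩ i
    simp [crossPoly, Pi.single_apply, apply_ite abs]
  · obtain ⟨y, hy, hTy⟩ := h1 (Set.smul_mem_smul_set (show s ∈ cube 3 from hs))
    refine ⟨(9/5 : ℝ) • y, ?_, ?_⟩
    · rw [Matrix.mulVec_smul, LinearMap.toMatrix'_mulVec, hTy, smul_smul]
      norm_num
    · have hy' : ∑ j, |y j| ≤ 1 := hy
      simp only [Pi.smul_apply, smul_eq_mul, abs_mul, ← Finset.mul_sum]
      rw [abs_of_pos (by norm_num : (0 : ℝ) < 9/5)]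
      linarith

lemma IsAdmissible.signed_submatrix {A : Matrix (Fin 3) (Fin 3) ℝ} (hA : IsAdmissible A)
    {ε δ : Fin 3 → ℝ} (hε : ∀ i, ε i = 1 ∨ ε i = -1) (hδ : ∀ j, δ j = 1 ∨ δ j = -1)
    (σ τ : Equiv.Perm (Fin 3)) :
    IsAdmissible (Matrix.of fun i j => ε i * δ j * A (σ i) (τ j)) := by
  have hε' : ∀ i, |ε i| = 1 := fun i => by rcases hε i with h | h <;> simp [h]
  have hδ' : ∀ j, |δ j| = 1 := fun j => by rcases hδ j with h | h <;> simp [h]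
  have hεε : ∀ i, ε i * ε i = 1 := fun i => by rcases hε i with h | h <;> simp [h]
  have hδδ : ∀ j, δ j * δ j = 1 := fun j => by rcases hδ j with h | h <;> simp [h]
  refine ⟨fun i j => ?_, fun s hs => ?_⟩
  · simpa [abs_mul, hε', hδ'] using hA.1 (σ i) (τ j)
  · obtain ⟨y, hy, hy'⟩ := hA.2 (fun i => ε (σ.symm i) * s (σ.symm i))
      (fun i => by simpa [abs_mul, hε'] using hs _)
    refine ⟨fun j => δ j * y (τ j), ?_, ?_⟩
    · funext i
      have := congrFun hy (σ i)
      simp only [Matrix.mulVec, dotProduct, Equiv.symm_apply_apply] at this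
      rw [← Equiv.sum_comp τ] at this
      calc _ = ε i * ∑ j, A (σ i) (τ j) * y (τ j) := by
            simp only [Matrix.mulVec, dotProduct, Matrix.of_apply, Finset.mul_sum]
            refine Finset.sum_congr rfl fun j _ => ?_
            linear_combination ε i * A (σ i) (τ j) * y (τ j) * hδδ j
        _ = s i := by rw [this, ← mul_assoc, hεε, one_mul]
    · simp only [abs_mul, hδ', one_mul]
      rwa [Equiv.sum_comp τ fun j => |y j|]

lemma det_sub_vecMulVec_nonneg {A : Matrix (Fin 3) (Fin 3) ℝ} (hA : 0 ≤ A.det)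
    {y w : Fin 3 → ℝ} (hy : ∑ j, |y j| ≤ 9/5) (hw : ∀ j, |w j| ≤ 1) :
    0 ≤ (A - (5/9 : ℝ) • Matrix.vecMulVec (A.mulVec y) w).det := by
  have hwy : ∑ j, w j * y j ≤ 9/5 :=
    (Finset.sum_le_sum fun j _ => (le_abs_self _).trans (by
      rw [abs_mul]; exact mul_le_of_le_one_left (abs_nonneg _) (hw j))).trans hy
  have h : (A - (5/9 : ℝ) • Matrix.vecMulVec (A.mulVec y) w).det =
      A.det * (1 - 5/9 * ∑ j, w j * y j) := by
    simp [Matrix.det_fin_three, Matrix.vecMulVec_apply, Matrix.mulVec, dotProduct,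
      Fin.sum_univ_three]
    ring
  rw [h]
  exact mul_nonneg hA (by linarith)

/-- Entrywise bounds for a matrix with nonpositive diagonal mapping a nonnegative vector of small
`ℓ¹` norm to the all-ones vector. -/
lemma offDiag_bounds {A : Matrix (Fin 3) (Fin 3) ℝ} (hA : ∀ i j, A i j ≤ 1)
    (hdiag : ∀ i, A i i ≤ 0) {x : Fin 3 → ℝ} (hx : ∀ j, 0 ≤ x j) (hAx : A.mulVec x = 1)
    (hsum : ∑ j, x j ≤ 9/5) {i j : Fin 3} (hij : i ≠ j) :
    0 < x j ∧ 1/4 ≤ A i j ∧ -A i i * x i ≤ A i j * x j := by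
  have row : ∀ i j k : Fin 3, i ≠ j → i ≠ k → j ≠ k →
      A i i * x i + A i j * x j + A i k * x k = 1 := by
    intro i j k hij hik hjk
    have := congrFun hAx i
    simp only [Matrix.mulVec, dotProduct, Fin.sum_univ_three, Pi.one_apply] at this
    fin_cases i <;> fin_cases j <;> fin_cases k <;> simp at * <;> linarith
  have tot : ∀ i j k : Fin 3, i ≠ j → i ≠ k → j ≠ k → x i + x j + x k ≤ 9/5 := by
    intro i j k hij hik hjk
    simp only [Fin.sum_univ_three] at hsum
    fin_cases i <;> fin_cases j <;> fin_cases k <;> simp at * <;> linarith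
  have off : ∀ i j, A i j * x j ≤ x j := fun i j => mul_le_of_le_one_left (hx j) (hA i j)
  have neg : ∀ i, A i i * x i ≤ 0 := fun i => mul_nonpos_of_nonpos_of_nonneg (hdiag i) (hx i)
  obtain ⟨k, hik, hjk⟩ : ∃ k, i ≠ k ∧ j ≠ k := by
    revert i j; decide
  have r₁ := row i j k hij hik hjk
  have r₂ := row j i k hij.symm hjk hik
  have r₃ := row k i j hik.symm hjk.symm hij
  have t := tot i j k hij hik hjk
  have := neg i
  have := neg j
  have := neg k
  have := off i j
  have := off i k
  have := off j i
  have := off j k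
  have := off k i
  have := off k j
  have hxj : 0 < x j := by linarith
  exact ⟨hxj, by nlinarith, by linarith⟩

lemma det_nonneg_of_offDiag {a p q b₁₂ b₁₃ b₂₁ b₂₃ b₃₁ b₃₂ x y z : ℝ}
    (ha : 0 ≤ a) (hp : 0 ≤ p) (hq : 0 ≤ q) (hx : 0 < x) (hy : 0 < y) (hz : 0 < z)
    (h₁₂ : 0 ≤ b₁₂) (h₁₃ : 0 ≤ b₁₃) (h₂₁ : 0 ≤ b₂₁) (h₂₃ : 0 ≤ b₂₃) (h₃₁ : 0 ≤ b₃₁)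
    (h₃₂ : 0 ≤ b₃₂) (h₁ : a * x ≤ b₁₂ * y) (h₂ : p * y ≤ b₂₃ * z) (h₃ : q * z ≤ b₃₁ * x) :
    0 ≤ -(a * p * q) + b₁₂ * b₂₃ * b₃₁ + b₁₃ * b₃₂ * b₂₁ + a * b₂₃ * b₃₂ + p * b₁₃ * b₃₁ +
      q * b₁₂ * b₂₁ := by
  have h : (a * p * q) * (x * y * z) ≤ (b₁₂ * b₂₃ * b₃₁) * (x * y * z) := by
    calc _ = (a * x) * (p * y) * (q * z) := by ring
      _ ≤ (b₁₂ * y) * (b₂₃ * z) * (b₃₁ * x) := by gcongr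
      _ = _ := by ring
  have h' := le_of_mul_le_mul_right h (by positivity)
  have : 0 ≤ b₁₃ * b₃₂ * b₂₁ := by positivity
  have : 0 ≤ a * b₂₃ * b₃₂ := by positivity
  have : 0 ≤ p * b₁₃ * b₃₁ := by positivity
  have : 0 ≤ q * b₁₂ * b₂₁ := by positivity
  linarith

lemma IsAdmissible.eq_of_normalized {A : Matrix (Fin 3) (Fin 3) ℝ} (hA : IsAdmissible A)
    (hdiag : ∀ i, A i i ≤ 0) (hmax : ∀ i, A i i ≤ A 0 0) {x : Fin 3 → ℝ} (hx : ∀ j, 0 ≤ x j)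
    (hAx : A.mulVec x = 1) (hsum : ∑ j, x j ≤ 9/5) (i j : Fin 3) :
    A i j = if i = j then -(1/3) else 1 := by
  have le_one : ∀ i j, A i j ≤ 1 := fun i j => (abs_le.1 (hA.1 i j)).2
  have neg_one_le : ∀ i j, -1 ≤ A i j := fun i j => (abs_le.1 (hA.1 i j)).1
  have key : ∀ i j : Fin 3, i ≠ j → 0 < x j ∧ 1/4 ≤ A i j ∧ -A i i * x i ≤ A i j * x j :=
    fun i j => offDiag_bounds le_one hdiag hx hAx hsum
  obtain ⟨x₁, b₀₁, c₀₁⟩ := key 0 1 (by decide)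
  obtain ⟨x₂, b₀₂, -⟩ := key 0 2 (by decide)
  obtain ⟨x₀, b₁₀, -⟩ := key 1 0 (by decide)
  obtain ⟨-, b₁₂, c₁₂⟩ := key 1 2 (by decide)
  obtain ⟨-, b₂₀, c₂₀⟩ := key 2 0 (by decide)
  obtain ⟨-, b₂₁, -⟩ := key 2 1 (by decide)
  have d₀ := hdiag 0
  have d₁ := hdiag 1
  have d₂ := hdiag 2
  have m₁ := hmax 1
  have m₂ := hmax 2
  have hdet : 0 ≤ A.det := by
    have := det_nonneg_of_offDiag (neg_nonneg.2 d₀) (neg_nonneg.2 d₁) (neg_nonneg.2 d₂) x₀ x₁ x₂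
      (b₁₂ := A 0 1) (b₁₃ := A 0 2) (b₂₁ := A 1 0) (b₂₃ := A 1 2) (b₃₁ := A 2 0) (b₃₂ := A 2 1)
      (by linarith) (by linarith) (by linarith) (by linarith) (by linarith) (by linarith)
      c₀₁ c₁₂ c₂₀
    rw [Matrix.det_fin_three]
    linarith
  have f₀ := det_sub_vecMulVec_nonneg hdet (y := x) (w := 1)
    (by simpa only [abs_of_nonneg (hx _)] using hsum) (by simp)
  rw [hAx] at f₀
  obtain ⟨y, hAy, hy⟩ := hA.2 ![-1, 1, 1] (by intro i; fin_cases i <;> simp)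
  have f₁ := det_sub_vecMulVec_nonneg hdet (y := y) (w := ![1, -1, -1]) hy
    (by intro i; fin_cases i <;> simp)
  rw [hAy] at f₁
  have hpen := penalizedDet_nonpos (neg_nonneg.2 d₀) (by linarith [neg_one_le 0 0])
    (neg_le_neg m₁) (by linarith [neg_one_le 1 1]) (neg_le_neg m₂) (by linarith [neg_one_le 2 2])
    b₀₁ (le_one 0 1) b₀₂ (le_one 0 2) b₁₀ (le_one 1 0) b₁₂ (le_one 1 2) b₂₀ (le_one 2 0)
    b₂₁ (le_one 2 1)
  have hpen' : 1/50 * ((1 - A 0 1) + (1 - A 0 2) + (1 - A 1 0) + (1 - A 1 2) + (1 - A 2 0) +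
      (1 - A 2 1) + (A 0 0 - A 1 1) + (A 0 0 - A 2 2)) ≤
      penalizedDet (-A 0 0) (-A 1 1) (-A 2 2) (A 0 1) (A 0 2) (A 1 0) (A 1 2) (A 2 0) (A 2 1) := by
    simp [Matrix.det_fin_three] at f₀ f₁
    unfold penalizedDet
    linarith
  have l := le_one
  have e₀₁ : A 0 1 = 1 := by
    linarith [l 0 1, l 0 2, l 1 0, l 1 2, l 2 0, l 2 1]
  have e₀₂ : A 0 2 = 1 := by linarith [l 0 1, l 0 2, l 1 0, l 1 2, l 2 0, l 2 1]
  have e₁₀ : A 1 0 = 1 := by linarith [l 0 1, l 0 2, l 1 0, l 1 2, l 2 0, l 2 1]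
  have e₁₂ : A 1 2 = 1 := by linarith [l 0 1, l 0 2, l 1 0, l 1 2, l 2 0, l 2 1]
  have e₂₀ : A 2 0 = 1 := by linarith [l 0 1, l 0 2, l 1 0, l 1 2, l 2 0, l 2 1]
  have e₂₁ : A 2 1 = 1 := by linarith [l 0 1, l 0 2, l 1 0, l 1 2, l 2 0, l 2 1]
  have e₁₁ : A 1 1 = A 0 0 := by linarith
  have e₂₂ : A 2 2 = A 0 0 := by linarith
  have e₀₀ : A 0 0 = -(1/3) := by
    rw [e₀₁, e₀₂, e₁₀, e₁₂, e₂₀, e₂₁, e₁₁, e₂₂] at hpen'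
    unfold penalizedDet at hpen'
    have : (A 0 0 + 1/3) ^ 2 ≤ 0 := by
      nlinarith [mul_nonneg (neg_nonneg.2 d₀) (sq_nonneg (A 0 0 + 1/3))]
    nlinarith
  fin_cases i <;> fin_cases j <;> simp [*]

/-- Some orthant has the property that no column of `A` lies in its interior or in the interior of
its opposite. -/
lemma exists_sign_mixed (A : Matrix (Fin 3) (Fin 3) ℝ) :
    ∃ s : Fin 3 → ℝ, (∀ i, s i = 1 ∨ s i = -1) ∧
      ∀ j, (∃ i, s i * A i j ≤ 0) ∧ ∃ i, 0 ≤ s i * A i j := by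
  by_contra! h
  let v : Fin 4 → Fin 3 → ℝ := fun k i => if k = i.succ then -1 else 1
  have hv : ∀ k, ∃ j, ∀ i i', 0 < (v k i * v k i') * (A i j * A i' j) := by
    intro k
    obtain ⟨j, hj⟩ := h (v k) (fun i => by by_cases hk : k = i.succ <;> simp [v, hk])
    refine ⟨j, fun i i' => ?_⟩
    rw [mul_mul_mul_comm]
    by_cases hpos : ∃ i, v k i * A i j ≤ 0
    · obtain ⟨i₀, hi₀⟩ := hpos
      by_cases hall : ∀ i, v k i * A i j < 0
      · exact mul_pos_of_neg_of_neg (hall i) (hall i')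
      · exact absurd (hj ⟨i₀, hi₀⟩) hall
    · push Not at hpos
      exact mul_pos (hpos i) (hpos i')
  choose f hf using hv
  obtain ⟨k, k', hkk, hff⟩ := Fintype.exists_ne_map_eq_of_card_lt f (by simp)
  have g := hf k
  have g' := hf k'
  rw [← hff] at g'
  have g₁ := g 0 1
  have g₂ := g 0 2
  have g₁' := g' 0 1
  have g₂' := g' 0 2
  fin_cases k <;> fin_cases k' <;> simp [v] at hkk g₁ g₂ g₁' g₂' <;> first | omega | linarith

/-- any linear `T` with `(5/9)·C₃ ⊆ T(C₃*) ⊆ C₃` has matrix obtained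
from the matrix with `1/3` on the diagonal and `−1` off the diagonal by permuting
rows/columns and changing signs of rows/columns. -/
theorem stmt3 (T : (Fin 3 → ℝ) →ₗ[ℝ] (Fin 3 → ℝ))
    (h1 : (5/9 : ℝ) • cube 3 ⊆ ⇑T '' crossPoly 3) (h2 : ⇑T '' crossPoly 3 ⊆ cube 3) :
    ∃ (ε δ : Fin 3 → ℝ) (σ τ : Equiv.Perm (Fin 3)),
      (∀ i, ε i = 1 ∨ ε i = -1) ∧ (∀ j, δ j = 1 ∨ δ j = -1) ∧
      ∀ i j, T (Pi.single j 1) i =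
        ε i * δ j * (if σ i = τ j then (1/3 : ℝ) else -1) := by
  have hA := isAdmissible_of_image_crossPoly T h1 h2
  simp only [← LinearMap.toMatrix'_apply]
  set A := LinearMap.toMatrix' T
  obtain ⟨s, hs, hmix⟩ := exists_sign_mixed A
  obtain ⟨y, hAy, hy⟩ := hA.2 s (fun i => by rcases hs i with h | h <;> simp [h])
  let δ : Fin 3 → ℝ := fun j => if 0 ≤ y j then 1 else -1
  have hδ : ∀ j, δ j = 1 ∨ δ j = -1 := fun j => by by_cases h : 0 ≤ y j <;> simp [δ, h]
  have hδy : ∀ j, δ j * |y j| = y j := fun j => by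
    by_cases h : 0 ≤ y j
    · simp [δ, h, abs_of_nonneg h]
    · simp [δ, h, abs_of_neg (not_le.1 h)]
  have hneg : ∀ j, ∃ i, s i * δ j * A i j ≤ 0 := by
    intro j
    obtain ⟨⟨i, hi⟩, i', hi'⟩ := hmix j
    rcases hδ j with h | h
    · exact ⟨i, by rw [h]; linarith⟩
    · exact ⟨i', by rw [h]; linarith⟩
  have hrow : ∀ i, ∑ j, s i * δ j * A i j * |y j| = 1 := by
    intro i
    have h := congrFun hAy i
    simp only [Matrix.mulVec, dotProduct] at h
    calc _ = s i * ∑ j, A i j * y j := by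
          rw [Finset.mul_sum]
          refine Finset.sum_congr rfl fun j _ => ?_
          linear_combination s i * A i j * hδy j
      _ = 1 := by rw [h]; rcases hs i with h | h <;> simp [h]
  have hle : ∀ i j, s i * δ j * A i j ≤ 1 := fun i j => by
    simpa using (abs_le.1 ((hA.signed_submatrix hs hδ 1 1).1 i j)).2
  choose f hf using hneg
  have hinj : Function.Injective f := by
    intro j k hjk
    by_contra hne
    obtain ⟨l, hlj, hlk⟩ : ∃ l, j ≠ l ∧ k ≠ l := by
      clear * - hne
      revert j k; decide
    have expand : ∀ g : Fin 3 → ℝ, ∑ i, g i = g j + g k + g l := by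
      intro g
      rw [Fin.sum_univ_three]
      clear * - hne hlj hlk
      fin_cases j <;> fin_cases k <;> fin_cases l <;> simp at * <;> ring
    have hj := hrow (f j)
    have hl := hrow (f l)
    rw [expand] at hj hl hy
    have u₁ := mul_nonpos_of_nonpos_of_nonneg (hf j) (abs_nonneg (y j))
    have u₂ := mul_nonpos_of_nonpos_of_nonneg (hf k) (abs_nonneg (y k))
    have u₃ := mul_nonpos_of_nonpos_of_nonneg (hf l) (abs_nonneg (y l))
    rw [← hjk] at u₂
    have u₄ := mul_le_of_le_one_left (abs_nonneg (y l)) (hle (f j) l)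
    have u₅ := mul_le_of_le_one_left (abs_nonneg (y j)) (hle (f l) j)
    have u₆ := mul_le_of_le_one_left (abs_nonneg (y k)) (hle (f l) k)
    linarith
  let π : Equiv.Perm (Fin 3) := Equiv.ofBijective f (Finite.injective_iff_bijective.1 hinj)
  obtain ⟨j₀, hj₀⟩ := Finite.exists_max fun j => s (f j) * δ j * A (f j) j
  let τ : Equiv.Perm (Fin 3) := Equiv.swap 0 j₀
  have hτ : τ 0 = j₀ := Equiv.swap_apply_left 0 j₀
  have hB := (hA.signed_submatrix (fun i => hs ((τ.trans π) i)) (fun j => hδ (τ j))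
    (τ.trans π) τ).eq_of_normalized (x := fun j => |y (τ j)|) (fun i => hf (τ i))
    (fun i => by
      simp only [Matrix.of_apply, Equiv.trans_apply, hτ]
      exact hj₀ (τ i))
    (fun j => abs_nonneg _)
    (by
      funext i
      simp only [Matrix.mulVec, dotProduct, Matrix.of_apply, Pi.one_apply]
      rw [Equiv.sum_comp τ fun j => s (τ.trans π i) * δ j * A (τ.trans π i) j * |y j|]
      exact hrow _)
    (by rwa [Equiv.sum_comp τ fun j => |y j|])
  refine ⟨s, fun j => -δ j, (τ.trans π).symm, τ.symm, hs,
    fun j => by rcases hδ j with h | h <;> simp [h], fun i j => ?_⟩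
  have h := hB ((τ.trans π).symm i) (τ.symm j)
  simp only [Matrix.of_apply, Equiv.apply_symm_apply] at h
  have hss : s i * s i = 1 := by rcases hs i with h | h <;> simp [h]
  have hdd : δ j * δ j = 1 := by rcases hδ j with h | h <;> simp [h]
  have hij : A i j = s i * δ j * (s i * δ j * A i j) := by
    linear_combination (-A i j * δ j * δ j) * hss - A i j * hdd
  rw [hij, h]
  split_ifs <;> ring
end
end

section
/- The linear map T : ℝ³ → ℝ³ whose matrix has rows (1/3, −1, −1), (−1, 1/3, −1), (−1, −1, 1/3) satisfies (5/9)·C₃ ⊆ T(C₃*) ⊆ C₃. -/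
open Set Pointwise

noncomputable section

/-- the linear map with matrix rows `(1/3, −1, −1)`, `(−1, 1/3, −1)`,
`(−1, −1, 1/3)` satisfies `(5/9)·C₃ ⊆ T(C₃*) ⊆ C₃`. -/
theorem stmt4 :
    (5/9 : ℝ) • cube 3 ⊆
      ⇑(Matrix.toLin' (!![(1/3 : ℝ), -1, -1; -1, 1/3, -1; -1, -1, 1/3])) '' crossPoly 3 ∧
    ⇑(Matrix.toLin' (!![(1/3 : ℝ), -1, -1; -1, 1/3, -1; -1, -1, 1/3])) '' crossPoly 3 ⊆
      cube 3 := by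
  constructor
  · rintro _ ⟨y, hy, rfl⟩
    set s : ℝ := y 0 + y 1 + y 2 with hs
    refine ⟨fun i => 5 / 12 * y i - s / 4, ?_, ?_⟩
    · obtain ⟨h0, h0'⟩ := abs_le.mp (hy 0)
      obtain ⟨h1, h1'⟩ := abs_le.mp (hy 1)
      obtain ⟨h2, h2'⟩ := abs_le.mp (hy 2)
      simp only [crossPoly, Set.mem_ofPred_eq, Fin.sum_univ_three]
      rcases abs_cases (5 / 12 * y 0 - s / 4) with ⟨e0, -⟩ | ⟨e0, -⟩ <;>
      rcases abs_cases (5 / 12 * y 1 - s / 4) with ⟨e1, -⟩ | ⟨e1, -⟩ <;>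
      rcases abs_cases (5 / 12 * y 2 - s / 4) with ⟨e2, -⟩ | ⟨e2, -⟩ <;>
      rw [e0, e1, e2] <;> linarith
    · ext i
      fin_cases i <;>
        simp [Matrix.toLin'_apply, Matrix.mulVec, dotProduct, Fin.sum_univ_three] <;> linarith
  · rintro _ ⟨x, hx, rfl⟩ i
    simp only [crossPoly, Set.mem_ofPred_eq, Fin.sum_univ_three] at hx
    have h0 := abs_le.mp (le_refl |x 0|)
    have h1 := abs_le.mp (le_refl |x 1|)
    have h2 := abs_le.mp (le_refl |x 2|)
    have hn0 := abs_nonneg (x 0)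
    have hn1 := abs_nonneg (x 1)
    have hn2 := abs_nonneg (x 2)
    rw [abs_le]
    fin_cases i <;>
      simp [Matrix.toLin'_apply, Matrix.mulVec, dotProduct, Fin.sum_univ_three] <;>
      constructor <;> linarith
end
end

section
/- Let T : ℝ³ → ℝ³ be a linear map with (5/9)·C₃ ⊆ T(C₃*) ⊆ C₃. Then each of the six points ±T(e₁), ±T(e₂), ±T(e₃) lies in the set V = {x ∈ ℝ³ : ∀ j, 1/3 ≤ |xⱼ| ≤ 1}, and moreover for each choice of signs ε₁, ε₂, ε₃ ∈ {−1,1}, the cube V_{(ε₁,ε₂,ε₃)} = {x ∈ ℝ³ : ∀ j, 1/3 ≤ εⱼxⱼ ≤ 1} contains at most one of these six points. -/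
open Set Pointwise

noncomputable section

/-- Normalized planar case: if `±(a, α)`, `±(u, h)` span a subset of the square whose hull contains
`(±5/9, 5/9)`, then `|a| ≥ 1/3`. -/
lemma one_third_le_abs_of_nonneg {a α u h l m l' m' : ℝ} (hα : 0 ≤ α) (hα1 : α ≤ 1)
    (hu : 0 ≤ u) (hu1 : u ≤ 1) (hh : 0 ≤ h) (hh1 : h ≤ 1)
    (hl : |l| + |m| ≤ 1) (hl' : |l'| + |m'| ≤ 1)
    (e1 : l * a + m * u = 5/9) (e2 : l * α + m * h = 5/9)
    (e1' : l' * a + m' * u = -(5/9)) (e2' : l' * α + m' * h = 5/9) : 1/3 ≤ |a| := by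
  by_contra! ha
  have bound : ∀ x : ℝ, |x * a| ≤ |x| / 3 := fun x => by
    rw [abs_mul]; nlinarith [abs_nonneg x]
  have hla := abs_le.1 (bound l)
  have hla' := abs_le.1 (bound l')
  have hmu : 0 < m * u := by linarith [abs_nonneg m]
  have hmu' : m' * u < 0 := by linarith [abs_nonneg m']
  have hm : 0 < m := pos_of_mul_pos_left hmu hu
  have hm' : m' < 0 := by
    by_contra! h0
    linarith [mul_nonneg h0 hu]
  rw [abs_of_pos hm] at hl
  rw [abs_of_neg hm'] at hl'
  have hmu1 : m * u ≤ m := mul_le_of_le_one_right hm.le hu1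
  have hmu1' : m' ≤ m' * u := by linarith [mul_le_of_le_one_right (neg_nonneg.2 hm'.le) hu1]
  have hm'h : m' * h ≤ 0 := mul_nonpos_of_nonpos_of_nonneg hm'.le hh
  have hl'0 : 0 < l' := pos_of_mul_pos_left (by linarith) hα
  rw [abs_of_pos hl'0] at hl' hla'
  have hl'α : l' * α ≤ l' := mul_le_of_le_one_right hl'0.le hα1
  obtain ⟨ha1, ha2⟩ := abs_lt.1 ha
  have hh3 : h ≤ 1/3 := by
    have h1 : 1/3 * h ≤ -m' * h := mul_le_mul_of_nonneg_right (by linarith) hh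
    linarith
  have hl0 : 0 < l := by
    have : m * h ≤ m * (1/3) := mul_le_mul_of_nonneg_left hh3 hm.le
    exact pos_of_mul_pos_left (by linarith [abs_nonneg l]) hα
  rw [abs_of_pos hl0] at hl
  have hlα : l * α ≤ l := mul_le_of_le_one_right hl0.le hα1
  have ha0 : a < 0 := by
    by_contra! h0
    linarith [mul_nonneg hl'0.le h0]
  have k1 : 1 - 5 * a ≤ (5 - 9 * a) * h := by
    have h1 : m * (1 - h) ≤ 4/9 := by linarith
    have h2 : 5/9 * (1 - a) ≤ m * (1 - a * h) := by
      have : 0 ≤ -a * (l - 5/9 + m * h) := mul_nonneg (by linarith) (by linarith)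
      linarith
    have h3 : m * (1 - h) * (1 - a * h) ≤ 4/9 * (1 - a * h) :=
      mul_le_mul_of_nonneg_right h1
        (by linarith [mul_nonneg (neg_nonneg.2 ha0.le) hh])
    have h4 : 5/9 * (1 - a) * (1 - h) ≤ m * (1 - a * h) * (1 - h) :=
      mul_le_mul_of_nonneg_right h2 (by linarith)
    linarith
  have k2 : (5 + 9 * a) * h ≤ -1 - 5 * a := by
    have h1 : -m' * (1 + h) ≤ 4/9 := by linarith
    have h2 : 5/9 + a ≤ -m' * (1 + a) := by
      have : 0 ≤ -a * (1 + m' - l') := mul_nonneg (by linarith) (by linarith)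
      linarith
    have h3 : -m' * (1 + h) * (1 + a) ≤ 4/9 * (1 + a) :=
      mul_le_mul_of_nonneg_right h1 (by linarith)
    have h4 : (5/9 + a) * (1 + h) ≤ -m' * (1 + a) * (1 + h) :=
      mul_le_mul_of_nonneg_right h2 (by linarith)
    linarith
  have h1 : (1 - 5 * a) * (5 + 9 * a) ≤ (5 - 9 * a) * h * (5 + 9 * a) :=
    mul_le_mul_of_nonneg_right k1 (by linarith)
  have h2 : (5 + 9 * a) * h * (5 - 9 * a) ≤ (-1 - 5 * a) * (5 - 9 * a) :=
    mul_le_mul_of_nonneg_right k2 (by linarith)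
  have h3 : 0 < (1/3 - a) * (1/3 + a) := mul_pos (by linarith) (by linarith)
  linarith

/-- If the hull of `±(a, α)`, `±(u, h)` contains `(±5/9, 5/9)` and these points lie in the unit square
(no bound on `a` being needed), then `|a| ≥ 1/3`. -/
lemma one_third_le_abs_planar {a α u h l m l' m' : ℝ} (hα : |α| ≤ 1)
    (hu : |u| ≤ 1) (hh : |h| ≤ 1)
    (hl : |l| + |m| ≤ 1) (hl' : |l'| + |m'| ≤ 1)
    (e1 : l * a + m * u = 5/9) (e2 : l * α + m * h = 5/9)
    (e1' : l' * a + m' * u = -(5/9)) (e2' : l' * α + m' * h = 5/9) : 1/3 ≤ |a| := by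
  wlog hα0 : 0 ≤ α generalizing a α l l'
  · rw [← abs_neg a]
    exact this (a := -a) (α := -α) (l := -l) (l' := -l') (by simpa) (by simpa) (by simpa)
      (by linarith) (by linarith) (by linarith) (by linarith) (by linarith)
  wlog hu0 : 0 ≤ u generalizing u h m m'
  · exact this (u := -u) (h := -h) (m := -m) (m' := -m') (by simpa) (by simpa) (by simpa)
      (by simpa) (by linarith) (by linarith) (by linarith) (by linarith) (by linarith)
  rw [abs_le] at hα hu hh
  rcases le_total 0 h with hh0 | hh0
  · exact one_third_le_abs_of_nonneg hα0 hα.2 hu0 hu.2 hh0 hh.2 hl hl' e1 e2 e1' e2'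
  · rw [← abs_neg a]
    exact one_third_le_abs_of_nonneg (a := -a) (h := -h) (l := l') (m := -m') (l' := l) (m' := -m)
      hα0 hα.2 hu0 hu.2 (by linarith) (by linarith) (by simpa) (by simpa)
      (by linarith) (by linarith) (by linarith) (by linarith)

/-- A line through the origin in the plane is spanned by a vector of unit `ℓ¹` norm. -/
lemma exists_unit_spanning_line {β γ : ℝ} (h : β ≠ 0 ∨ γ ≠ 0) :
    ∃ d e : ℝ, |d| + |e| = 1 ∧
      ∀ x y : ℝ, x * β + y * γ = 0 → ∃ μ : ℝ, x = μ * d ∧ y = μ * e := by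
  have hN : 0 < |β| + |γ| := by
    rcases h with h | h
    · linarith [abs_pos.2 h, abs_nonneg γ]
    · linarith [abs_pos.2 h, abs_nonneg β]
  refine ⟨γ / (|β| + |γ|), -β / (|β| + |γ|), ?_, fun x y hxy => ?_⟩
  · rw [abs_div, abs_div, abs_neg, abs_of_pos hN]
    field_simp
    ring
  · rcases h with h | h
    · refine ⟨-y * (|β| + |γ|) / β, ?_, ?_⟩
      · field_simp
        linarith
      · field_simp
    · refine ⟨x * (|β| + |γ|) / γ, ?_, ?_⟩
      · field_simp
      · field_simp
        linarith

lemma abs_combination_le_one {d e x y : ℝ} (h : |d| + |e| ≤ 1) (hx : |x| ≤ 1) (hy : |y| ≤ 1) :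
    |d * x + e * y| ≤ 1 := by
  refine (abs_add_le _ _).trans ?_
  rw [abs_mul, abs_mul]
  nlinarith [abs_nonneg d, abs_nonneg e]

/-- If the octahedron with vertices `±a`, `±b`, `±c` lies between the cubes of radii `5/9` and `1`,
then `|a₁| ≥ 1/3`. -/
lemma one_third_le_abs_entry {a1 a2 a3 b1 b2 b3 c1 c2 c3 : ℝ}
    (ha2 : |a2| ≤ 1) (ha3 : |a3| ≤ 1) (hb1 : |b1| ≤ 1) (hb2 : |b2| ≤ 1) (hb3 : |b3| ≤ 1)
    (hc1 : |c1| ≤ 1) (hc2 : |c2| ≤ 1) (hc3 : |c3| ≤ 1)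
    (H : ∀ x y z : ℝ, |x| ≤ 1 → |y| ≤ 1 → |z| ≤ 1 → ∃ l m n : ℝ, |l| + |m| + |n| ≤ 1 ∧
      l * a1 + m * b1 + n * c1 = 5/9 * x ∧ l * a2 + m * b2 + n * c2 = 5/9 * y ∧
      l * a3 + m * b3 + n * c3 = 5/9 * z) : 1/3 ≤ |a1| := by
  wlog h32 : |a3| ≤ |a2| generalizing a2 a3 b2 b3 c2 c3
  · refine this ha3 ha2 hb3 hb2 hc3 hc2 (fun x y z hx hy hz => ?_) (le_of_not_ge h32)
    obtain ⟨l, m, n, h, h1, h2, h3⟩ := H x z y hx hz hy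
    exact ⟨l, m, n, h, h1, h3, h2⟩
  obtain ⟨ρ, hρ, rfl⟩ : ∃ ρ : ℝ, |ρ| ≤ 1 ∧ a3 = ρ * a2 := by
    by_cases h0 : a2 = 0
    · exact ⟨0, by simp, by simpa [h0] using h32⟩
    · refine ⟨a3 / a2, ?_, by field_simp⟩
      rw [abs_div]
      exact div_le_one_of_le₀ h32 (abs_nonneg _)
  have hne : b3 - ρ * b2 ≠ 0 ∨ c3 - ρ * c2 ≠ 0 := by
    by_contra! h
    obtain ⟨l, m, n, -, -, h2, h3⟩ := H 0 0 1 (by simp) (by simp) (by simp)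
    have hb : b3 = ρ * b2 := by linarith [h.1]
    have hc : c3 = ρ * c2 := by linarith [h.2]
    rw [hb, hc] at h3
    have : ρ * (l * a2 + m * b2 + n * c2) = 5/9 := by linarith
    rw [h2] at this
    norm_num at this
  obtain ⟨d, e, hde, hline⟩ := exists_unit_spanning_line hne
  obtain ⟨l, m, n, h, h1, h2, h3⟩ := H 1 1 ρ (by simp) (by simp) hρ
  obtain ⟨l', m', n', h', h1', h2', h3'⟩ := H (-1) 1 ρ (by simp) (by simp) hρ
  obtain ⟨μ, rfl, rfl⟩ := hline m n (by linear_combination h3 - ρ * h2)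
  obtain ⟨μ', rfl, rfl⟩ := hline m' n' (by linear_combination h3' - ρ * h2')
  have norm_eq : ∀ t : ℝ, |t * d| + |t * e| = |t| := fun t => by
    rw [abs_mul, abs_mul, ← mul_add, hde, mul_one]
  exact one_third_le_abs_planar (α := a2) (u := d * b1 + e * c1) (h := d * b2 + e * c2)
    (l := l) (m := μ) (l' := l') (m' := μ')
    ha2 (abs_combination_le_one hde.le hb1 hc1) (abs_combination_le_one hde.le hb2 hc2)
    (by linarith [norm_eq μ]) (by linarith [norm_eq μ'])
    (by linarith) (by linarith) (by linarith) (by linarith)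

/-- Among three reals, two have nonnegative product. -/
lemma exists_ne_mul_nonneg (f : Fin 3 → ℝ) : ∃ j k : Fin 3, j ≠ k ∧ 0 ≤ f j * f k := by
  by_contra! h
  have h01 := h 0 1 (by decide)
  have h02 := h 0 2 (by decide)
  have h12 := h 1 2 (by decide)
  nlinarith [mul_pos_of_neg_of_neg h01 h02, sq_nonneg (f 0)]

lemma abs_sub_le_one_of_mul_nonneg {x y : ℝ} (hx : |x| ≤ 1) (hy : |y| ≤ 1) (h : 0 ≤ x * y) :
    |x - y| ≤ 1 := by
  rw [abs_le] at *
  rcases mul_nonneg_iff.1 h with h | h <;> constructor <;> linarith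

/-- for `T` with `(5/9)·C₃ ⊆ T(C₃*) ⊆ C₃`, all six points `±T(eᵢ)` lie
in `V = {x : ∀ j, 1/3 ≤ |xⱼ| ≤ 1}`, and each cube `V_ε` contains at most one of them. -/
theorem stmt5 (T : (Fin 3 → ℝ) →ₗ[ℝ] (Fin 3 → ℝ))
    (h1 : (5/9 : ℝ) • cube 3 ⊆ ⇑T '' crossPoly 3) (h2 : ⇑T '' crossPoly 3 ⊆ cube 3) :
    ({x | ∃ i : Fin 3, x = T (Pi.single i 1) ∨ x = -T (Pi.single i 1)} : Set (Fin 3 → ℝ)) ⊆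
      {x | ∀ j, 1/3 ≤ |x j| ∧ |x j| ≤ 1} ∧
    ∀ ε : Fin 3 → ℝ, (∀ j, ε j = 1 ∨ ε j = -1) →
      Set.Subsingleton
        ({x | ∃ i : Fin 3, x = T (Pi.single i 1) ∨ x = -T (Pi.single i 1)} ∩
          {x : Fin 3 → ℝ | ∀ j, 1/3 ≤ ε j * x j ∧ ε j * x j ≤ 1}) := by
  set M : Fin 3 → Fin 3 → ℝ := fun i => T (Pi.single i 1) with hM
  have hT : ∀ (l : Fin 3 → ℝ) (j : Fin 3), T l j = ∑ i, l i * M i j := fun l j => by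
    conv_lhs => rw [pi_eq_sum_univ' l]
    simp [hM, Finset.sum_apply]
  have hle : ∀ i j, |M i j| ≤ 1 := fun i j => by
    refine h2 ⟨Pi.single i 1, ?_, rfl⟩ j
    simp only [crossPoly, Set.mem_ofPred_eq]
    fin_cases i <;> simp [Fin.sum_univ_three]
  have hsurj : ∀ x : Fin 3 → ℝ, (∀ j, |x j| ≤ 1) →
      ∃ l : Fin 3 → ℝ, ∑ i, |l i| ≤ 1 ∧ ∀ j, ∑ i, l i * M i j = 5/9 * x j := fun x hx => by
    obtain ⟨l, hl, hlx⟩ := h1 (Set.smul_mem_smul_set (a := (5/9 : ℝ)) (show x ∈ cube 3 from hx))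
    exact ⟨l, hl, fun j => by rw [← hT, hlx]; simp⟩
  have hentry : ∀ i j, 1/3 ≤ |M i j| := by
    intro i j
    have hi : ∃ i₂ i₃ : Fin 3, ∀ f : Fin 3 → ℝ, ∑ t, f t = f i + f i₂ + f i₃ :=
      ⟨i + 1, i + 2, fun f => by fin_cases i <;> simp [Fin.sum_univ_three] <;> ring⟩
    have hj : j + 1 ≠ j ∧ j + 2 ≠ j ∧ j + 2 ≠ j + 1 := by revert j; decide
    obtain ⟨i₂, i₃, hs⟩ := hi
    refine one_third_le_abs_entry (a2 := M i (j + 1)) (a3 := M i (j + 2))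
      (b1 := M i₂ j) (b2 := M i₂ (j + 1)) (b3 := M i₂ (j + 2))
      (c1 := M i₃ j) (c2 := M i₃ (j + 1)) (c3 := M i₃ (j + 2))
      (hle _ _) (hle _ _) (hle _ _) (hle _ _) (hle _ _) (hle _ _) (hle _ _) (hle _ _)
      fun x y z hx hy hz => ?_
    obtain ⟨l, hl, hlx⟩ := hsurj (fun t => if t = j then x else if t = j + 1 then y else z)
      (fun t => by split_ifs <;> assumption)
    rw [hs] at hl
    simp only [hs] at hlx
    refine ⟨l i, l i₂, l i₃, hl, ?_, ?_, ?_⟩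
    · simpa using hlx j
    · simpa [hj.1] using hlx (j + 1)
    · simpa only [if_neg hj.2.1, if_neg hj.2.2] using hlx (j + 2)
  refine ⟨?_, ?_⟩
  · rintro x ⟨i, rfl | rfl⟩ j
    · exact ⟨hentry i j, hle i j⟩
    · rw [Pi.neg_apply, abs_neg]
      exact ⟨hentry i j, hle i j⟩
  · intro ε hε
    have hεabs : ∀ j, |ε j| = 1 := fun j => by rcases hε j with h | h <;> simp [h]
    have hεsq : ∀ j, ε j * ε j = 1 := fun j => by rcases hε j with h | h <;> simp [h]
    have hsep : ∀ j k, j ≠ k → ∃ i, 1 < |ε j * M i j - ε k * M i k| := by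
      intro j k hjk
      by_contra! hf
      obtain ⟨l, hl, hlx⟩ := hsurj
        (fun t => if t = j then ε j else if t = k then -ε k else 0)
        (fun t => by split_ifs <;> simp [hεabs])
      have hj := hlx j
      have hk := hlx k
      simp only [if_true, if_neg hjk.symm] at hj hk
      have hval : ∑ i, l i * (ε j * M i j - ε k * M i k) = 10/9 := by
        calc ∑ i, l i * (ε j * M i j - ε k * M i k)
            = ε j * ∑ i, l i * M i j - ε k * ∑ i, l i * M i k := by
              rw [Finset.mul_sum, Finset.mul_sum, ← Finset.sum_sub_distrib]
              exact Finset.sum_congr rfl fun i _ => by ring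
          _ = 10/9 := by
              rw [hj, hk]
              linear_combination 5/9 * hεsq j + 5/9 * hεsq k
      have hbd : ∑ i, l i * (ε j * M i j - ε k * M i k) ≤ ∑ i, |l i| := by
        refine Finset.sum_le_sum fun i _ => (le_abs_self _).trans ?_
        rw [abs_mul]
        exact mul_le_of_le_one_right (abs_nonneg _) (hf i)
      linarith
    have hcube : ∀ (x : Fin 3 → ℝ) i, (x = T (Pi.single i 1) ∨ x = -T (Pi.single i 1)) →
        (∀ j, 1/3 ≤ ε j * x j ∧ ε j * x j ≤ 1) → ∀ j k, |ε j * M i j - ε k * M i k| ≤ 1 := by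
      rintro x i (rfl | rfl) hx j k
      · obtain ⟨hj, hj'⟩ := hx j
        obtain ⟨hk, hk'⟩ := hx k
        rw [abs_le]
        constructor <;> linarith
      · obtain ⟨hj, hj'⟩ := hx j
        obtain ⟨hk, hk'⟩ := hx k
        simp only [Pi.neg_apply, mul_neg] at hj hj' hk hk'
        rw [abs_le]
        constructor <;> linarith
    rintro x ⟨⟨i, hxi⟩, hx⟩ y ⟨⟨i', hyi⟩, hy⟩
    by_cases hii : i = i'
    · subst hii
      have hx0 := (hx 0).1
      have hy0 := (hy 0).1
      rcases hxi with rfl | rfl <;> rcases hyi with rfl | rfl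
      · rfl
      · simp only [Pi.neg_apply, mul_neg] at hy0
        linarith
      · simp only [Pi.neg_apply, mul_neg] at hx0
        linarith
      · rfl
    · exfalso
      obtain ⟨r, hr⟩ : ∃ r : Fin 3, ∀ t, t = i ∨ t = i' ∨ t = r := by
        clear hxi hyi
        revert i i'; decide
      obtain ⟨j, k, hjk, hpos⟩ := exists_ne_mul_nonneg fun j => ε j * M r j
      obtain ⟨t, ht⟩ := hsep j k hjk
      refine ht.not_ge ?_
      rcases hr t with rfl | rfl | rfl
      · exact hcube x _ hxi hx j k
      · exact hcube y _ hyi hy j k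
      · refine abs_sub_le_one_of_mul_nonneg ?_ ?_ hpos <;>
        · rw [abs_mul, hεabs, one_mul]
          exact hle _ _
end
end

section
/- The linear map T : ℝ⁴ → ℝ⁴ whose matrix has rows (1, 1, 1, 0), (1, 1, −1, 0), (1, −1, 0, 1), (1, −1, 0, −1) satisfies (1/2)·C₄ ⊆ T(C₄*) ⊆ C₄. -/
open Set Pointwise

noncomputable section

/-- the linear map with matrix rows `(1,1,1,0)`, `(1,1,−1,0)`,
`(1,−1,0,1)`, `(1,−1,0,−1)` satisfies `(1/2)·C₄ ⊆ T(C₄*) ⊆ C₄`. -/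
theorem stmt8 :
    (1/2 : ℝ) • cube 4 ⊆
      ⇑(Matrix.toLin'
        (!![(1 : ℝ), 1, 1, 0; 1, 1, -1, 0; 1, -1, 0, 1; 1, -1, 0, -1])) '' crossPoly 4 ∧
    ⇑(Matrix.toLin'
        (!![(1 : ℝ), 1, 1, 0; 1, 1, -1, 0; 1, -1, 0, 1; 1, -1, 0, -1])) '' crossPoly 4 ⊆
      cube 4 := by
  constructor
  · rintro _ ⟨z, hz, rfl⟩
    refine ⟨![(z 0 + z 1 + z 2 + z 3) / 8, (z 0 + z 1 - z 2 - z 3) / 8,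
      (z 0 - z 1) / 4, (z 2 - z 3) / 4], ?_, ?_⟩
    · have h0 := abs_le.mp (hz 0)
      have h1 := abs_le.mp (hz 1)
      have h2 := abs_le.mp (hz 2)
      have h3 := abs_le.mp (hz 3)
      simp only [crossPoly, mem_ofPred_eq, Fin.sum_univ_four, Matrix.cons_val]
      rcases abs_cases ((z 0 + z 1 + z 2 + z 3) / 8) with h | h <;>
      rcases abs_cases ((z 0 + z 1 - z 2 - z 3) / 8) with h' | h' <;>
      rcases abs_cases ((z 0 - z 1) / 4) with k | k <;>
      rcases abs_cases ((z 2 - z 3) / 4) with k' | k' <;>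
      linarith
    · ext i
      fin_cases i <;>
        simp [Matrix.toLin'_apply, Matrix.mulVec, dotProduct, Fin.sum_univ_four] <;> ring
  · rintro _ ⟨x, hx, rfl⟩ i
    simp only [crossPoly, mem_ofPred_eq, Fin.sum_univ_four] at hx
    have h0 := abs_le.mp (le_refl |x 0|)
    have h1 := abs_le.mp (le_refl |x 1|)
    have h2 := abs_le.mp (le_refl |x 2|)
    have h3 := abs_le.mp (le_refl |x 3|)
    have p2 := abs_nonneg (x 2)
    have p3 := abs_nonneg (x 3)
    rw [abs_le]
    fin_cases i <;>
      simp [Matrix.toLin'_apply, Matrix.mulVec, dotProduct, Fin.sum_univ_four] <;>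
      constructor <;> linarith
end
end

section
/- Let a ∈ ℝ⁴ satisfy |aᵢ| ≤ 1 for all i, and let r > 1/2. Then the number of sign vectors ε ∈ {−1,1}⁴ with |ε₁a₁ + ε₂a₂ + ε₃a₃ + ε₄a₄| ≥ 4r is at most 4. -/
open Set Pointwise

noncomputable section

/-- Two sign vectors with `∑ εᵢ aᵢ > 2` cannot differ in two coordinates. -/
theorem eq_or_eq_of_two_lt_sum {a x y : Fin 4 → ℝ} (ha : ∀ i, |a i| ≤ 1)
    (hx : ∀ i, x i = 1 ∨ x i = -1) (hy : ∀ i, y i = 1 ∨ y i = -1)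
    (hxa : 2 < ∑ i, x i * a i) (hya : 2 < ∑ i, y i * a i) {i j : Fin 4} (hij : i ≠ j) :
    x i = y i ∨ x j = y j := by
  by_contra! h
  have opp : ∀ m, x m ≠ y m → x m + y m = 0 := by
    intro m hm
    rcases hx m with h1 | h1 <;> rcases hy m with h2 | h2 <;> simp_all
  have term : ∀ m, x m * a m + y m * a m ≤ if m = i ∨ m = j then 0 else 2 := by
    intro m
    rw [← add_mul]
    split_ifs with hm
    · rcases hm with rfl | rfl
      · simp [opp _ h.1]
      · simp [opp _ h.2]
    · have := abs_le.mp (ha m)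
      rcases hx m with h1 | h1 <;> rcases hy m with h2 | h2 <;> rw [h1, h2] <;> linarith
  have le := Finset.sum_le_sum fun m (_ : m ∈ Finset.univ) => term m
  have four : (∑ m : Fin 4, if m = i ∨ m = j then (0 : ℝ) else 2) = 4 := by
    fin_cases i <;> fin_cases j <;> simp [Fin.sum_univ_four] at hij ⊢ <;> norm_num
  rw [Finset.sum_add_distrib, four] at le
  linarith

theorem finite_setOf_signs : {ε : Fin 4 → ℝ | ∀ i, ε i = 1 ∨ ε i = -1}.Finite := by
  have := Set.Finite.pi' (ι := Fin 4) (t := fun _ => ({1, -1} : Set ℝ)) fun _ => Set.toFinite _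
  simpa using this

theorem ncard_signs_two_lt_sum_le {a : Fin 4 → ℝ} (ha : ∀ i, |a i| ≤ 1) :
    {ε : Fin 4 → ℝ | (∀ i, ε i = 1 ∨ ε i = -1) ∧ 2 < ∑ i, ε i * a i}.ncard ≤ 2 := by
  by_contra! h
  obtain ⟨x, y, z, ⟨hx, hxa⟩, ⟨hy, hya⟩, ⟨hz, hza⟩, hxy, hxz, hyz⟩ :=
    (Set.two_lt_ncard_iff (finite_setOf_signs.subset fun _ h => h.1)).mp h
  obtain ⟨i, hi⟩ := Function.ne_iff.mp hxy
  obtain ⟨j, hj⟩ := Function.ne_iff.mp hyz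
  obtain ⟨k, hk⟩ := Function.ne_iff.mp hxz
  have hXY := fun {i j : Fin 4} => eq_or_eq_of_two_lt_sum ha hx hy hxa hya (i := i) (j := j)
  have hYZ := fun {i j : Fin 4} => eq_or_eq_of_two_lt_sum ha hy hz hya hza (i := i) (j := j)
  have hXZ := fun {i j : Fin 4} => eq_or_eq_of_two_lt_sum ha hx hz hxa hza (i := i) (j := j)
  by_cases hij : i = j
  · subst hij
    have hik : i ≠ k := by
      rintro rfl
      rcases hx i with h1 | h1 <;> rcases hy i with h2 | h2 <;> rcases hz i with h3 | h3 <;>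
        simp_all
    exact hk (((hXY hik).resolve_left hi).trans ((hYZ hik).resolve_left hj))
  · have hyzi : y i = z i := (hYZ (Ne.symm hij)).resolve_left hj
    have hxyj : x j = y j := (hXY hij).resolve_left hi
    rcases hXZ hij with h1 | h1
    · exact hi (h1.trans hyzi.symm)
    · exact hj (hxyj.symm.trans h1)

/-- for `a ∈ ℝ⁴` with `|aᵢ| ≤ 1` and `r > 1/2`, at most `4` sign
vectors `ε ∈ {−1,1}⁴` satisfy `|Σᵢ εᵢ aᵢ| ≥ 4r`. -/
theorem stmt9 (a : Fin 4 → ℝ) (ha : ∀ i, |a i| ≤ 1) (r : ℝ) (hr : 1/2 < r) :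
    Set.ncard {ε : Fin 4 → ℝ | (∀ i, ε i = 1 ∨ ε i = -1) ∧
      4 * r ≤ |∑ i, ε i * a i|} ≤ 4 := by
  have hpos := ncard_signs_two_lt_sum_le ha
  have hneg := ncard_signs_two_lt_sum_le (a := -a) (by simpa using ha)
  refine (Set.ncard_le_ncard (t := {ε : Fin 4 → ℝ | (∀ i, ε i = 1 ∨ ε i = -1) ∧
      2 < ∑ i, ε i * a i} ∪ {ε : Fin 4 → ℝ | (∀ i, ε i = 1 ∨ ε i = -1) ∧
      2 < ∑ i, ε i * (-a) i}) ?_ (finite_setOf_signs.subset ?_)).trans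
    ((Set.ncard_union_le _ _).trans (by omega))
  · rintro ε ⟨hε, h⟩
    rcases le_abs.mp h with h | h
    · exact Or.inl ⟨hε, by linarith⟩
    · refine Or.inr ⟨hε, ?_⟩
      simp only [Pi.neg_apply, mul_neg, Finset.sum_neg_distrib]
      linarith
  · rintro ε (h | h) <;> exact h.1
end
end

section
/- For every n ≥ 2, the Banach–Mazur distance between the n-dimensional cube and the cross-polytope is at least √(n/2); that is, whenever an invertible linear map T : ℝⁿ → ℝⁿ, vectors u, v ∈ ℝⁿ and r > 0 satisfy Cₙ + u ⊆ T(Cₙ* + v) ⊆ r·(Cₙ + u), one has r ≥ √(n/2). -/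
open Set Pointwise

noncomputable section

/-- The Walsh function of a set `S` of coordinates on the discrete cube. -/
def walsh {ι : Type*} (S : Finset ι) (x : ι → ℤˣ) : ℝ := ∏ i ∈ S, ((x i : ℤ) : ℝ)

/-- The unnormalized Walsh coefficient of `f` at `S`. -/
def walshCoeff {ι : Type*} [Fintype ι] [DecidableEq ι] (f : (ι → ℤˣ) → ℝ) (S : Finset ι) : ℝ :=
  ∑ x, f x * walsh S x

section Walsh

variable {ι : Type*}

lemma walsh_mul (S : Finset ι) (x y : ι → ℤˣ) : walsh S (x * y) = walsh S x * walsh S y := by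
  simp [walsh, Finset.prod_mul_distrib]

lemma walsh_neg (S : Finset ι) (x : ι → ℤˣ) : walsh S (-x) = (-1) ^ S.card * walsh S x := by
  simp [walsh, Finset.prod_neg]

lemma walsh_empty (x : ι → ℤˣ) : walsh ∅ x = 1 := by simp [walsh]

lemma walsh_mulSingle [DecidableEq ι] (S : Finset ι) (i : ι) :
    walsh S (Pi.mulSingle i (-1)) = if i ∈ S then -1 else 1 := by
  have h (j : ι) : (((Pi.mulSingle i (-1) : ι → ℤˣ) j : ℤ) : ℝ) = if j = i then -1 else 1 := by
    by_cases hj : j = i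
    · subst hj; simp
    · simp [hj]
  simp [walsh, h, Finset.prod_ite_eq']

variable [Fintype ι]

lemma sum_walsh (z : ι → ℤˣ) :
    ∑ S : Finset ι, walsh S z = if z = 1 then 2 ^ Fintype.card ι else 0 := by
  have h : ∑ S : Finset ι, walsh S z = ∏ i, (1 + ((z i : ℤ) : ℝ)) := by
    rw [Finset.prod_one_add, Finset.powerset_univ]
    rfl
  rw [h]
  split_ifs with hz
  · subst hz
    norm_num
  · obtain ⟨i, hi⟩ : ∃ i, z i ≠ 1 := by
      by_contra! hc
      exact hz (funext hc)
    refine Finset.prod_eq_zero (Finset.mem_univ i) ?_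
    rw [(Int.units_eq_one_or (z i)).resolve_left hi]
    simp

variable [DecidableEq ι]

/-- Parseval's identity on the discrete cube. -/
lemma sum_walshCoeff_mul (f g : (ι → ℤˣ) → ℝ) :
    ∑ S, walshCoeff f S * walshCoeff g S = 2 ^ Fintype.card ι * ∑ x, f x * g x := by
  calc ∑ S, walshCoeff f S * walshCoeff g S
      = ∑ S, ∑ x, ∑ y, f x * g y * walsh S (x * y) := by
        refine Finset.sum_congr rfl fun S _ => ?_
        rw [walshCoeff, walshCoeff, Finset.sum_mul_sum]
        refine Finset.sum_congr rfl fun x _ => Finset.sum_congr rfl fun y _ => ?_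
        rw [walsh_mul]
        ring
    _ = ∑ x, ∑ y, f x * g y * ∑ S, walsh S (x * y) := by
        rw [Finset.sum_comm]
        refine Finset.sum_congr rfl fun x _ => ?_
        rw [Finset.sum_comm]
        exact Finset.sum_congr rfl fun y _ => (Finset.mul_sum _ _ _).symm
    _ = 2 ^ Fintype.card ι * ∑ x, f x * g x := by
        rw [Finset.mul_sum]
        refine Finset.sum_congr rfl fun x _ => ?_
        have hxy (y : ι → ℤˣ) : x * y = 1 ↔ x = y := by
          rw [mul_eq_one_iff_eq_inv]
          have : y⁻¹ = y := funext fun i => Int.units_inv_eq_self (y i)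
          rw [this]
        simp only [sum_walsh, hxy, mul_ite, mul_zero, Finset.sum_ite_eq, Finset.mem_univ, if_true]
        ring

lemma walshCoeff_empty (f : (ι → ℤˣ) → ℝ) : walshCoeff f ∅ = ∑ x, f x := by
  simp [walshCoeff, walsh_empty]

lemma walshCoeff_eq_zero_of_odd {f : (ι → ℤˣ) → ℝ} (hf : ∀ x, f (-x) = f x) {S : Finset ι}
    (hS : Odd S.card) : walshCoeff f S = 0 := by
  have h : walshCoeff f S = -walshCoeff f S := by
    conv_lhs => rw [walshCoeff, ← Equiv.sum_comp (Equiv.neg (ι → ℤˣ))]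
    rw [walshCoeff, ← Finset.sum_neg_distrib]
    refine Finset.sum_congr rfl fun x _ => ?_
    rw [Equiv.neg_apply, hf, walsh_neg, hS.neg_one_pow]
    ring
  linarith

lemma walshCoeff_translate (f : (ι → ℤˣ) → ℝ) (z : ι → ℤˣ) (S : Finset ι) :
    walshCoeff (fun x => f (z * x)) S = walsh S z * walshCoeff f S := by
  have hz : z * z = 1 := funext fun i => Int.units_mul_self (z i)
  rw [walshCoeff, ← Equiv.sum_comp (Equiv.mulLeft z), walshCoeff, Finset.mul_sum]
  refine Finset.sum_congr rfl fun x _ => ?_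
  rw [Equiv.coe_mulLeft, ← mul_assoc, hz, one_mul, walsh_mul]
  ring

lemma walshCoeff_sum_flip (f : (ι → ℤˣ) → ℝ) (S : Finset ι) :
    walshCoeff (fun x => ∑ i, f (Pi.mulSingle i (-1) * x)) S
      = (Fintype.card ι - 2 * S.card) * walshCoeff f S := by
  have h1 : walshCoeff (fun x => ∑ i, f (Pi.mulSingle i (-1) * x)) S
      = ∑ i, walshCoeff (fun x => f (Pi.mulSingle i (-1) * x)) S := by
    simp only [walshCoeff, Finset.sum_mul]
    exact Finset.sum_comm
  have h2 : ∑ i, walsh S (Pi.mulSingle i (-1)) = (Fintype.card ι : ℝ) - 2 * S.card := by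
    have h3 (i : ι) : walsh S (Pi.mulSingle i (-1)) = 1 - 2 * if i ∈ S then (1 : ℝ) else 0 := by
      rw [walsh_mulSingle]
      split_ifs <;> norm_num
    simp [h3, Finset.sum_sub_distrib, mul_comm]
  rw [h1, ← h2, Finset.sum_mul]
  exact Finset.sum_congr rfl fun i _ => walshCoeff_translate _ _ _

/-- The Poincaré inequality for even functions on the discrete cube. -/
lemma sum_mul_sum_flip_le {f : (ι → ℤˣ) → ℝ} (hf : ∀ x, f (-x) = f x) :
    2 ^ Fintype.card ι * ∑ x, f x * ∑ i, f (Pi.mulSingle i (-1) * x)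
      ≤ (Fintype.card ι - 4) * (2 ^ Fintype.card ι * ∑ x, f x * f x) + 4 * (∑ x, f x) ^ 2 := by
  have h4 : 4 * (∑ x, f x) ^ 2
      = ∑ S : Finset ι, if S = ∅ then 4 * (walshCoeff f S) ^ 2 else 0 := by
    simp [walshCoeff_empty]
  rw [← sum_walshCoeff_mul, ← sum_walshCoeff_mul, h4, Finset.mul_sum, ← Finset.sum_add_distrib]
  refine Finset.sum_le_sum fun S _ => ?_
  rw [walshCoeff_sum_flip]
  split_ifs with hS
  · subst hS
    simp only [Finset.card_empty]
    push_cast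
    nlinarith
  · rcases Nat.even_or_odd S.card with he | ho
    · have h2 : (2 : ℝ) ≤ S.card := by
        have := Finset.card_pos.2 (Finset.nonempty_iff_ne_empty.2 hS)
        obtain ⟨k, hk⟩ := he
        exact_mod_cast (by omega : 2 ≤ S.card)
      nlinarith [mul_nonneg (sub_nonneg.2 h2) (mul_self_nonneg (walshCoeff f S))]
    · simp [walshCoeff_eq_zero_of_odd hf ho]

lemma sum_sq_signed_sum (a : ι → ℝ) :
    ∑ x : ι → ℤˣ, (∑ i, a i * ((x i : ℤ) : ℝ)) ^ 2 = 2 ^ Fintype.card ι * ∑ i, a i ^ 2 := by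
  have hort (i j : ι) : ∑ x : ι → ℤˣ, ((x i : ℤ) : ℝ) * ((x j : ℤ) : ℝ)
      = if i = j then 2 ^ Fintype.card ι else 0 := by
    split_ifs with h
    · subst h
      have h1 (x : ι → ℤˣ) : ((x i : ℤ) : ℝ) * ((x i : ℤ) : ℝ) = 1 := by
        rcases Int.units_eq_one_or (x i) with h | h <;> simp [h]
      simp [h1, Fintype.card_units_int]
    · have h1 : ∑ x : ι → ℤˣ, ((x i : ℤ) : ℝ) * ((x j : ℤ) : ℝ)
          = -∑ x : ι → ℤˣ, ((x i : ℤ) : ℝ) * ((x j : ℤ) : ℝ) := by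
        conv_lhs => rw [← Equiv.sum_comp (Equiv.mulLeft (Pi.mulSingle i (-1) : ι → ℤˣ))]
        rw [← Finset.sum_neg_distrib]
        refine Finset.sum_congr rfl fun x _ => ?_
        simp [Pi.mulSingle_eq_of_ne (Ne.symm h)]
      linarith
  calc ∑ x : ι → ℤˣ, (∑ i, a i * ((x i : ℤ) : ℝ)) ^ 2
      = ∑ x : ι → ℤˣ, ∑ i, ∑ j, a i * a j * (((x i : ℤ) : ℝ) * ((x j : ℤ) : ℝ)) := by
        refine Finset.sum_congr rfl fun x _ => ?_
        rw [sq, Finset.sum_mul_sum]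
        refine Finset.sum_congr rfl fun i _ => Finset.sum_congr rfl fun j _ => ?_
        ring
    _ = ∑ i, ∑ j, a i * a j * ∑ x : ι → ℤˣ, ((x i : ℤ) : ℝ) * ((x j : ℤ) : ℝ) := by
        rw [Finset.sum_comm]
        refine Finset.sum_congr rfl fun i _ => ?_
        rw [Finset.sum_comm]
        exact Finset.sum_congr rfl fun j _ => (Finset.mul_sum _ _ _).symm
    _ = 2 ^ Fintype.card ι * ∑ i, a i ^ 2 := by
        simp only [hort, mul_ite, mul_zero, Finset.sum_ite_eq, Finset.mem_univ, if_true]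
        rw [Finset.mul_sum]
        exact Finset.sum_congr rfl fun i _ => by ring

/-- The triangle inequality gives a pointwise lower bound for the sum over neighbours. -/
lemma card_sub_two_mul_le_sum_flip (a : ι → ℝ) (x : ι → ℤˣ) :
    ((Fintype.card ι : ℝ) - 2) * |∑ j, a j * ((x j : ℤ) : ℝ)|
      ≤ ∑ i, |∑ j, a j * (((Pi.mulSingle i (-1) * x : ι → ℤˣ) j : ℤ) : ℝ)| := by
  set s := ∑ j, a j * ((x j : ℤ) : ℝ) with hs
  have hflip (i : ι) : ∑ j, a j * (((Pi.mulSingle i (-1) * x : ι → ℤˣ) j : ℤ) : ℝ)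
      = s - 2 * (a i * ((x i : ℤ) : ℝ)) := by
    have h (j : ι) : a j * (((Pi.mulSingle i (-1) * x : ι → ℤˣ) j : ℤ) : ℝ)
        = a j * ((x j : ℤ) : ℝ) - if j = i then 2 * (a j * ((x j : ℤ) : ℝ)) else 0 := by
      by_cases hj : j = i
      · subst hj
        simp
        ring
      · simp [hj]
    rw [Finset.sum_congr rfl fun j _ => h j, Finset.sum_sub_distrib, ← hs]
    simp
  have hsum : ∑ i, (s - 2 * (a i * ((x i : ℤ) : ℝ))) = ((Fintype.card ι : ℝ) - 2) * s := by
    rw [Finset.sum_sub_distrib, ← Finset.mul_sum, ← hs]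
    simp
    ring
  calc ((Fintype.card ι : ℝ) - 2) * |s| ≤ |(Fintype.card ι : ℝ) - 2| * |s| :=
        mul_le_mul_of_nonneg_right (le_abs_self _) (abs_nonneg _)
    _ = |∑ i, (s - 2 * (a i * ((x i : ℤ) : ℝ)))| := by rw [hsum, abs_mul]
    _ ≤ ∑ i, |s - 2 * (a i * ((x i : ℤ) : ℝ))| := Finset.abs_sum_le_sum_abs _ _
    _ = _ := Finset.sum_congr rfl fun i _ => by rw [hflip]

/-- Szarek's sharp form of Khintchine's inequality in `L¹`. -/
theorem khintchine_L1 (a : ι → ℝ) :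
    2 ^ Fintype.card ι * √(∑ i, a i ^ 2)
      ≤ √2 * ∑ x : ι → ℤˣ, |∑ i, a i * ((x i : ℤ) : ℝ)| := by
  set f : (ι → ℤˣ) → ℝ := fun x => |∑ i, a i * ((x i : ℤ) : ℝ)| with hf
  have heven (x) : f (-x) = f x := by
    simp [hf]
  have hsq : ∑ x, f x * f x = 2 ^ Fintype.card ι * ∑ i, a i ^ 2 := by
    rw [← sum_sq_signed_sum]
    exact Finset.sum_congr rfl fun x _ => by rw [abs_mul_abs_self, sq]
  have hlow : ((Fintype.card ι : ℝ) - 2) * ∑ x, f x * f x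
      ≤ ∑ x, f x * ∑ i, f (Pi.mulSingle i (-1) * x) := by
    rw [Finset.mul_sum]
    refine Finset.sum_le_sum fun x _ => ?_
    have := mul_le_mul_of_nonneg_left (card_sub_two_mul_le_sum_flip a x) (abs_nonneg _ : 0 ≤ f x)
    calc _ = f x * (((Fintype.card ι : ℝ) - 2) * f x) := by ring
      _ ≤ _ := this
  have hpoin := sum_mul_sum_flip_le heven
  have hlow' := mul_le_mul_of_nonneg_left hlow
    (by positivity : (0 : ℝ) ≤ 2 ^ Fintype.card ι)
  rw [hsq] at hlow' hpoin
  have hnn : 0 ≤ ∑ x, f x := Finset.sum_nonneg fun x _ => abs_nonneg _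
  refine (sq_le_sq₀ (by positivity) (by positivity)).1 ?_
  rw [mul_pow, mul_pow, Real.sq_sqrt (by positivity), Real.sq_sqrt (by positivity)]
  linarith

end Walsh

lemma LinearMap.apply_eq_sum_single {n : ℕ} (S : (Fin n → ℝ) →ₗ[ℝ] (Fin n → ℝ))
    (x : Fin n → ℝ) (i : Fin n) : S x i = ∑ j, S (Pi.single j 1) i * x j := by
  rw [LinearMap.pi_apply_eq_sum_univ S x, Finset.sum_apply]
  refine Finset.sum_congr rfl fun j _ => ?_
  rw [Pi.smul_apply, smul_eq_mul, mul_comm]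
  have h : (fun k => if j = k then (1 : ℝ) else 0) = Pi.single j 1 := by
    ext k
    simp [Pi.single_apply, eq_comm]
  rw [h]

/-- If `S` maps the vertices of the cube into the cross-polytope, the Euclidean norms of its rows
sum to at most `√2`. -/
lemma sum_row_norm_le {n : ℕ} (S : (Fin n → ℝ) →ₗ[ℝ] (Fin n → ℝ))
    (hS : ∀ x ∈ cube n, S x ∈ crossPoly n) :
    ∑ i, √(∑ j, S (Pi.single j 1) i ^ 2) ≤ √2 := by
  have hvert (x : Fin n → ℤˣ) : ∑ i, |∑ j, S (Pi.single j 1) i * ((x j : ℤ) : ℝ)| ≤ 1 := by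
    have h := hS (fun j => ((x j : ℤ) : ℝ)) fun i => by
      rcases Int.units_eq_one_or (x i) with h | h <;> simp [h]
    have h' : ∑ i, |S (fun j => ((x j : ℤ) : ℝ)) i| ≤ 1 := h
    convert h' using 3 with i
    rw [LinearMap.apply_eq_sum_single]
  have hpow : (0 : ℝ) < 2 ^ n := by positivity
  refine le_of_mul_le_mul_left ?_ hpow
  calc (2 : ℝ) ^ n * ∑ i, √(∑ j, S (Pi.single j 1) i ^ 2)
      ≤ ∑ i, √2 * ∑ x : Fin n → ℤˣ, |∑ j, S (Pi.single j 1) i * ((x j : ℤ) : ℝ)| := by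
        rw [Finset.mul_sum]
        refine Finset.sum_le_sum fun i _ => ?_
        simpa using khintchine_L1 fun j => S (Pi.single j 1) i
    _ = √2 * ∑ x : Fin n → ℤˣ, ∑ i, |∑ j, S (Pi.single j 1) i * ((x j : ℤ) : ℝ)| := by
        rw [← Finset.mul_sum, Finset.sum_comm]
    _ ≤ √2 * ∑ _x : Fin n → ℤˣ, 1 := by
        gcongr with x
        exact hvert x
    _ = 2 ^ n * √2 := by
        simp [Fintype.card_units_int, mul_comm]

/-- The estimate for concentric cube and cross-polytope, by computing the trace of the identity. -/
lemma sqrt_half_le_of_mapsTo {n : ℕ} (hn : 0 < n) (T : (Fin n → ℝ) ≃ₗ[ℝ] (Fin n → ℝ)) {r : ℝ}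
    (hr : 0 < r) (h1 : ∀ x ∈ cube n, T.symm x ∈ crossPoly n)
    (h2 : ∀ i j, |T (Pi.single i 1) j| ≤ r) : √(n / 2) ≤ r := by
  have hrow := sum_row_norm_le T.symm.toLinearMap h1
  have hcol (i : Fin n) : √(∑ j, T (Pi.single i 1) j ^ 2) ≤ r * √n := by
    rw [← Real.sqrt_sq hr.le, ← Real.sqrt_mul (sq_nonneg r)]
    refine Real.sqrt_le_sqrt ?_
    calc ∑ j, T (Pi.single i 1) j ^ 2 ≤ ∑ _j : Fin n, r ^ 2 :=
          Finset.sum_le_sum fun j _ => sq_le_sq' (abs_le.1 (h2 i j)).1 (abs_le.1 (h2 i j)).2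
      _ = r ^ 2 * n := by simp [mul_comm]
  have htrace (i : Fin n) : ∑ j, T.symm (Pi.single j 1) i * T (Pi.single i 1) j = 1 := by
    have h := LinearMap.apply_eq_sum_single T.symm.toLinearMap (T (Pi.single i 1)) i
    simpa using h.symm
  have hn' : (0 : ℝ) < √n := Real.sqrt_pos.2 (by exact_mod_cast hn)
  have hmain : √n * √n ≤ √n * (√2 * r) := by
    calc √n * √n = ∑ i : Fin n, ∑ j, T.symm (Pi.single j 1) i * T (Pi.single i 1) j := by
          simp [htrace]
      _ ≤ ∑ i : Fin n, √(∑ j, T.symm (Pi.single j 1) i ^ 2) * (r * √n) := by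
          refine Finset.sum_le_sum fun i _ => ?_
          exact (Real.sum_mul_le_sqrt_mul_sqrt _ _ _).trans
            (mul_le_mul_of_nonneg_left (hcol i) (Real.sqrt_nonneg _))
      _ ≤ √2 * (r * √n) := by
          rw [← Finset.sum_mul]
          exact mul_le_mul_of_nonneg_right hrow (by positivity)
      _ = √n * (√2 * r) := by ring
  rw [Real.sqrt_div (Nat.cast_nonneg n), div_le_iff₀ (by positivity), mul_comm r]
  exact le_of_mul_le_mul_left hmain hn'

/-- A point with both translates `c + x` and `c - x` in the cross-polytope lies in it. -/
lemma mem_crossPoly_of_add_sub {n : ℕ} {c x : Fin n → ℝ} (h1 : c + x ∈ crossPoly n)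
    (h2 : c - x ∈ crossPoly n) : x ∈ crossPoly n := by
  simp only [crossPoly, mem_ofPred_eq, Pi.add_apply, Pi.sub_apply] at h1 h2 ⊢
  have h : 2 * ∑ i, |x i| ≤ ∑ i, |c i + x i| + ∑ i, |c i - x i| := by
    rw [Finset.mul_sum, ← Finset.sum_add_distrib]
    refine Finset.sum_le_sum fun i _ => ?_
    have := abs_sub (c i + x i) (c i - x i)
    rw [show c i + x i - (c i - x i) = 2 * x i by ring, abs_mul, abs_two] at this
    exact this
  linarith

/-- for `n ≥ 2`, whenever `Cₙ + u ⊆ T(Cₙ* + v) ⊆ r·(Cₙ + u)` with `T`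
invertible linear and `r > 0`, one has `r ≥ √(n/2)`. -/
theorem stmt11 (n : ℕ) (hn : 2 ≤ n) (T : (Fin n → ℝ) ≃ₗ[ℝ] (Fin n → ℝ))
    (u v : Fin n → ℝ) (r : ℝ) (hr : 0 < r)
    (h1 : (fun x => x + u) '' cube n ⊆ ⇑T '' ((fun x => x + v) '' crossPoly n))
    (h2 : ⇑T '' ((fun x => x + v) '' crossPoly n) ⊆ r • ((fun x => x + u) '' cube n)) :
    Real.sqrt (n / 2) ≤ r := by
  refine sqrt_half_le_of_mapsTo (by omega) T hr (fun x hx => ?_) fun i j => ?_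
  · have key (y : Fin n → ℝ) (hy : y ∈ cube n) : T.symm u - v + T.symm y ∈ crossPoly n := by
      obtain ⟨_, ⟨w, hw, rfl⟩, h⟩ := h1 ⟨y, hy, rfl⟩
      have hw' : w + v = T.symm y + T.symm u := by
        rw [← map_add, LinearEquiv.eq_symm_apply]
        exact h
      rwa [show T.symm u - v + T.symm y = w by rw [eq_sub_of_add_eq hw']; abel]
    have hneg := key (-x) fun i => by simpa using hx i
    rw [map_neg, ← sub_eq_add_neg] at hneg
    exact mem_crossPoly_of_add_sub (key x hx) hneg
  · have key (w : Fin n → ℝ) (hw : w ∈ crossPoly n) : |T w j + T v j - r * u j| ≤ r := by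
      obtain ⟨_, ⟨y, hy, rfl⟩, h⟩ := h2 ⟨_, ⟨w, hw, rfl⟩, rfl⟩
      have hj := congrFun h j
      simp only [map_add, Pi.smul_apply, Pi.add_apply, smul_eq_mul] at hj
      rw [← hj, mul_add, add_sub_cancel_right, abs_mul, abs_of_pos hr]
      exact mul_le_of_le_one_right hr.le (hy j)
    have hsingle : (Pi.single i 1 : Fin n → ℝ) ∈ crossPoly n := by
      simp [crossPoly, Pi.single_apply, apply_ite abs]
    have hp := abs_le.1 (key _ hsingle)
    have hm := abs_le.1 (key (-Pi.single i 1) (by simpa [crossPoly] using hsingle))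
    simp only [map_neg, Pi.neg_apply] at hm
    exact abs_le.2 ⟨by linarith [hp.1, hm.2], by linarith [hp.2, hm.1]⟩
end
end

section
/- Let 7/4 ≤ r ≤ 2 and let k ∈ [1/(2r), 2 − 3/r]. Suppose a convex body K ⊆ ℝ² satisfies: (1) conv{u₁, u₂, u₃} ⊆ K ⊆ conv{−u₁, u₁, u₂, u₃}; (2) the segment with endpoints ((r−3)/r + k)·u₁ + 2k·u₂ and ((r−3)/r + k)·u₁ + 2k·u₃ is contained in the boundary of K; (3) K is invariant under the reflection (x, y) ↦ (x, −y). Then as(K) = r and d_BM(K, L) = r for every symmetric convex body L ⊆ ℝ². -/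
open Set Pointwise

noncomputable section

/-- Vertex `u₁ = (1, 0)` of an equilateral triangle. -/
def u1 : Fin 2 → ℝ := ![1, 0]

/-- Vertex `u₂ = (−1/2, √3/2)` of an equilateral triangle. -/
def u2 : Fin 2 → ℝ := ![-(1/2), Real.sqrt 3 / 2]

/-- Vertex `u₃ = (−1/2, −√3/2)` of an equilateral triangle. -/
def u3 : Fin 2 → ℝ := ![-(1/2), -(Real.sqrt 3 / 2)]

/-- Barycentric coordinate with respect to `u1` in the triangle `u1 u2 u3`. -/
def bary1 (y : Fin 2 → ℝ) : ℝ := (2 * y 0 + 1) / 3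

/-- Barycentric coordinate with respect to `u2` in the triangle `u1 u2 u3`. -/
def bary2 (y : Fin 2 → ℝ) : ℝ := (1 - y 0) / 3 + y 1 * Real.sqrt 3 / 3

/-- Barycentric coordinate with respect to `u3` in the triangle `u1 u2 u3`. -/
def bary3 (y : Fin 2 → ℝ) : ℝ := (1 - y 0) / 3 - y 1 * Real.sqrt 3 / 3

/-- Twice the signed area of the triangle `p q s`. -/
def signedArea (p q s : Fin 2 → ℝ) : ℝ :=
  (q 0 - p 0) * (s 1 - p 1) - (q 1 - p 1) * (s 0 - p 0)

lemma bary_sum (y : Fin 2 → ℝ) : bary1 y + bary2 y + bary3 y = 1 := by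
  simp only [bary1, bary2, bary3]; ring

lemma sqrt_three_sq : Real.sqrt 3 * Real.sqrt 3 = 3 := Real.mul_self_sqrt (by norm_num)

lemma eq_bary (y : Fin 2 → ℝ) : y = bary1 y • u1 + bary2 y • u2 + bary3 y • u3 := by
  have h := sqrt_three_sq
  ext i
  fin_cases i
  · simp [bary1, bary2, bary3, u1, u2, u3]; ring
  · simp [bary1, bary2, bary3, u1, u2, u3]; linear_combination (-(y 1) / 3) * h

lemma bary_of_comb {a b c : ℝ} (h : a + b + c = 1) :
    bary1 (a • u1 + b • u2 + c • u3) = a ∧ bary2 (a • u1 + b • u2 + c • u3) = b ∧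
      bary3 (a • u1 + b • u2 + c • u3) = c := by
  have h3 := sqrt_three_sq
  obtain rfl : a = 1 - b - c := by linarith
  refine ⟨?_, ?_, ?_⟩ <;> simp [bary1, bary2, bary3, u1, u2, u3]
  · ring
  · linear_combination ((b - c) / 6) * h3
  · linear_combination (-(b - c) / 6) * h3

lemma bary_ext {x y : Fin 2 → ℝ} (h1 : bary1 x = bary1 y) (h2 : bary2 x = bary2 y)
    (h3 : bary3 x = bary3 y) : x = y := by
  rw [eq_bary x, eq_bary y, h1, h2, h3]

lemma bary_u1 : bary1 u1 = 1 ∧ bary2 u1 = 0 ∧ bary3 u1 = 0 := by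
  simpa using bary_of_comb (a := 1) (b := 0) (c := 0) (by norm_num)

lemma bary_u2 : bary1 u2 = 0 ∧ bary2 u2 = 1 ∧ bary3 u2 = 0 := by
  simpa using bary_of_comb (a := 0) (b := 1) (c := 0) (by norm_num)

lemma bary_u3 : bary1 u3 = 0 ∧ bary2 u3 = 0 ∧ bary3 u3 = 1 := by
  simpa using bary_of_comb (a := 0) (b := 0) (c := 1) (by norm_num)

lemma mem_of_bary_nonneg {S : Set (Fin 2 → ℝ)} (hS : Convex ℝ S) (h1 : u1 ∈ S) (h2 : u2 ∈ S)
    (h3 : u3 ∈ S) {y : Fin 2 → ℝ} (b1 : 0 ≤ bary1 y) (b2 : 0 ≤ bary2 y) (b3 : 0 ≤ bary3 y) :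
    y ∈ S := by
  have := hS.sum_mem (t := Finset.univ) (w := ![bary1 y, bary2 y, bary3 y])
    (z := ![u1, u2, u3]) (by intro i _; fin_cases i <;> simpa)
    (by simpa [Fin.sum_univ_succ, ← add_assoc] using bary_sum y)
    (by intro i _; fin_cases i <;> simpa)
  rw [eq_bary y]
  simpa [Fin.sum_univ_succ, ← add_assoc] using this

lemma mem_of_apex {S : Set (Fin 2 → ℝ)} (hS : Convex ℝ S) (h2 : u2 ∈ S)
    (h3 : u3 ∈ S) {g y : Fin 2 → ℝ} (hg : g ∈ S) {s : ℝ} (hs : 0 ≤ s)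
    (b1 : bary1 y = s * bary1 g) (b2 : s * bary2 g ≤ bary2 y) (b3 : s * bary3 g ≤ bary3 y) :
    y ∈ S := by
  have hy := bary_sum y
  have hgs := bary_sum g
  have := hS.sum_mem (t := Finset.univ)
    (w := ![s, bary2 y - s * bary2 g, bary3 y - s * bary3 g])
    (z := ![g, u2, u3]) (by intro i _; fin_cases i <;> simpa)
    (by simp [Fin.sum_univ_succ]; linear_combination hy - s * hgs - b1)
    (by intro i _; fin_cases i <;> simpa)
  convert this using 1
  simp only [Fin.sum_univ_succ, Fin.sum_univ_zero]
  simp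
  calc
    y = bary1 y • u1 + bary2 y • u2 + bary3 y • u3 := eq_bary y
    _ = s • (bary1 g • u1 + bary2 g • u2 + bary3 g • u3) +
        ((bary2 y - s * bary2 g) • u2 + (bary3 y - s * bary3 g) • u3) := by rw [b1]; module
    _ = _ := by rw [← eq_bary g]

lemma bary_of_mem_kite {y : Fin 2 → ℝ} (hy : y ∈ convexHull ℝ {-u1, u1, u2, u3}) :
    0 ≤ bary2 y ∧ 0 ≤ bary3 y ∧ 0 ≤ 2 * bary1 y + bary2 y ∧ 0 ≤ 2 * bary1 y + bary3 y := by
  have h3 := sqrt_three_sq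
  have hc : Convex ℝ {y : Fin 2 → ℝ | 0 ≤ bary2 y ∧ 0 ≤ bary3 y ∧
      0 ≤ 2 * bary1 y + bary2 y ∧ 0 ≤ 2 * bary1 y + bary3 y} := by
    intro x hx y hy a b ha hb hab
    obtain rfl : b = 1 - a := by linarith
    simp only [mem_ofPred_eq, bary1, bary2, bary3, Pi.add_apply, Pi.smul_apply, smul_eq_mul]
      at hx hy ⊢
    obtain ⟨x1, x2, x3, x4⟩ := hx
    obtain ⟨y1, y2, y3, y4⟩ := hy
    refine ⟨?_, ?_, ?_, ?_⟩
    · linarith [mul_nonneg ha x1, mul_nonneg hb y1]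
    · linarith [mul_nonneg ha x2, mul_nonneg hb y2]
    · linarith [mul_nonneg ha x3, mul_nonneg hb y3]
    · linarith [mul_nonneg ha x4, mul_nonneg hb y4]
  refine convexHull_min ?_ hc hy
  rintro x (rfl | rfl | rfl | rfl)
  · simp [bary1, bary2, bary3, u1]; norm_num
  · obtain ⟨e1, e2, e3⟩ := bary_u1
    simp [e1, e2, e3]
  · obtain ⟨e1, e2, e3⟩ := bary_u2
    simp [e1, e2, e3]
  · obtain ⟨e1, e2, e3⟩ := bary_u3
    simp [e1, e2, e3]

lemma exists_supporting_functional {K : Set (Fin 2 → ℝ)} (hK : IsConvexBody K)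
    {m : Fin 2 → ℝ} (hm : m ∈ frontier K) :
    ∃ a b : ℝ, (a ≠ 0 ∨ b ≠ 0) ∧ ∀ y ∈ K, a * y 0 + b * y 1 ≤ a * m 0 + b * m 1 := by
  obtain ⟨hc, hcomp, hne⟩ := hK
  obtain ⟨f, hf⟩ := geometric_hahn_banach_open_point hc.interior isOpen_interior hm.2
  have hrep : ∀ y : Fin 2 → ℝ, f y = f ![1, 0] * y 0 + f ![0, 1] * y 1 := by
    intro y
    have : y = y 0 • ![1, 0] + y 1 • ![0, 1] := by ext i; fin_cases i <;> simp
    conv_lhs => rw [this, map_add, map_smul, map_smul]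
    simp only [smul_eq_mul]; ring
  refine ⟨f ![1, 0], f ![0, 1], ?_, fun y hy => ?_⟩
  · by_contra! h
    obtain ⟨x, hx⟩ := hne
    have := hf x hx
    rw [hrep x, hrep m, h.1, h.2] at this
    simp at this
  · rw [← hrep, ← hrep]
    have hcl : y ∈ closure (interior K) := by
      rw [hc.closure_interior_eq_closure_of_nonempty_interior hne]
      exact subset_closure hy
    exact closure_minimal (fun x hx => (hf x hx).le)
      (isClosed_le f.continuous continuous_const) hcl

lemma mem_segment_vertical {r k t : ℝ} (hk : 0 < k) (h1 : -k ≤ t) (h2 : t ≤ k)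
    (hr : r ≠ 0) :
    (![1 - 3 / r, Real.sqrt 3 * t] : Fin 2 → ℝ) ∈
      segment ℝ ((((r - 3) / r + k) • u1 + (2 * k) • u2))
        (((r - 3) / r + k) • u1 + (2 * k) • u3) := by
  refine ⟨(k + t) / (2 * k), (k - t) / (2 * k), by apply div_nonneg <;> linarith,
    by apply div_nonneg <;> linarith, by field_simp; ring, ?_⟩
  ext i
  fin_cases i
  · simp [u1, u2, u3]; field_simp; ring
  · simp [u1, u2, u3]; field_simp; ring

/-- The vertical segment supports the body and bounds its first barycentric coordinate. -/
lemma body_bounds {r k : ℝ} (hr1 : 7/4 ≤ r) (hk : 1 / (2 * r) ≤ k)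
    {K : Set (Fin 2 → ℝ)} (hK : IsConvexBody K) (hu : u1 ∈ K)
    (hseg : segment ℝ (((r - 3) / r + k) • u1 + (2 * k) • u2)
        (((r - 3) / r + k) • u1 + (2 * k) • u3) ⊆ frontier K) :
    (∀ y ∈ K, 1 - 2 / r ≤ bary1 y) ∧
    (∀ t, -(1 / 2) ≤ t → t ≤ 1 / 2 → ![1 - 3 / r, Real.sqrt 3 * (t / r)] ∈ K) := by
  have hr : 0 < r := by linarith
  have hk0 : 0 < k := lt_of_lt_of_le (by positivity) hk
  have hmem : ∀ t, -k ≤ t → t ≤ k → ![1 - 3 / r, Real.sqrt 3 * t] ∈ K := fun t h1 h2 =>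
    hK.2.1.isClosed.frontier_subset (hseg (mem_segment_vertical hk0 h1 h2 hr.ne'))
  constructor
  · obtain ⟨a, b, hab, H⟩ := exists_supporting_functional hK
      (hseg (mem_segment_vertical (r := r) (t := 0) hk0 (by linarith) hk0.le hr.ne'))
    have e1 := H _ (hmem k (by linarith) le_rfl)
    have e2 := H _ (hmem (-k) le_rfl (by linarith))
    have e3 := H _ hu
    have hs : 0 < Real.sqrt 3 * k := by positivity
    simp [u1] at e1 e2 e3
    have hb : b = 0 := by
      have : b * (Real.sqrt 3 * k) = 0 := by linarith
      rcases mul_eq_zero.1 this with h | h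
      · exact h
      · exact absurd h hs.ne'
    have ha0 : a ≠ 0 := by simpa [hb] using hab
    have h3r : 0 < 3 / r := by positivity
    have ha : a < 0 := by
      refine lt_of_le_of_ne ?_ ha0
      by_contra! h
      nlinarith [mul_pos h h3r]
    intro y hy
    have := H y hy
    simp [hb] at this
    have h4 : 1 - 3 / r ≤ y 0 := by
      by_contra! h
      nlinarith
    have : 3 / r = 3 / 2 * (2 / r) := by ring
    simp only [bary1]; linarith
  · intro t h1 h2
    have hb : t / r ≤ 1 / (2 * r) := by
      rw [show 1 / (2 * r) = (1 / 2) / r by field_simp]; gcongr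
    have hb' : -(1 / (2 * r)) ≤ t / r := by
      rw [show -(1 / (2 * r)) = (-(1 / 2)) / r by field_simp]; gcongr
    exact hmem _ (by linarith) (by linarith)

lemma le_of_reflected_cover {r ρ : ℝ} (hr : 0 < r) (hρ : 0 < ρ) {K : Set (Fin 2 → ℝ)}
    (h1 : u1 ∈ K) (h2 : u2 ∈ K) (h3 : u3 ∈ K) (hb1 : ∀ y ∈ K, 1 - 2 / r ≤ bary1 y)
    (hb2 : ∀ y ∈ K, 0 ≤ bary2 y) (hb3 : ∀ y ∈ K, 0 ≤ bary3 y) {w : Fin 2 → ℝ}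
    (hw : ∀ x ∈ K, ∃ y ∈ K, x + ρ • y = w) : r ≤ ρ := by
  have hs := sqrt_three_sq
  obtain ⟨y1, hy1, e1⟩ := hw u1 h1
  obtain ⟨y2, hy2, e2⟩ := hw u2 h2
  obtain ⟨y3, hy3, e3⟩ := hw u3 h3
  have f1 := mul_le_mul_of_nonneg_left (hb1 _ hy1) hρ.le
  have f2 := mul_nonneg hρ.le (hb2 _ hy2)
  have f3 := mul_nonneg hρ.le (hb3 _ hy3)
  have e10 := congrFun e1 0
  have e20 := congrFun e2 0
  have e30 := congrFun e3 0
  have e21 := congrFun e2 1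
  have e31 := congrFun e3 1
  simp [u1, u2, u3] at e10 e20 e30 e21 e31
  simp only [bary1, bary2, bary3] at f1 f2 f3
  have : 2 ≤ ρ * (2 / r) := by
    linear_combination f1 + f2 + f3 + (2 / 3) * e10 - (1 / 3) * e20 - (1 / 3) * e30
      + (Real.sqrt 3 / 3) * e21 - (Real.sqrt 3 / 3) * e31 - (1 / 3) * hs
  rw [mul_div_assoc', le_div_iff₀ hr] at this
  linarith

/-- The negative homothet `w - r K` covers the truncated triangle. -/
lemma mem_neg_homothet {r : ℝ} (hr1 : 7/4 ≤ r) {K : Set (Fin 2 → ℝ)}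
    (hK : Convex ℝ K) (h1 : u1 ∈ K) (h2 : u2 ∈ K) (h3 : u3 ∈ K)
    (hg : ∀ t, -(1 / 2) ≤ t → t ≤ 1 / 2 → ![1 - 3 / r, Real.sqrt 3 * (t / r)] ∈ K)
    {q : Fin 2 → ℝ} (q1 : bary1 q ≤ 1) (q2 : bary2 q ≤ 1) (q3 : bary3 q ≤ 1)
    (q12 : bary1 q - bary2 q ≤ 3 / 2) (q13 : bary1 q - bary3 q ≤ 3 / 2) :
    (1 / r) • ((r - 2) • u1 - q) ∈ K := by
  have hr : 0 < r := by linarith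
  have hs := sqrt_three_sq
  have hsum := bary_sum q
  set y := (1 / r) • ((r - 2) • u1 - q) with hy
  have y0 : y 0 = (r - 2 - q 0) / r := by
    simp only [hy, u1, Pi.smul_apply, Pi.sub_apply, smul_eq_mul, Matrix.cons_val_zero]; ring
  have y1 : y 1 = -q 1 / r := by
    simp only [hy, u1, Pi.smul_apply, Pi.sub_apply, smul_eq_mul, Matrix.cons_val_one,
      Matrix.cons_val_fin_one]
    ring
  have b1 : bary1 y = (r - 1 - bary1 q) / r := by
    simp only [bary1, y0]; field_simp; ring
  have b2 : bary2 y = (1 - bary2 q) / r := by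
    simp only [bary2, y0, y1]; field_simp; ring
  have b3 : bary3 y = (1 - bary3 q) / r := by
    simp only [bary3, y0, y1]; field_simp; ring
  by_cases hcase : bary1 q ≤ r - 1
  · refine mem_of_bary_nonneg hK h1 h2 h3 ?_ ?_ ?_
    · rw [b1]; exact div_nonneg (by linarith) hr.le
    · rw [b2]; exact div_nonneg (by linarith) hr.le
    · rw [b3]; exact div_nonneg (by linarith) hr.le
  push Not at hcase
  have hr2' : 0 < 2 - r := by linarith
  obtain ⟨σ, hσ⟩ : ∃ σ, σ = (1 + bary1 q - r) / (2 - r) := ⟨_, rfl⟩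
  have hσe : σ * (2 - r) = 1 + bary1 q - r := by rw [hσ]; field_simp
  have hσ0 : 0 < σ := by rw [hσ]; exact div_pos (by linarith) hr2'
  have hσ1 : σ ≤ 1 := by rw [hσ, div_le_one hr2']; linarith
  have hA : σ / 2 ≤ 1 - bary2 q := by nlinarith
  have hB : σ / 2 ≤ 1 - bary3 q := by nlinarith
  have hC : 2 * σ ≤ 1 + bary1 q := by nlinarith
  -- the apex has coordinates `(1 - 2 / r, (1 + t) / r, (1 - t) / r)`
  obtain ⟨t, ht1, ht2, ht3, ht4⟩ : ∃ t : ℝ, -(1 / 2) ≤ t ∧ t ≤ 1 / 2 ∧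
      σ * (1 + t) ≤ 1 - bary2 q ∧ σ * (1 - t) ≤ 1 - bary3 q := by
    by_cases h : 1 - bary2 q ≤ 3 / 2 * σ
    · refine ⟨(1 - bary2 q) / σ - 1, ?_, ?_, ?_, ?_⟩
      · have : 1 / 2 ≤ (1 - bary2 q) / σ := by rw [le_div_iff₀ hσ0]; linarith
        linarith
      · have : (1 - bary2 q) / σ ≤ 3 / 2 := by rw [div_le_iff₀ hσ0]; linarith
        linarith
      · apply le_of_eq; field_simp; ring
      · have : σ * ((1 - bary2 q) / σ) = 1 - bary2 q := by field_simp
        linarith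
    · push Not at h
      exact ⟨1 / 2, by norm_num, le_rfl, by linarith, by linarith⟩
  refine mem_of_apex hK h2 h3 (hg t ht1 ht2) hσ0.le ?_ ?_ ?_
  · have : bary1 ![1 - 3 / r, Real.sqrt 3 * (t / r)] = (r - 2) / r := by
      simp [bary1]; field_simp; ring
    rw [b1, this, mul_div_assoc']
    congr 1
    linarith
  · rw [b2, le_div_iff₀ hr]
    have : σ * bary2 ![1 - 3 / r, Real.sqrt 3 * (t / r)] * r = σ * (1 + t) := by
      simp [bary2]; field_simp; linear_combination t * hs
    linarith
  · rw [b3, le_div_iff₀ hr]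
    have : σ * bary3 ![1 - 3 / r, Real.sqrt 3 * (t / r)] * r = σ * (1 - t) := by
      simp [bary3]; field_simp; linear_combination -t * hs
    linarith

/-- A triangle of maximal area in a convex body, labelled so that the first barycentric
coordinate of a given point is the smallest. -/
lemma exists_maximal_triangle {L : Set (Fin 2 → ℝ)} (hL : IsConvexBody L) (c : Fin 2 → ℝ) :
    ∃ p₁ ∈ L, ∃ p₂ ∈ L, ∃ p₃ ∈ L, 0 < signedArea p₁ p₂ p₃ ∧
      (∀ q ∈ L, signedArea q p₂ p₃ ≤ signedArea p₁ p₂ p₃ ∧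
        signedArea p₁ q p₃ ≤ signedArea p₁ p₂ p₃ ∧
        signedArea p₁ p₂ q ≤ signedArea p₁ p₂ p₃) ∧
      signedArea c p₂ p₃ ≤ signedArea p₁ c p₃ ∧ signedArea c p₂ p₃ ≤ signedArea p₁ p₂ c := by
  obtain ⟨-, hcomp, a, ha⟩ := hL
  have hcont : Continuous fun t : (Fin 2 → ℝ) × (Fin 2 → ℝ) × (Fin 2 → ℝ) =>
      signedArea t.1 t.2.1 t.2.2 := by
    unfold signedArea; fun_prop
  obtain ⟨⟨p₁, p₂, p₃⟩, ⟨h1, h2, h3⟩, hmax⟩ :=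
    (hcomp.prod (hcomp.prod hcomp)).exists_isMaxOn
      ⟨(a, a, a), interior_subset ha, interior_subset ha, interior_subset ha⟩ hcont.continuousOn
  have hmax' : ∀ x ∈ L, ∀ y ∈ L, ∀ z ∈ L, signedArea x y z ≤ signedArea p₁ p₂ p₃ :=
    fun x hx y hy z hz => hmax (show (x, y, z) ∈ L ×ˢ L ×ˢ L from ⟨hx, hy, hz⟩)
  have hpos : 0 < signedArea p₁ p₂ p₃ := by
    obtain ⟨ε, hε, hball⟩ := Metric.isOpen_iff.1 isOpen_interior a ha
    have hmem : ∀ v : Fin 2 → ℝ, ‖v‖ < ε → a + v ∈ L := fun v hv =>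
      interior_subset (hball (by simpa [dist_eq_norm] using hv))
    have hn : ∀ v : Fin 2 → ℝ, (∀ i, |v i| ≤ ε / 2) → ‖v‖ < ε := fun v hv =>
      lt_of_le_of_lt ((pi_norm_le_iff_of_nonneg (by linarith)).2 hv) (by linarith)
    refine lt_of_lt_of_le ?_ (hmax' a (interior_subset ha)
      (a + ![ε / 2, 0]) (hmem _ (hn _ ?_)) (a + ![0, ε / 2]) (hmem _ (hn _ ?_)))
    · simp [signedArea]; positivity
    · intro i; fin_cases i <;> simp [abs_of_pos (half_pos hε), (half_pos hε).le]
    · intro i; fin_cases i <;> simp [abs_of_pos (half_pos hε), (half_pos hε).le]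
  have hrot : ∀ x y z, signedArea x y z = signedArea y z x := fun x y z => by
    simp only [signedArea]; ring
  have key : ∀ x ∈ L, ∀ y ∈ L, ∀ z ∈ L, signedArea x y z = signedArea p₁ p₂ p₃ →
      signedArea c y z ≤ signedArea x c z → signedArea c y z ≤ signedArea x y c →
      ∃ p₁ ∈ L, ∃ p₂ ∈ L, ∃ p₃ ∈ L, 0 < signedArea p₁ p₂ p₃ ∧
      (∀ q ∈ L, signedArea q p₂ p₃ ≤ signedArea p₁ p₂ p₃ ∧
        signedArea p₁ q p₃ ≤ signedArea p₁ p₂ p₃ ∧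
        signedArea p₁ p₂ q ≤ signedArea p₁ p₂ p₃) ∧
      signedArea c p₂ p₃ ≤ signedArea p₁ c p₃ ∧
      signedArea c p₂ p₃ ≤ signedArea p₁ p₂ c := by
    intro x hx y hy z hz he hxy hxz
    refine ⟨x, hx, y, hy, z, hz, by rwa [he], fun q hq => ?_, hxy, hxz⟩
    rw [he]
    exact ⟨hmax' _ hq _ hy _ hz, hmax' _ hx _ hq _ hz, hmax' _ hx _ hy _ hq⟩
  have r1 : signedArea c p₃ p₁ = signedArea p₁ c p₃ := by rw [hrot, hrot]
  have r2 : signedArea p₂ c p₁ = signedArea p₁ p₂ c := by rw [hrot, hrot]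
  have r3 : signedArea p₂ p₃ c = signedArea c p₂ p₃ := by rw [hrot, hrot]
  have r4 : signedArea c p₁ p₂ = signedArea p₁ p₂ c := hrot _ _ _
  have r5 : signedArea p₃ c p₂ = signedArea c p₂ p₃ := hrot _ _ _
  have r6 : signedArea p₃ p₁ c = signedArea p₁ c p₃ := hrot _ _ _
  rcases le_total (signedArea c p₂ p₃) (signedArea p₁ c p₃) with hA | hA <;>
  rcases le_total (signedArea c p₂ p₃) (signedArea p₁ p₂ c) with hB | hB <;>
  rcases le_total (signedArea p₁ c p₃) (signedArea p₁ p₂ c) with hC | hC <;>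
  first
  | exact key p₁ h1 p₂ h2 p₃ h3 rfl (by linarith) (by linarith)
  | exact key p₂ h2 p₃ h3 p₁ h1 (hrot _ _ _).symm (by linarith) (by linarith)
  | exact key p₃ h3 p₁ h1 p₂ h2 (hrot _ _ _) (by linarith) (by linarith)

/-- The linear part of the affine map sending the triangle `p₁ p₂ p₃` to `u1 u2 u3`. -/
def triangleLinear (p₁ p₂ p₃ : Fin 2 → ℝ) : (Fin 2 → ℝ) →ₗ[ℝ] (Fin 2 → ℝ) where
  toFun x :=
    ((x 0 * (p₂ 1 - p₃ 1) - x 1 * (p₂ 0 - p₃ 0)) / signedArea p₁ p₂ p₃) • u1 +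
    ((x 0 * (p₃ 1 - p₁ 1) - x 1 * (p₃ 0 - p₁ 0)) / signedArea p₁ p₂ p₃) • u2 +
    ((x 0 * (p₁ 1 - p₂ 1) - x 1 * (p₁ 0 - p₂ 0)) / signedArea p₁ p₂ p₃) • u3
  map_add' x y := by simp only [Pi.add_apply]; module
  map_smul' a x := by simp only [Pi.smul_apply, smul_eq_mul, RingHom.id_apply]; module

lemma triangleLinear_add {p₁ p₂ p₃ : Fin 2 → ℝ} (x : Fin 2 → ℝ) :
    triangleLinear p₁ p₂ p₃ x + ((signedArea 0 p₂ p₃ / signedArea p₁ p₂ p₃) • u1 +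
      (signedArea p₁ 0 p₃ / signedArea p₁ p₂ p₃) • u2 +
      (signedArea p₁ p₂ 0 / signedArea p₁ p₂ p₃) • u3) =
    (signedArea x p₂ p₃ / signedArea p₁ p₂ p₃) • u1 +
      (signedArea p₁ x p₃ / signedArea p₁ p₂ p₃) • u2 +
      (signedArea p₁ p₂ x / signedArea p₁ p₂ p₃) • u3 := by
  have e1 : signedArea x p₂ p₃ =
      x 0 * (p₂ 1 - p₃ 1) - x 1 * (p₂ 0 - p₃ 0) + signedArea 0 p₂ p₃ := by
    simp [signedArea]; ring
  have e2 : signedArea p₁ x p₃ =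
      x 0 * (p₃ 1 - p₁ 1) - x 1 * (p₃ 0 - p₁ 0) + signedArea p₁ 0 p₃ := by
    simp [signedArea]; ring
  have e3 : signedArea p₁ p₂ x =
      x 0 * (p₁ 1 - p₂ 1) - x 1 * (p₁ 0 - p₂ 0) + signedArea p₁ p₂ 0 := by
    simp [signedArea]; ring
  simp only [e1, e2, e3, add_div]
  simp only [triangleLinear, LinearMap.coe_mk, AddHom.coe_mk]
  module

/-- The affine map sending a nondegenerate triangle to `u1 u2 u3`. -/
lemma exists_affine_normalization {p₁ p₂ p₃ : Fin 2 → ℝ} (h : signedArea p₁ p₂ p₃ ≠ 0) :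
    ∃ (T : (Fin 2 → ℝ) ≃ₗ[ℝ] (Fin 2 → ℝ)) (d : Fin 2 → ℝ), ∀ x,
      bary1 (T x + d) = signedArea x p₂ p₃ / signedArea p₁ p₂ p₃ ∧
      bary2 (T x + d) = signedArea p₁ x p₃ / signedArea p₁ p₂ p₃ ∧
      bary3 (T x + d) = signedArea p₁ p₂ x / signedArea p₁ p₂ p₃ := by
  obtain ⟨d, hd⟩ : ∃ d : Fin 2 → ℝ, ∀ x,
      bary1 (triangleLinear p₁ p₂ p₃ x + d) = signedArea x p₂ p₃ / signedArea p₁ p₂ p₃ ∧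
      bary2 (triangleLinear p₁ p₂ p₃ x + d) = signedArea p₁ x p₃ / signedArea p₁ p₂ p₃ ∧
      bary3 (triangleLinear p₁ p₂ p₃ x + d) = signedArea p₁ p₂ x / signedArea p₁ p₂ p₃ := by
    refine ⟨(signedArea 0 p₂ p₃ / signedArea p₁ p₂ p₃) • u1 +
      (signedArea p₁ 0 p₃ / signedArea p₁ p₂ p₃) • u2 +
      (signedArea p₁ p₂ 0 / signedArea p₁ p₂ p₃) • u3, fun x => ?_⟩
    rw [triangleLinear_add]
    apply bary_of_comb
    rw [← add_div, ← add_div, div_eq_one_iff_eq h]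
    simp only [signedArea]; ring
  have hinj : Function.Injective (triangleLinear p₁ p₂ p₃) := by
    intro x y hxy
    obtain ⟨a1, a2, a3⟩ := hd x
    obtain ⟨b1, b2, b3⟩ := hd y
    rw [hxy] at a1 a2 a3
    have f1 := a1.symm.trans b1
    have f2 := a2.symm.trans b2
    have f3 := a3.symm.trans b3
    rw [div_left_inj' h] at f1 f2 f3
    have g : ∀ (z : Fin 2 → ℝ) (i), z i * signedArea p₁ p₂ p₃ = signedArea z p₂ p₃ * p₁ i +
        signedArea p₁ z p₃ * p₂ i + signedArea p₁ p₂ z * p₃ i := by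
      intro z i
      fin_cases i <;> simp only [signedArea, Fin.zero_eta, Fin.mk_one] <;> ring
    ext i
    apply mul_right_cancel₀ h
    rw [g x, g y, f1, f2, f3]
  exact ⟨LinearEquiv.ofInjectiveEndo _ hinj, d, hd⟩

lemma bary_reflect (C y : Fin 2 → ℝ) : bary1 ((2 : ℝ) • C - y) = 2 * bary1 C - bary1 y ∧
    bary2 ((2 : ℝ) • C - y) = 2 * bary2 C - bary2 y ∧
    bary3 ((2 : ℝ) • C - y) = 2 * bary3 C - bary3 y := by
  refine ⟨?_, ?_, ?_⟩ <;> simp [bary1, bary2, bary3] <;> ring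

/-- A symmetric convex set in normalized position contains `K` and lies in `w - r K`. -/
lemma between_of_normalized {r : ℝ} (hr1 : 7/4 ≤ r) {K : Set (Fin 2 → ℝ)}
    (hK : Convex ℝ K) (h1 : u1 ∈ K) (h2 : u2 ∈ K) (h3 : u3 ∈ K)
    (hout : K ⊆ convexHull ℝ {-u1, u1, u2, u3})
    (hg : ∀ t, -(1 / 2) ≤ t → t ≤ 1 / 2 → ![1 - 3 / r, Real.sqrt 3 * (t / r)] ∈ K)
    {S : Set (Fin 2 → ℝ)} (hS : Convex ℝ S) (s1 : u1 ∈ S) (s2 : u2 ∈ S) (s3 : u3 ∈ S)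
    (hb : ∀ q ∈ S, bary1 q ≤ 1 ∧ bary2 q ≤ 1 ∧ bary3 q ≤ 1) {C : Fin 2 → ℝ}
    (hsym : ∀ q ∈ S, (2 : ℝ) • C - q ∈ S) (c12 : bary1 C ≤ bary2 C) (c13 : bary1 C ≤ bary3 C) :
    K ⊆ S ∧ ∀ q ∈ S, (1 / r) • ((r - 2) • u1 - q) ∈ K := by
  have hC := bary_sum C
  obtain ⟨-, v2, v3⟩ := bary_u1
  have d2 := (hb _ (hsym _ s1)).2.1
  have d3 := (hb _ (hsym _ s1)).2.2
  rw [(bary_reflect C u1).2.1, v2] at d2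
  rw [(bary_reflect C u1).2.2, v3] at d3
  constructor
  · intro y hy
    obtain ⟨k2, k3, k12, k13⟩ := bary_of_mem_kite (hout hy)
    by_cases hpos : 0 ≤ bary1 y
    · exact mem_of_bary_nonneg hS s1 s2 s3 hpos k2 k3
    push Not at hpos
    have hden : 0 < 1 - 2 * bary1 C := by linarith
    obtain ⟨s, hs⟩ : ∃ s, s = -bary1 y / (1 - 2 * bary1 C) := ⟨_, rfl⟩
    have hs0 : 0 ≤ s := by rw [hs]; exact div_nonneg (by linarith) hden.le
    have hse : s * (1 - 2 * bary1 C) = -bary1 y := by rw [hs]; field_simp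
    obtain ⟨e1, e2, e3⟩ := bary_reflect C u1
    rw [bary_u1.1] at e1
    rw [v2] at e2
    rw [v3] at e3
    refine mem_of_apex hS s2 s3 (hsym _ s1) hs0 ?_ ?_ ?_
    · rw [e1]; linarith
    · rw [e2]; nlinarith [mul_nonneg hs0 (sub_nonneg.2 c13)]
    · rw [e3]; nlinarith [mul_nonneg hs0 (sub_nonneg.2 c12)]
  · intro q hq
    obtain ⟨q1, q2, q3⟩ := hb q hq
    obtain ⟨-, q2', q3'⟩ := hb _ (hsym _ hq)
    rw [(bary_reflect C q).2.1] at q2'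
    rw [(bary_reflect C q).2.2] at q3'
    exact mem_neg_homothet hr1 hK h1 h2 h3 hg q1 q2 q3 (by linarith) (by linarith)

lemma exists_position {r : ℝ} (hr1 : 7/4 ≤ r) {K : Set (Fin 2 → ℝ)}
    (hK : Convex ℝ K) (h1 : u1 ∈ K) (h2 : u2 ∈ K) (h3 : u3 ∈ K)
    (hout : K ⊆ convexHull ℝ {-u1, u1, u2, u3})
    (hg : ∀ t, -(1 / 2) ≤ t → t ≤ 1 / 2 → ![1 - 3 / r, Real.sqrt 3 * (t / r)] ∈ K)
    {L : Set (Fin 2 → ℝ)} (hL : IsConvexBody L) {c : Fin 2 → ℝ}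
    (hc : ∀ x ∈ L, (2 : ℝ) • c - x ∈ L) :
    ∃ (T : (Fin 2 → ℝ) ≃ₗ[ℝ] (Fin 2 → ℝ)) (u v : Fin 2 → ℝ),
      (fun x => x + u) '' K ⊆ ⇑T '' ((fun x => x + v) '' L) ∧
      ⇑T '' ((fun x => x + v) '' L) ⊆ r • ((fun x => x + u) '' K) := by
  obtain ⟨p₁, hp₁, p₂, hp₂, p₃, hp₃, hpos, hmax, hc2, hc3⟩ := exists_maximal_triangle hL c
  obtain ⟨T, d, hT⟩ := exists_affine_normalization hpos.ne'
  have hv1 : T p₁ + d = u1 := by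
    obtain ⟨a1, a2, a3⟩ := hT p₁
    obtain ⟨b1, b2, b3⟩ := bary_u1
    refine bary_ext ?_ ?_ ?_
    · rw [a1, b1, div_self hpos.ne']
    · rw [a2, b2]; simp [signedArea]
    · rw [a3, b3]; simp [signedArea]
  have hv2 : T p₂ + d = u2 := by
    obtain ⟨a1, a2, a3⟩ := hT p₂
    obtain ⟨b1, b2, b3⟩ := bary_u2
    refine bary_ext ?_ ?_ ?_
    · rw [a1, b1]; simp [signedArea]
    · rw [a2, b2, div_self hpos.ne']
    · rw [a3, b3]; simp [signedArea]; left; ring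
  have hv3 : T p₃ + d = u3 := by
    obtain ⟨a1, a2, a3⟩ := hT p₃
    obtain ⟨b1, b2, b3⟩ := bary_u3
    refine bary_ext ?_ ?_ ?_
    · rw [a1, b1]; simp [signedArea]
    · rw [a2, b2]; simp [signedArea]; left; ring
    · rw [a3, b3, div_self hpos.ne']
  have hS : Convex ℝ ((fun x => T x + d) '' L) := by
    rintro _ ⟨x, hx, rfl⟩ _ ⟨y, hy, rfl⟩ a b ha hb hab
    refine ⟨a • x + b • y, hL.1 hx hy ha hb hab, ?_⟩
    obtain rfl : b = 1 - a := by linarith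
    simp only [map_add, map_smul]
    module
  have hsymT : ∀ x, (2 : ℝ) • (T c + d) - (T x + d) = T ((2 : ℝ) • c - x) + d := fun x => by
    simp only [map_sub, map_smul]
    module
  obtain ⟨hKS, hSK⟩ := between_of_normalized hr1 hK h1 h2 h3 hout hg hS
    ⟨p₁, hp₁, hv1⟩ ⟨p₂, hp₂, hv2⟩ ⟨p₃, hp₃, hv3⟩ (C := T c + d)
    (by
      rintro _ ⟨x, hx, rfl⟩
      obtain ⟨a1, a2, a3⟩ := hT x
      simp only [a1, a2, a3, div_le_one hpos]
      exact hmax x hx)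
    (by
      rintro _ ⟨x, hx, rfl⟩
      exact ⟨_, hc x hx, (hsymT x).symm⟩)
    (by rw [(hT c).1, (hT c).2.1]; gcongr)
    (by rw [(hT c).1, (hT c).2.2]; gcongr)
  have hr : r ≠ 0 := by linarith
  have hr' : r - 1 ≠ 0 := by linarith
  obtain ⟨u, hu⟩ : ∃ u, u = (1 / (r - 1)) • ((2 : ℝ) • (T c + d) - (r - 2) • u1) := ⟨_, rfl⟩
  have hu' : (r - 1) • u = (2 : ℝ) • (T c + d) - (r - 2) • u1 := by
    rw [hu, smul_smul, mul_one_div_cancel hr', one_smul]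
  have hTv : ∀ l, T (l + T.symm (d + u)) = T l + d + u := fun l => by
    rw [map_add, T.apply_symm_apply, add_assoc]
  refine ⟨T, u, T.symm (d + u), ?_, ?_⟩
  · rintro _ ⟨x, hx, rfl⟩
    obtain ⟨l, hl, rfl⟩ := hKS hx
    exact ⟨_, ⟨l, hl, rfl⟩, hTv l⟩
  · rintro _ ⟨_, ⟨l, hl, rfl⟩, rfl⟩
    refine ⟨_, ⟨_, hSK _ ⟨_, hc l hl, rfl⟩, rfl⟩, ?_⟩
    simp only [hTv, ← hsymT]
    rw [smul_add, smul_smul, mul_one_div_cancel hr, one_smul]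
    have : r • u = (r - 1) • u + u := by module
    rw [this, hu']
    module

lemma center_mem_interior {r : ℝ} (hr : 1 < r) {K : Set (Fin 2 → ℝ)}
    (hK : Convex ℝ K) (h1 : u1 ∈ K) (h2 : u2 ∈ K) (h3 : u3 ∈ K) :
    ((r - 2) / (r + 1)) • u1 ∈ interior K := by
  have hsub : {y : Fin 2 → ℝ | 0 < bary1 y ∧ 0 < bary2 y ∧ 0 < bary3 y} ⊆ K :=
    fun y hy => mem_of_bary_nonneg hK h1 h2 h3 hy.1.le hy.2.1.le hy.2.2.le
  have hopen : IsOpen {y : Fin 2 → ℝ | 0 < bary1 y ∧ 0 < bary2 y ∧ 0 < bary3 y} := by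
    have o1 : IsOpen {y : Fin 2 → ℝ | 0 < bary1 y} :=
      isOpen_lt continuous_const (by unfold bary1; fun_prop)
    have o2 : IsOpen {y : Fin 2 → ℝ | 0 < bary2 y} :=
      isOpen_lt continuous_const (by unfold bary2; fun_prop)
    have o3 : IsOpen {y : Fin 2 → ℝ | 0 < bary3 y} :=
      isOpen_lt continuous_const (by unfold bary3; fun_prop)
    exact o1.inter (o2.inter o3)
  refine interior_maximal hsub hopen ?_
  have e1 : bary1 (((r - 2) / (r + 1)) • u1) = (r - 1) / (r + 1) := by
    simp [bary1, u1]; field_simp; ring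
  have e2 : bary2 (((r - 2) / (r + 1)) • u1) = 1 / (r + 1) := by
    simp [bary2, u1]; field_simp; ring
  have e3 : bary3 (((r - 2) / (r + 1)) • u1) = 1 / (r + 1) := by
    simp [bary3, u1]; field_simp; ring
  refine ⟨?_, ?_, ?_⟩
  · rw [e1]; exact div_pos (by linarith) (by linarith)
  · rw [e2]; exact div_pos (by linarith) (by linarith)
  · rw [e3]; exact div_pos (by linarith) (by linarith)

/-- main construction of planar bodies equidistant to all symmetric
convex bodies. -/
theorem stmt13 (r k : ℝ) (hr1 : 7/4 ≤ r) (hr2 : r ≤ 2)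
    (hk : k ∈ Set.Icc (1 / (2 * r)) (2 - 3 / r))
    (K : Set (Fin 2 → ℝ)) (hK : IsConvexBody K)
    (hin : convexHull ℝ {u1, u2, u3} ⊆ K)
    (hout : K ⊆ convexHull ℝ {-u1, u1, u2, u3})
    (hseg : segment ℝ (((r - 3) / r + k) • u1 + (2 * k) • u2)
        (((r - 3) / r + k) • u1 + (2 * k) • u3) ⊆ frontier K)
    (hrefl : (fun x : Fin 2 → ℝ => (![x 0, -(x 1)] : Fin 2 → ℝ)) '' K = K) :
    asymConst K = r ∧
    ∀ L : Set (Fin 2 → ℝ), IsConvexBody L → IsSymmetricBody L → bmDist K L = r := by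
  have hr : 0 < r := by linarith
  have h1 : u1 ∈ K := hin (subset_convexHull ℝ _ (by simp))
  have h2 : u2 ∈ K := hin (subset_convexHull ℝ _ (by simp))
  have h3 : u3 ∈ K := hin (subset_convexHull ℝ _ (by simp))
  obtain ⟨hb1, hg⟩ := body_bounds hr1 hk.1 hK h1 hseg
  have hkite : ∀ y ∈ K, _ := fun y hy => bary_of_mem_kite (hout hy)
  have hlow : ∀ {ρ : ℝ}, 0 < ρ → ∀ {w : Fin 2 → ℝ},
      (∀ x ∈ K, ∃ y ∈ K, x + ρ • y = w) → r ≤ ρ := fun hρ _ hw =>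
    le_of_reflected_cover hr hρ h1 h2 h3 hb1 (fun y hy => (hkite y hy).1)
      (fun y hy => (hkite y hy).2.1) hw
  constructor
  · refine IsLeast.csInf_eq ⟨⟨hr, ((r - 2) / (r + 1)) • u1,
      center_mem_interior (by linarith) hK.1 h1 h2 h3, ?_⟩, ?_⟩
    · rintro _ ⟨p, hp, rfl⟩
      obtain ⟨k2, k3, k12, k13⟩ := hkite p hp
      have hps := bary_sum p
      refine ⟨_, ⟨_, mem_neg_homothet hr1 hK.1 h1 h2 h3 hg (q := p) (by linarith)
        (by linarith) (by linarith) (by linarith) (by linarith), rfl⟩, ?_⟩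
      have hr0 : r ≠ 0 := hr.ne'
      have hr1' : r + 1 ≠ 0 := by linarith
      ext i
      simp
      field_simp
      ring
    · rintro ρ ⟨hρ, z, -, hz⟩
      refine hlow hρ (w := (1 + ρ) • z) fun x hx => ?_
      obtain ⟨_, ⟨y, hy, rfl⟩, he⟩ := hz ⟨x, hx, rfl⟩
      refine ⟨y, hy, ?_⟩
      simp only at he
      rw [eq_add_of_sub_eq he.symm]
      module
  · rintro L hL ⟨c, hc⟩
    have hc' : ∀ x ∈ L, (2 : ℝ) • c - x ∈ L := fun x hx => by
      rw [hc]; exact ⟨x, hx, rfl⟩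
    refine IsLeast.csInf_eq
      ⟨⟨hr, exists_position hr1 hK.1 h1 h2 h3 hout hg hL hc'⟩, ?_⟩
    rintro ρ ⟨hρ, T, u, v, hKL, hLK⟩
    refine hlow hρ (w := T ((2 : ℝ) • c + (2 : ℝ) • v) - u - ρ • u) fun x hx => ?_
    obtain ⟨_, ⟨l, hl, rfl⟩, he⟩ := hKL ⟨x, hx, rfl⟩
    obtain ⟨_, ⟨y, hy, rfl⟩, he'⟩ := hLK ⟨_, ⟨_, hc' l hl, rfl⟩, rfl⟩
    refine ⟨y, hy, ?_⟩
    have hsum : T ((2 : ℝ) • c + (2 : ℝ) • v) = T (l + v) + T ((2 : ℝ) • c - l + v) := by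
      rw [← map_add]; congr 1; module
    simp only at he he'
    rw [hsum, he, ← he']
    module
end
end

section
/- Let S = conv{u₁, u₂, u₃} and let L ⊆ ℝ² be a convex body that is symmetric about a point s, i.e. L = 2s − L, with s ∈ conv{0, u₂, u₃}. If S ⊆ L ⊆ −2·S, then −u₁ ∈ L. -/
open Set Pointwise

noncomputable section

/-- A point of a triangle with one vertex at the origin is a nonnegative combination of
the other two vertices. -/
theorem exists_nonneg_combination_of_mem_convexHull_zero {E : Type*} [AddCommGroup E]
    [Module ℝ E] {v w s : E} (hs : s ∈ convexHull ℝ {0, v, w}) :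
    ∃ a b : ℝ, 0 ≤ a ∧ 0 ≤ b ∧ s = a • v + b • w := by
  rw [convexHull_insert (by simp), convexHull_pair, mem_convexJoin] at hs
  obtain ⟨x, rfl, y, ⟨c, d, hc, hd, -, rfl⟩, e, f, -, hf, -, rfl⟩ := hs
  exact ⟨f * c, f * d, by positivity, by positivity, by module⟩

theorem u1_add_u2_add_u3 : u1 + u2 + u3 = 0 := by
  ext i
  fin_cases i <;> norm_num [u1, u2, u3]

/-- if `S = conv{u₁,u₂,u₃} ⊆ L ⊆ −2·S` for a convex body `L` symmetric
about a point `s ∈ conv{0, u₂, u₃}`, then `−u₁ ∈ L`. -/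
theorem stmt15 (L : Set (Fin 2 → ℝ)) (hL : IsConvexBody L) (s : Fin 2 → ℝ)
    (hs : s ∈ convexHull ℝ {0, u2, u3})
    (hsym : L = (fun x => (2 : ℝ) • s - x) '' L)
    (h1 : convexHull ℝ {u1, u2, u3} ⊆ L)
    (h2 : L ⊆ (-2 : ℝ) • convexHull ℝ {u1, u2, u3}) :
    -u1 ∈ L := by
  obtain ⟨a, b, ha, hb, rfl⟩ := exists_nonneg_combination_of_mem_convexHull_zero hs
  have hu1 : u1 ∈ L := h1 (subset_convexHull ℝ _ (by simp))
  have hu2 : u2 ∈ L := h1 (subset_convexHull ℝ _ (by simp))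
  have hu3 : u3 ∈ L := h1 (subset_convexHull ℝ _ (by simp))
  have hrefl : (2 : ℝ) • (a • u2 + b • u3) - u1 ∈ L := by
    rw [hsym]
    exact mem_image_of_mem _ hu1
  have hpos : 0 < 1 + 2 * a + 2 * b := by positivity
  have hmem := hL.1.sum_mem (t := Finset.univ)
    (w := ![1 / (1 + 2 * a + 2 * b), 2 * b / (1 + 2 * a + 2 * b), 2 * a / (1 + 2 * a + 2 * b)])
    (z := ![(2 : ℝ) • (a • u2 + b • u3) - u1, u2, u3])
    (by intro i _; fin_cases i <;> simp <;> positivity)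
    (by simp only [Fin.sum_univ_three, Matrix.cons_val]; field_simp; ring)
    (by intro i _; fin_cases i; exacts [hrefl, hu2, hu3])
  simp only [Fin.sum_univ_three, Matrix.cons_val] at hmem
  convert hmem using 1
  have hu : u1 = -u2 - u3 := by
    rw [eq_sub_iff_add_eq, eq_neg_iff_add_eq_zero, add_right_comm, u1_add_u2_add_u3]
  rw [hu]
  match_scalars <;> field_simp <;> ring
end
end
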